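/- Let K ⊆ ℂ be a compact set whose complement Ω := ℂ∞ ∖ K is a finitely connected domain with C^∞ boundary. Then there exists a function ψ (a Garabedian function for Ω) with the following properties: (i) ψ ∈ A(Ω); (ii) ψ(∞) = 1/(2πi); (iii) g′(∞) = ∫_{∂Ω} g(ζ) ψ(ζ) dζ for all g ∈ A(Ω); (iv) ∫_{∂Ω} |ψ(ζ)| |dζ| = γ(K); (v) ψ has an analytic square root: there exists q ∈ A(Ω) with q(∞) = 1 and q(z)² = 2πi ψ(z) for all z in the closure of Ω. -/

import Mathlib

open Complex Filter Metric Set Topology Bornology MeasureTheory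

noncomputable section

/-- `f` has value `l` at infinity and derivative `w` at infinity (within the set `s`), i.e.
`f(z) → l` and `z (f(z) - l) → w` as `z → ∞` within `s`. -/
def HasDerivAtInftyOn (f : ℂ → ℂ) (s : Set ℂ) (l w : ℂ) : Prop :=
  Tendsto f (cobounded ℂ ⊓ 𝓟 s) (𝓝 l) ∧
    Tendsto (fun z => z * (f z - l)) (cobounded ℂ ⊓ 𝓟 s) (𝓝 w)

/-- The analytic capacity of a plane set `K`:
`γ(K) = sup { |f′(∞)| : f` holomorphic on `ℂ∞ ∖ K`, `‖f‖ ≤ 1 }`. -/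
def analyticCapacity (K : Set ℂ) : ℝ :=
  sSup { r : ℝ | ∃ (f : ℂ → ℂ) (l w : ℂ),
    DifferentiableOn ℂ f Kᶜ ∧ (∀ z ∈ Kᶜ, ‖f z‖ ≤ 1) ∧
    HasDerivAtInftyOn f Kᶜ l w ∧ r = ‖w‖ }

/-- Data exhibiting the boundary of a compact set `K ⊆ ℂ` as a finite union of pairwise
disjoint `C^∞` Jordan curves, positively oriented: each curve is a `1`-periodic regular `C^∞`
parametrization, injective on a period, the curve images are pairwise disjoint and their union
is the frontier of `K`, and the total winding number around every point of `interior K` is `1`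
(counterclockwise orientation). -/
structure SmoothBoundary (K : Set ℂ) where
  n : ℕ
  npos : 0 < n
  curve : Fin n → ℝ → ℂ
  smooth : ∀ i, ContDiff ℝ (⊤ : ℕ∞) (curve i)
  periodic : ∀ i, Function.Periodic (curve i) 1
  injOn : ∀ i, Set.InjOn (curve i) (Set.Ico (0:ℝ) 1)
  regular : ∀ i t, deriv (curve i) t ≠ 0
  boundary : (⋃ i, Set.range (curve i)) = frontier K
  disjointCurves : ∀ i j, i ≠ j → Disjoint (Set.range (curve i)) (Set.range (curve j))
  orientation : ∀ w ∈ interior K,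
    (∑ i, ∫ t in (0:ℝ)..1, deriv (curve i) t / (curve i t - w)) = 2 * Real.pi * Complex.I

/-- The contour integral `∫_{∂Ω} f(ζ) dζ` over a finite family of parametrized curves. -/
def contourIntegralOf {n : ℕ} (curve : Fin n → ℝ → ℂ) (f : ℂ → ℂ) : ℂ :=
  ∑ i, ∫ t in (0:ℝ)..1, f (curve i t) * deriv (curve i) t

/-- The arc-length integral `∫_{∂Ω} f(ζ) |dζ|` over a finite family of parametrized curves. -/
def arcIntegralOf {n : ℕ} (curve : Fin n → ℝ → ℂ) (f : ℂ → ℝ) : ℝ :=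
  ∑ i, ∫ t in (0:ℝ)..1, f (curve i t) * ‖deriv (curve i) t‖

/-- `f ∈ A(Ω)` with value `l` at `∞`, where `Ω = ℂ∞ ∖ K`: `f` is continuous on the closure of
`Ω` (whose finite part is `(interior K)ᶜ`), holomorphic on `Ω`, and `f(z) → l` as `z → ∞`. -/
def MemA (K : Set ℂ) (f : ℂ → ℂ) (l : ℂ) : Prop :=
  ContinuousOn f (interior K)ᶜ ∧ DifferentiableOn ℂ f Kᶜ ∧
    Tendsto f (cobounded ℂ ⊓ 𝓟 Kᶜ) (𝓝 l)

open scoped ContDiff Interval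

theorem cdiv {V : Type} [NormedAddCommGroup V] [NormedSpace ℝ V] {f g : V → ℂ}
    (hf : ContDiff ℝ ∞ f) (hg : ContDiff ℝ ∞ g) (h : ∀ x, g x ≠ 0) :
    ContDiff ℝ ∞ (fun x => f x / g x) := by
  simp only [div_eq_mul_inv]
  exact hf.mul (hg.inv h)

theorem cdivAt {V : Type} [NormedAddCommGroup V] [NormedSpace ℝ V] {f g : V → ℂ} {x : V}
    (hf : ContDiffAt ℝ ∞ f x) (hg : ContDiffAt ℝ ∞ g x) (h : g x ≠ 0) :
    ContDiffAt ℝ ∞ (fun x => f x / g x) x := by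
  simp only [div_eq_mul_inv]
  exact hf.mul (hg.inv h)

section ParamIntegral

variable {V : Type} [NormedAddCommGroup V] [NormedSpace ℝ V] [FiniteDimensional ℝ V]

theorem param_hasFDerivAt {G : Type} [NormedAddCommGroup G] [NormedSpace ℝ G] [CompleteSpace G]
    (w : ℝ → ℝ) (hw : IntervalIntegrable w volume 0 1)
    (f : V × ℝ → G) (hf : ContDiff ℝ ∞ f) (x₀ : V) :
    HasFDerivAt (fun x => ∫ θ in (0:ℝ)..1, w θ • f (x, θ))
      (∫ θ in (0:ℝ)..1, w θ • (fderiv ℝ f (x₀, θ)).comp (ContinuousLinearMap.inl ℝ V ℝ)) x₀ := by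
  have : ProperSpace V := FiniteDimensional.proper ℝ V
  have hcf' : Continuous (fun p : V × ℝ => (fderiv ℝ f p).comp (ContinuousLinearMap.inl ℝ V ℝ)) := by
    have := hf.continuous_fderiv (by simp)
    fun_prop
  have hcomp : IsCompact (closedBall x₀ 1 ×ˢ Icc (0:ℝ) 1) :=
    (isCompact_closedBall _ _).prod isCompact_Icc
  obtain ⟨M, hM⟩ := hcomp.exists_bound_of_continuousOn hcf'.continuousOn
  have hmeas : AEStronglyMeasurable w (volume.restrict (Ι (0:ℝ) 1)) := hw.def'.aestronglyMeasurable
  refine intervalIntegral.hasFDerivAt_integral_of_dominated_of_fderiv_le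
    (bound := fun θ => ‖w θ‖ * M) (s := closedBall x₀ 1)
    (F' := fun x θ => w θ • (fderiv ℝ f (x, θ)).comp (ContinuousLinearMap.inl ℝ V ℝ))
    (closedBall_mem_nhds _ one_pos) ?_ ?_ ?_ ?_ ?_ ?_
  · refine Eventually.of_forall fun x => hmeas.smul ?_
    exact (hf.continuous.comp (by fun_prop : Continuous fun θ : ℝ => (x, θ))).aestronglyMeasurable
  · exact hw.smul_continuousOn (hf.continuous.comp (by fun_prop : Continuous fun θ : ℝ => (x₀, θ))).continuousOn
  · refine hmeas.smul ?_
    exact (hcf'.comp (by fun_prop : Continuous fun θ : ℝ => (x₀, θ))).aestronglyMeasurable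
  · refine Eventually.of_forall fun θ hθ x hx => ?_
    rw [norm_smul]
    refine mul_le_mul_of_nonneg_left (hM (x, θ) ⟨hx, ?_⟩) (norm_nonneg _)
    rw [uIoc_of_le zero_le_one] at hθ
    exact ⟨hθ.1.le, hθ.2⟩
  · exact hw.norm.mul_const M
  · refine Eventually.of_forall fun θ hθ x hx => ?_
    have h1 : HasFDerivAt f (fderiv ℝ f (x, θ)) (x, θ) :=
      (hf.differentiable (by simp) _).hasFDerivAt
    have h2 : HasFDerivAt (fun x : V => (x, θ)) (ContinuousLinearMap.inl ℝ V ℝ) x :=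
      hasFDerivAt_prodMk_left x θ
    exact (h1.comp x h2).const_smul (w θ)

theorem param_contDiff_nat (w : ℝ → ℝ) (hw : IntervalIntegrable w volume 0 1) (n : ℕ) :
    ∀ {G : Type} [NormedAddCommGroup G] [NormedSpace ℝ G] [CompleteSpace G]
    (f : V × ℝ → G) (_ : ContDiff ℝ ∞ f),
    ContDiff ℝ n (fun x => ∫ θ in (0:ℝ)..1, w θ • f (x, θ)) := by
  induction n with
  | zero =>
    intro G _ _ _ f hf
    rw [Nat.cast_zero, contDiff_zero]
    exact continuous_iff_continuousAt.2 fun x => (param_hasFDerivAt w hw f hf x).continuousAt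
  | succ n ih =>
    intro G _ _ _ f hf
    rw [Nat.cast_succ, contDiff_succ_iff_fderiv]
    refine ⟨fun x => (param_hasFDerivAt w hw f hf x).differentiableAt, by simp, ?_⟩
    have : fderiv ℝ (fun x => ∫ θ in (0:ℝ)..1, w θ • f (x, θ)) = fun x =>
        ∫ θ in (0:ℝ)..1, w θ • (fun p => (fderiv ℝ f p).comp (ContinuousLinearMap.inl ℝ V ℝ)) (x, θ) := by
      ext1 x
      exact (param_hasFDerivAt w hw f hf x).fderiv
    rw [this]
    refine ih (fun p => (fderiv ℝ f p).comp (ContinuousLinearMap.inl ℝ V ℝ)) ?_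
    have h := hf.fderiv_right (m := ∞) (by simp)
    fun_prop

theorem param_contDiff {G : Type} [NormedAddCommGroup G] [NormedSpace ℝ G] [CompleteSpace G]
    (w : ℝ → ℝ) (hw : IntervalIntegrable w volume 0 1)
    (f : V × ℝ → G) (hf : ContDiff ℝ ∞ f) :
    ContDiff ℝ ∞ (fun x => ∫ θ in (0:ℝ)..1, w θ • f (x, θ)) :=
  contDiff_infty.2 fun n => param_contDiff_nat w hw n f hf

theorem param_contDiff' {G : Type} [NormedAddCommGroup G] [NormedSpace ℝ G] [CompleteSpace G]
    (f : V × ℝ → G) (hf : ContDiff ℝ ∞ f) :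
    ContDiff ℝ ∞ (fun x => ∫ θ in (0:ℝ)..1, f (x, θ)) := by
  simpa using param_contDiff (fun _ => 1) (by simp) f hf

/-- Smooth logarithm of a nonvanishing function on a vector space. -/
theorem exists_smooth_log (F : V → ℂ) (hF : ContDiff ℝ ∞ F) (h0 : ∀ x, F x ≠ 0) :
    ∃ L : V → ℂ, ContDiff ℝ ∞ L ∧ ∀ x, Complex.exp (L x) = F x := by
  let u : V × ℝ → ℂ := fun p => fderiv ℝ F (p.2 • p.1) p.1 / F (p.2 • p.1)
  have hu : ContDiff ℝ ∞ u := by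
    have h := hF.fderiv_right (m := ∞) (by simp)
    have h1 : ContDiff ℝ ∞ (fun p : V × ℝ => p.2 • p.1) := by fun_prop
    refine cdiv ?_ (hF.comp h1) (fun p => h0 _)
    exact (h.comp h1).clm_apply contDiff_fst
  refine ⟨fun x => Complex.log (F 0) + ∫ θ in (0:ℝ)..1, u (x, θ),
    contDiff_const.add (param_contDiff' u hu), fun x => ?_⟩
  have hux : Continuous fun θ : ℝ => u (x, θ) := hu.continuous.comp (by fun_prop)
  let φ : ℝ → ℂ := fun τ => Complex.exp (-∫ θ in (0:ℝ)..τ, u (x, θ)) * F (τ • x)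
  have hφ : ∀ τ, HasDerivAt φ 0 τ := by
    intro τ
    have h1 : HasDerivAt (fun τ => ∫ θ in (0:ℝ)..τ, u (x, θ)) (u (x, τ)) τ :=
      intervalIntegral.integral_hasDerivAt_right (hux.intervalIntegrable _ _)
        (hux.stronglyMeasurableAtFilter _ _) hux.continuousAt
    have h2 : HasDerivAt (fun τ : ℝ => F (τ • x)) (fderiv ℝ F (τ • x) x) τ := by
      have h3 : HasFDerivAt F (fderiv ℝ F (τ • x)) (τ • x) :=
        (hF.differentiable (by simp) _).hasFDerivAt
      have h4 : HasDerivAt (fun τ : ℝ => τ • x) x τ := by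
        simpa using (hasDerivAt_id τ).smul_const x
      exact h3.comp_hasDerivAt τ h4
    have := h1.neg.cexp.mul h2
    refine this.congr_deriv ?_
    have h5 : u (x, τ) * F (τ • x) = fderiv ℝ F (τ • x) x := by
      change fderiv ℝ F (τ • x) x / F (τ • x) * F (τ • x) = _
      field_simp [h0 (τ • x)]
    rw [← h5]
    ring
  have hconst : φ 1 = φ 0 := is_const_of_deriv_eq_zero (fun τ => (hφ τ).differentiableAt)
    (fun τ => (hφ τ).deriv) 1 0
  simp only [φ, one_smul, zero_smul, intervalIntegral.integral_same, neg_zero, Complex.exp_zero,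
    one_mul] at hconst
  rw [Complex.exp_add, Complex.exp_log (h0 0), ← hconst, mul_right_comm, ← Complex.exp_add]
  simp

end ParamIntegral

/-- `e(t) = exp(2π i t)`. -/
def ee (t : ℝ) : ℂ := Complex.exp (2 * Real.pi * Complex.I * t)

theorem ee_smooth : ContDiff ℝ ∞ ee := by
  unfold ee
  have : ContDiff ℝ ∞ (fun t : ℝ => (t : ℂ)) := Complex.ofRealCLM.contDiff
  fun_prop

theorem ee_ne_zero (t : ℝ) : ee t ≠ 0 := Complex.exp_ne_zero _

theorem ee_hasDerivAt (t : ℝ) : HasDerivAt ee (2 * Real.pi * Complex.I * ee t) t := by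
  have h : HasDerivAt (fun t : ℝ => (2 * Real.pi * Complex.I * t : ℂ)) (2 * Real.pi * Complex.I) t := by
    simpa using (Complex.ofRealCLM.hasDerivAt (x := t)).const_mul (2 * Real.pi * Complex.I : ℂ)
  have := h.cexp
  exact this.congr_deriv (mul_comm _ _)

theorem two_pi_I_ne : (2 * Real.pi * Complex.I : ℂ) ≠ 0 := Complex.two_pi_I_ne_zero

theorem ee_eq_iff (s t : ℝ) : ee s = ee t ↔ ∃ k : ℤ, s - t = k := by
  unfold ee
  rw [Complex.exp_eq_exp_iff_exists_int]
  refine exists_congr fun k => ?_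
  have : (2 * Real.pi * Complex.I * s : ℂ) = 2 * Real.pi * Complex.I * t + k * (2 * Real.pi * Complex.I) ↔
      (2 * Real.pi * Complex.I) * (s - t - k : ℂ) = 0 := by
    constructor
    · intro h; linear_combination h
    · intro h; linear_combination h
  rw [this, mul_eq_zero, or_iff_right two_pi_I_ne, sub_eq_zero]
  norm_cast

theorem ee_add_int (t : ℝ) (k : ℤ) : ee (t + k) = ee t := (ee_eq_iff _ _).2 ⟨k, by ring⟩
theorem ee_add_one (t : ℝ) : ee (t + 1) = ee t := by simpa using ee_add_int t 1

/-- Hadamard quotient. -/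
def hadq (F : ℝ × ℝ → ℂ) (k : ℤ) (p : ℝ × ℝ) : ℂ :=
  ∫ θ in (0:ℝ)..1, fderiv ℝ F (p.2 + k + θ * (p.1 - p.2 - k), p.2) (1, 0)

theorem hadq_smooth (F : ℝ × ℝ → ℂ) (hF : ContDiff ℝ ∞ F) (k : ℤ) : ContDiff ℝ ∞ (hadq F k) := by
  unfold hadq
  refine param_contDiff' (V := ℝ × ℝ) (fun q : (ℝ × ℝ) × ℝ =>
    fderiv ℝ F (q.1.2 + k + q.2 * (q.1.1 - q.1.2 - k), q.1.2) (1, 0)) ?_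
  have h := hF.fderiv_right (m := ∞) (by simp)
  refine ContDiff.clm_apply (h.comp ?_) contDiff_const
  fun_prop

theorem hadq_eq (F : ℝ × ℝ → ℂ) (hF : ContDiff ℝ ∞ F) (k : ℤ) (s t : ℝ) (h0 : F (t + k, t) = 0) :
    F (s, t) = ((s - t - k : ℝ) : ℂ) * hadq F k (s, t) := by
  have hd : ∀ θ : ℝ, HasDerivAt (fun θ : ℝ => F (t + k + θ * (s - t - k), t))
      (fderiv ℝ F (t + k + θ * (s - t - k), t) (s - t - k, 0)) θ := by
    intro θ
    have h3 := (hF.differentiable (by simp) (t + k + θ * (s - t - k), t)).hasFDerivAt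
    have h4 : HasDerivAt (fun θ : ℝ => ((t + k + θ * (s - t - k), t) : ℝ × ℝ)) (s - t - k, 0) θ := by
      refine HasDerivAt.prodMk ?_ (hasDerivAt_const _ _)
      simpa using ((hasDerivAt_id θ).mul_const (s - t - k)).const_add (t + k)
    exact h3.comp_hasDerivAt θ h4
  have hlin : ∀ θ : ℝ, fderiv ℝ F (t + k + θ * (s - t - k), t) (s - t - k, 0) =
      ((s - t - k : ℝ) : ℂ) * fderiv ℝ F (t + k + θ * (s - t - k), t) (1, 0) := by
    intro θ
    have : ((s - t - k, 0) : ℝ × ℝ) = (s - t - k) • ((1, 0) : ℝ × ℝ) := by simp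
    rw [this, map_smul]
    simp
  have hcont : Continuous fun θ : ℝ => fderiv ℝ F (t + k + θ * (s - t - k), t) (s - t - k, 0) := by
    have := hF.continuous_fderiv (by simp)
    exact (this.comp (by fun_prop : Continuous fun θ : ℝ => ((t + k + θ * (s - t - k), t) : ℝ × ℝ))).clm_apply
      continuous_const
  have := intervalIntegral.integral_eq_sub_of_hasDerivAt (a := 0) (b := 1) (fun θ _ => hd θ)
    (hcont.intervalIntegrable _ _)
  simp only [hlin] at this
  rw [intervalIntegral.integral_const_mul] at this
  unfold hadq
  rw [this]
  simp only [one_mul, zero_mul, add_zero, h0, sub_zero]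
  congr 2
  ring

theorem hadq_diag (F : ℝ × ℝ → ℂ) (k : ℤ) (s t : ℝ) (h : s - t = k) :
    hadq F k (s, t) = fderiv ℝ F (s, t) (1, 0) := by
  unfold hadq
  have h2 : t + k = s := by linarith
  simp [h, h2]

/-- Division lemma. -/
theorem exists_div_ee (F : ℝ × ℝ → ℂ) (hF : ContDiff ℝ ∞ F)
    (h0 : ∀ (s t : ℝ) (k : ℤ), s - t = k → F (s, t) = 0) :
    ∃ H : ℝ × ℝ → ℂ, ContDiff ℝ ∞ H ∧ (∀ s t : ℝ, F (s, t) = (ee s - ee t) * H (s, t)) ∧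
      ∀ (s t : ℝ) (k : ℤ), s - t = k → H (s, t) = fderiv ℝ F (s, t) (1, 0) / (2 * Real.pi * Complex.I * ee s) := by
  classical
  let D : ℝ × ℝ → ℂ := fun p => ee p.1 - ee p.2
  have hD : ContDiff ℝ ∞ D := (ee_smooth.comp contDiff_fst).sub (ee_smooth.comp contDiff_snd)
  have hDd : ∀ s t, fderiv ℝ D (s, t) (1, 0) = 2 * Real.pi * Complex.I * ee s := by
    intro s t
    have h3 := (hD.differentiable (by simp) (s, t)).hasFDerivAt
    have h4 : HasDerivAt (fun x : ℝ => ((x, t) : ℝ × ℝ)) (1, 0) s :=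
      (hasDerivAt_id s).prodMk (hasDerivAt_const _ _)
    have h5 := h3.comp_hasDerivAt s h4
    have h6 : HasDerivAt (D ∘ fun x : ℝ => ((x, t) : ℝ × ℝ)) (2 * Real.pi * Complex.I * ee s) s :=
      (ee_hasDerivAt s).sub_const (ee t)
    exact h5.unique h6
  let H : ℝ × ℝ → ℂ := fun p => if ∃ k : ℤ, p.1 - p.2 = k then
    fderiv ℝ F p (1, 0) / (2 * Real.pi * Complex.I * ee p.1) else F p / D p
  have hdiag : ∀ (s t : ℝ) (k : ℤ), s - t = k →
      H (s, t) = fderiv ℝ F (s, t) (1, 0) / (2 * Real.pi * Complex.I * ee s) := by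
    intro s t k h
    simp only [H]
    rw [if_pos ⟨k, h⟩]
  have hoff : ∀ s t : ℝ, (¬ ∃ k : ℤ, s - t = k) → H (s, t) = F (s, t) / D (s, t) := by
    intro s t h
    simp only [H]
    rw [if_neg h]
  have hDne : ∀ s t : ℝ, (¬ ∃ k : ℤ, s - t = k) → D (s, t) ≠ 0 := by
    intro s t h
    simp only [D, sub_ne_zero]
    rwa [Ne, ee_eq_iff]
  refine ⟨H, ?_, ?_, hdiag⟩
  · rw [contDiff_iff_contDiffAt]
    rintro ⟨s₀, t₀⟩
    by_cases h : ∃ k : ℤ, s₀ - t₀ = k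
    · obtain ⟨k, hk⟩ := h
      have hB : hadq D k (s₀, t₀) ≠ 0 := by
        rw [hadq_diag D k s₀ t₀ hk, hDd]
        exact mul_ne_zero two_pi_I_ne (ee_ne_zero _)
      have hA : ContDiffAt ℝ ∞ (fun p => hadq F k p / hadq D k p) (s₀, t₀) :=
        cdivAt (hadq_smooth F hF k).contDiffAt (hadq_smooth D hD k).contDiffAt hB
      refine hA.congr_of_eventuallyEq ?_
      have hopen : ∀ᶠ p : ℝ × ℝ in 𝓝 (s₀, t₀), |p.1 - p.2 - k| < 1 := by
        have hc : Continuous fun p : ℝ × ℝ => |p.1 - p.2 - k| := by fun_prop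
        refine hc.continuousAt.eventually_lt continuousAt_const ?_
        simp [hk]
      filter_upwards [hopen] with p hp
      obtain ⟨s, t⟩ := p
      simp only at hp
      by_cases h' : s - t = k
      · rw [hdiag s t k h', hadq_diag F k s t h', hadq_diag D k s t h', hDd]
      · have hne : ¬ ∃ k' : ℤ, s - t = k' := by
          rintro ⟨k', hk'⟩
          rw [hk'] at hp
          have : |(k' - k : ℤ)| < 1 := by exact_mod_cast hp
          have h9 := Int.abs_lt_one_iff.1 this
          exact h' (by rw [hk']; exact_mod_cast (sub_eq_zero.1 h9))
        have hn0 : ((s - t - k : ℝ) : ℂ) ≠ 0 := by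
          exact_mod_cast sub_ne_zero.2 h'
        rw [hoff s t hne, hadq_eq F hF k s t (h0 _ _ k (by ring)),
          hadq_eq D hD k s t (sub_eq_zero.2 (ee_add_int t k)), mul_div_mul_left _ _ hn0]
    · have hA : ContDiffAt ℝ ∞ (fun p => F p / D p) (s₀, t₀) :=
        cdivAt hF.contDiffAt hD.contDiffAt (hDne _ _ h)
      refine hA.congr_of_eventuallyEq ?_
      have hopen : ∀ᶠ p : ℝ × ℝ in 𝓝 (s₀, t₀), D p ≠ 0 :=
        hD.continuous.continuousAt.eventually_ne (hDne _ _ h)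
      filter_upwards [hopen] with p hp
      obtain ⟨s, t⟩ := p
      refine hoff s t fun hk => hp ?_
      simp only [D]
      exact sub_eq_zero.2 ((ee_eq_iff _ _).2 hk)
  · intro s t
    by_cases h : ∃ k : ℤ, s - t = k
    · obtain ⟨k, hk⟩ := h
      rw [h0 s t k hk, (ee_eq_iff s t).2 ⟨k, hk⟩]
      simp
    · rw [hoff s t h]
      have := hDne s t h
      simp only [D] at this ⊢
      field_simp

theorem const_of_exp_eq_one {V : Type} [NormedAddCommGroup V] [NormedSpace ℝ V] (f : V → ℂ)
    (hf : ContDiff ℝ ∞ f) (h : ∀ x, Complex.exp (f x) = 1) (x y : V) : f x = f y := by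
  have hd : Differentiable ℝ f := hf.differentiable (by simp)
  refine is_const_of_fderiv_eq_zero (𝕜 := ℝ) hd (fun x => ?_) x y
  have h1 := (hd x).hasFDerivAt.cexp
  have h2 : (fun x => Complex.exp (f x)) = fun _ => 1 := funext h
  rw [h2] at h1
  have h3 := h1.unique (hasFDerivAt_const _ _)
  rw [h x, one_smul] at h3
  exact h3

section OneCurve

theorem curve_add_int (C : ℝ → ℂ) (hper : Function.Periodic C 1) (t : ℝ) (k : ℤ) : C (t + k) = C t := by
  have := hper.int_mul k t
  simpa using this

theorem curve_eq_iff (C : ℝ → ℂ) (hper : Function.Periodic C 1)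
    (hinj : Set.InjOn C (Set.Ico (0:ℝ) 1)) (s t : ℝ) : C s = C t ↔ ∃ k : ℤ, s - t = k := by
  constructor
  · intro h
    have h1 : ∀ u : ℝ, C (Int.fract u) = C u := by
      intro u
      have := curve_add_int C hper (Int.fract u) ⌊u⌋
      rw [Int.fract_add_floor] at this
      exact this.symm
    have h2 : Int.fract s = Int.fract t := by
      apply hinj ⟨Int.fract_nonneg s, Int.fract_lt_one s⟩ ⟨Int.fract_nonneg t, Int.fract_lt_one t⟩
      rw [h1, h1, h]
    obtain ⟨k, hk⟩ := Int.fract_eq_fract.1 h2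
    exact ⟨k, hk⟩
  · rintro ⟨k, hk⟩
    have : s = t + k := by linarith
    rw [this, curve_add_int C hper]

theorem exists_chordLog (C : ℝ → ℂ) (hC : ContDiff ℝ ∞ C) (hper : Function.Periodic C 1)
    (hinj : Set.InjOn C (Set.Ico (0:ℝ) 1)) (hreg : ∀ t, deriv C t ≠ 0) : ∃ L : ℝ × ℝ → ℂ, ContDiff ℝ ∞ L ∧
    (∀ s t, C s - C t = (ee s - ee t) * Complex.exp (L (s, t))) ∧
    (∀ t, deriv C t = 2 * Real.pi * Complex.I * ee t * Complex.exp (L (t, t))) ∧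
    ∃ α : ℂ, Complex.exp α = 1 ∧ (∀ s t, L (s + 1, t) = L (s, t) + α) ∧
      (∀ s t, L (s, t + 1) = L (s, t) + α) := by
  let F : ℝ × ℝ → ℂ := fun p => C p.1 - C p.2
  have hF : ContDiff ℝ ∞ F := (hC.comp contDiff_fst).sub (hC.comp contDiff_snd)
  have hFd : ∀ s t, fderiv ℝ F (s, t) (1, 0) = deriv C s := by
    intro s t
    have h3 := (hF.differentiable (by simp) (s, t)).hasFDerivAt
    have h4 : HasDerivAt (fun x : ℝ => ((x, t) : ℝ × ℝ)) (1, 0) s :=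
      (hasDerivAt_id s).prodMk (hasDerivAt_const _ _)
    have h5 := h3.comp_hasDerivAt s h4
    have h6 : HasDerivAt (F ∘ fun x : ℝ => ((x, t) : ℝ × ℝ)) (deriv C s) s :=
      ((hC.differentiable (by simp) s).hasDerivAt).sub_const (C t)
    exact h5.unique h6
  obtain ⟨Q, hQ, hQe, hQd⟩ := exists_div_ee F hF
    (fun s t k h => sub_eq_zero.2 ((curve_eq_iff C hper hinj s t).2 ⟨k, h⟩))
  have hQ0 : ∀ p, Q p ≠ 0 := by
    rintro ⟨s, t⟩ h
    by_cases hk : ∃ k : ℤ, s - t = k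
    · obtain ⟨k, hk⟩ := hk
      rw [hQd s t k hk, hFd] at h
      exact div_ne_zero (hreg s) (mul_ne_zero two_pi_I_ne (ee_ne_zero _)) h
    · have := hQe s t
      rw [h, mul_zero] at this
      exact hk ((curve_eq_iff C hper hinj s t).1 (sub_eq_zero.1 this))
  obtain ⟨L, hL, hLe⟩ := exists_smooth_log Q hQ hQ0
  have hQper : ∀ s t, Q (s + 1, t) = Q (s, t) := by
    intro s t
    by_cases hk : ∃ k : ℤ, s - t = k
    · obtain ⟨k, hk⟩ := hk
      have hd1 : deriv C (s + 1) = deriv C s := by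
        have h1 : (fun x => C (x + 1)) = C := funext hper
        have h2 := deriv_comp_add_const C 1 s
        rw [h1] at h2
        exact h2.symm
      rw [hQd s t k hk, hQd (s + 1) t (k + 1) (by push_cast; linarith), hFd, hFd, hd1, ee_add_one]
    · have hne : ee s - ee t ≠ 0 := by
        rw [sub_ne_zero, Ne, ee_eq_iff]; exact hk
      have h1 := hQe s t
      have h2 := hQe (s + 1) t
      simp only [F] at h1 h2
      rw [hper s, ee_add_one, h1] at h2
      exact (mul_left_cancel₀ hne h2).symm
  have hQsym : ∀ s t, Q (s, t) = Q (t, s) := by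
    intro s t
    by_cases hk : ∃ k : ℤ, s - t = k
    · obtain ⟨k, hk⟩ := hk
      have hst : s = t + k := by linarith
      have hd1 : deriv C (t + k) = deriv C t := by
        have h1 : (fun x => C (x + k)) = C := funext fun x => curve_add_int C hper x k
        have h2 := deriv_comp_add_const C k t
        rw [h1] at h2
        exact h2.symm
      rw [hQd s t k hk, hQd t s (-k) (by push_cast; linarith), hFd, hFd, hst, hd1, ee_add_int]
    · have hne : ee s - ee t ≠ 0 := by
        rw [sub_ne_zero, Ne, ee_eq_iff]; exact hk
      have h1 := hQe s t
      have h2 := hQe t s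
      simp only [F] at h1 h2
      apply mul_left_cancel₀ hne
      linear_combination -h1 - h2
  have hLsym : ∀ s t, L (s, t) = L (t, s) := by
    intro s t
    have h := const_of_exp_eq_one (V := ℝ × ℝ) (fun p => L p - L (p.2, p.1))
      (hL.sub (hL.comp (contDiff_snd.prodMk contDiff_fst)))
      (fun p => by
        rw [Complex.exp_sub, hLe, hLe, hQsym p.2 p.1]
        exact div_self (hQ0 _)) (s, t) (0, 0)
    simp only [sub_self] at h
    exact sub_eq_zero.1 h
  have hLp : ∀ s t, L (s + 1, t) = L (s, t) + (L (1, 0) - L (0, 0)) := by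
    intro s t
    have h := const_of_exp_eq_one (V := ℝ × ℝ) (fun p => L (p.1 + 1, p.2) - L p)
      ((hL.comp (f := fun p : ℝ × ℝ => (p.1 + 1, p.2)) (by fun_prop)).sub hL)
      (fun p => by
        rw [Complex.exp_sub, hLe, hLe, hQper]
        exact div_self (hQ0 _)) (s, t) (0, 0)
    simp only [zero_add] at h
    linear_combination h
  refine ⟨L, hL, fun s t => by rw [hLe]; exact hQe s t, fun t => ?_, L (1, 0) - L (0, 0), ?_, hLp,
    fun s t => ?_⟩
  · rw [hLe, hQd t t 0 (by simp), hFd]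
    have := ee_ne_zero t
    have := two_pi_I_ne
    field_simp
  · rw [Complex.exp_sub, hLe, hLe]
    have := hQper 0 0
    rw [zero_add] at this
    rw [this]
    exact div_self (hQ0 _)
  · rw [hLsym, hLp, hLsym]

end OneCurve

namespace SmoothBoundary

variable {K : Set ℂ} (B : SmoothBoundary K)

theorem exists_L (i : Fin B.n) : ∃ L : ℝ × ℝ → ℂ, ContDiff ℝ ∞ L ∧
    (∀ s t, B.curve i s - B.curve i t = (ee s - ee t) * Complex.exp (L (s, t))) ∧
    (∀ t, deriv (B.curve i) t = 2 * Real.pi * Complex.I * ee t * Complex.exp (L (t, t))) ∧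
    ∃ α : ℂ, Complex.exp α = 1 ∧ (∀ s t, L (s + 1, t) = L (s, t) + α) ∧
      (∀ s t, L (s, t + 1) = L (s, t) + α) := exists_chordLog (B.curve i) (B.smooth i) (B.periodic i) (B.injOn i)
  (B.regular i)

/-- Chord logarithm. -/
def L (i : Fin B.n) : ℝ × ℝ → ℂ := (B.exists_L i).choose
theorem L_smooth (i : Fin B.n) : ContDiff ℝ ∞ (B.L i) := (B.exists_L i).choose_spec.1
theorem chord (i : Fin B.n) (s t : ℝ) :
    B.curve i s - B.curve i t = (ee s - ee t) * Complex.exp (B.L i (s, t)) :=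
  (B.exists_L i).choose_spec.2.1 s t
theorem deriv_eq (i : Fin B.n) (t : ℝ) :
    deriv (B.curve i) t = 2 * Real.pi * Complex.I * ee t * Complex.exp (B.L i (t, t)) :=
  (B.exists_L i).choose_spec.2.2.1 t
/-- Period of the chord logarithm. -/
def alp (i : Fin B.n) : ℂ := (B.exists_L i).choose_spec.2.2.2.choose
theorem exp_alp (i : Fin B.n) : Complex.exp (B.alp i) = 1 :=
  (B.exists_L i).choose_spec.2.2.2.choose_spec.1
theorem L_left (i : Fin B.n) (s t : ℝ) : B.L i (s + 1, t) = B.L i (s, t) + B.alp i :=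
  (B.exists_L i).choose_spec.2.2.2.choose_spec.2.1 s t
theorem L_right (i : Fin B.n) (s t : ℝ) : B.L i (s, t + 1) = B.L i (s, t) + B.alp i :=
  (B.exists_L i).choose_spec.2.2.2.choose_spec.2.2 s t

theorem expL_left (i : Fin B.n) (s t : ℝ) :
    Complex.exp (B.L i (s + 1, t)) = Complex.exp (B.L i (s, t)) := by
  rw [L_left, Complex.exp_add, exp_alp, mul_one]
theorem expL_right (i : Fin B.n) (s t : ℝ) :
    Complex.exp (B.L i (s, t + 1)) = Complex.exp (B.L i (s, t)) := by
  rw [L_right, Complex.exp_add, exp_alp, mul_one]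

/-- Logarithm of the half-density `E`. -/
def logE (i : Fin B.n) (t : ℝ) : ℂ :=
  Complex.log (2 * Real.pi * Complex.I) / 2 + Real.pi * Complex.I * t + B.L i (t, t) / 2

theorem logE_smooth (i : Fin B.n) : ContDiff ℝ ∞ (B.logE i) := by
  unfold logE
  have h1 : ContDiff ℝ ∞ (fun t : ℝ => (t : ℂ)) := Complex.ofRealCLM.contDiff
  have h2 : ContDiff ℝ ∞ (fun t : ℝ => B.L i (t, t)) := (B.L_smooth i).comp (contDiff_id.prodMk contDiff_id)
  exact (contDiff_const.add (contDiff_const.mul h1)).add (h2.div_const 2)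

theorem logE_add_one (i : Fin B.n) (t : ℝ) :
    B.logE i (t + 1) = B.logE i t + Real.pi * Complex.I + B.alp i := by
  unfold logE
  rw [L_left, L_right]
  push_cast
  ring

/-- Square root of the derivative of the curve. -/
def E (i : Fin B.n) (t : ℝ) : ℂ := Complex.exp (B.logE i t)

theorem E_smooth (i : Fin B.n) : ContDiff ℝ ∞ (B.E i) := (B.logE_smooth i).cexp
theorem E_ne (i : Fin B.n) (t : ℝ) : B.E i t ≠ 0 := Complex.exp_ne_zero _
theorem E_sq (i : Fin B.n) (t : ℝ) : B.E i t ^ 2 = deriv (B.curve i) t := by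
  unfold E
  rw [← Complex.exp_nat_mul, deriv_eq]
  unfold logE ee
  have h : (((2 : ℕ) : ℂ) * (Complex.log (2 * Real.pi * Complex.I) / 2 + Real.pi * Complex.I * t + B.L i (t, t) / 2))
      = Complex.log (2 * Real.pi * Complex.I) + 2 * Real.pi * Complex.I * t + B.L i (t, t) := by
    push_cast
    ring
  rw [h, Complex.exp_add, Complex.exp_add, Complex.exp_log two_pi_I_ne]
theorem E_add_one (i : Fin B.n) (t : ℝ) : B.E i (t + 1) = - B.E i t := by
  unfold E
  rw [logE_add_one, Complex.exp_add, Complex.exp_add, exp_alp, Complex.exp_pi_mul_I]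
  ring

theorem curve_iff (i : Fin B.n) (s t : ℝ) : B.curve i s = B.curve i t ↔ ∃ k : ℤ, s - t = k :=
  curve_eq_iff _ (B.periodic i) (B.injOn i) s t

theorem curve_ne (i j : Fin B.n) (h : j ≠ i) (s t : ℝ) : B.curve j s - B.curve i t ≠ 0 := by
  rw [sub_ne_zero]
  intro h2
  exact Set.disjoint_left.1 (B.disjointCurves j i h) ⟨s, rfl⟩ ⟨t, h2.symm⟩

theorem curve_diff (i : Fin B.n) : Differentiable ℝ (B.curve i) :=
  (B.smooth i).differentiable (by simp)
theorem curve_hasDeriv (i : Fin B.n) (t : ℝ) :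
    HasDerivAt (B.curve i) (deriv (B.curve i) t) t := (B.curve_diff i t).hasDerivAt
theorem curve_cont (i : Fin B.n) : Continuous (B.curve i) := (B.smooth i).continuous
theorem dcurve_smooth (i : Fin B.n) : ContDiff ℝ ∞ (deriv (B.curve i)) :=
  (contDiff_infty_iff_deriv.1 (B.smooth i)).2
theorem dcurve_cont (i : Fin B.n) : Continuous (deriv (B.curve i)) := (B.dcurve_smooth i).continuous

/-- `∂_s L`. -/
def dL (i : Fin B.n) (s t : ℝ) : ℂ := fderiv ℝ (B.L i) (s, t) (1, 0)

theorem dL_smooth (i : Fin B.n) : ContDiff ℝ ∞ (fun p : ℝ × ℝ => B.dL i p.1 p.2) := by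
  have h := (B.L_smooth i).fderiv_right (m := ∞) (by simp)
  exact h.clm_apply contDiff_const

theorem L_hasDeriv (i : Fin B.n) (s t : ℝ) : HasDerivAt (fun s => B.L i (s, t)) (B.dL i s t) s := by
  have h3 := ((B.L_smooth i).differentiable (by simp) (s, t)).hasFDerivAt
  have h4 : HasDerivAt (fun x : ℝ => ((x, t) : ℝ × ℝ)) (1, 0) s :=
    (hasDerivAt_id s).prodMk (hasDerivAt_const _ _)
  exact h3.comp_hasDerivAt s h4

theorem int_dL (i : Fin B.n) (t a : ℝ) : ∫ s in a..(a + 1), B.dL i s t = B.alp i := by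
  have hc : Continuous fun s => B.dL i s t :=
    (B.dL_smooth i).continuous.comp (by fun_prop : Continuous fun s : ℝ => ((s, t) : ℝ × ℝ))
  rw [intervalIntegral.integral_eq_sub_of_hasDerivAt (fun s _ => B.L_hasDeriv i s t)
    (hc.intervalIntegrable _ _), L_left]
  ring

theorem deriv_div (i : Fin B.n) (s t : ℝ) (h : ¬ ∃ k : ℤ, s - t = k) :
    deriv (B.curve i) s / (B.curve i s - B.curve i t) =
      2 * Real.pi * Complex.I * (ee s / (ee s - ee t)) + B.dL i s t := by
  have hne : ee s - ee t ≠ 0 := by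
    rw [sub_ne_zero, Ne, ee_eq_iff]; exact h
  have h1 : HasDerivAt (fun s => B.curve i s - B.curve i t) (deriv (B.curve i) s) s :=
    (B.curve_hasDeriv i s).sub_const _
  have h2 := ((ee_hasDerivAt s).sub_const (ee t)).mul (B.L_hasDeriv i s t).cexp
  have h3 : (fun s => B.curve i s - B.curve i t) = ((fun s => ee s - ee t) * fun s => Complex.exp (B.L i (s, t))) :=
    funext fun s => B.chord i s t
  rw [h3] at h1
  rw [h1.unique h2, B.chord i s t]
  have := Complex.exp_ne_zero (B.L i (s, t))
  field_simp

theorem re_ee_div (s t : ℝ) (h : ¬ ∃ k : ℤ, s - t = k) : (ee s / (ee s - ee t)).re = 1 / 2 := by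
  have hne : ee s - ee t ≠ 0 := by
    rw [sub_ne_zero, Ne, ee_eq_iff]; exact h
  have hnorm : ∀ u : ℝ, (starRingEnd ℂ) (ee u) * ee u = 1 := by
    intro u
    unfold ee
    rw [← Complex.exp_conj, ← Complex.exp_add]
    have : (starRingEnd ℂ) (2 * Real.pi * Complex.I * u) = -(2 * Real.pi * Complex.I * u) := by
      simp [Complex.conj_ofNat]
    rw [this]
    simp
  have hs := hnorm s
  have ht := hnorm t
  have hne' : (starRingEnd ℂ) (ee s) - (starRingEnd ℂ) (ee t) ≠ 0 := by
    rw [← map_sub]; exact (map_ne_zero _).2 hne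
  have : ee s / (ee s - ee t) + (starRingEnd ℂ) (ee s / (ee s - ee t)) = 1 := by
    rw [map_div₀, map_sub]
    field_simp
    linear_combination hs - ht
  have h2 := congrArg Complex.re this
  rw [Complex.add_re, Complex.conj_re, Complex.one_re] at h2
  linarith

theorem im_deriv_div (i : Fin B.n) (s t : ℝ) (h : ¬ ∃ k : ℤ, s - t = k) :
    (deriv (B.curve i) s / (B.curve i s - B.curve i t)).im = Real.pi + (B.dL i s t).im := by
  rw [B.deriv_div i s t h]
  have := re_ee_div s t h
  simp [this]
  ring

end SmoothBoundary

theorem param_cont {X : Type} [TopologicalSpace X] (F : X → ℝ → ℂ) (S : Set X) {a b : ℝ} (hab : a ≤ b)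
    (hF : ContinuousOn (Function.uncurry F) (S ×ˢ Icc a b)) :
    ContinuousOn (fun x => ∫ t in a..b, F x t) S := by
  rw [continuousOn_iff_continuous_domRestrict]
  have hc : Continuous (Function.uncurry fun (x : S) (t : ℝ) => F x (projIcc a b hab t)) := by
    have : Continuous fun p : S × ℝ => ((p.1 : X), (projIcc a b hab p.2 : ℝ)) := by fun_prop
    exact hF.comp_continuous this fun p => ⟨p.1.2, (projIcc a b hab p.2).2⟩
  have h2 := intervalIntegral.continuous_parametric_intervalIntegral_of_continuous' (μ := volume) hc a b
  refine h2.congr fun x => ?_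
  refine intervalIntegral.integral_congr fun t ht => ?_
  rw [uIcc_of_le hab] at ht
  simp only [projIcc_of_mem hab ht]

theorem param_deriv {𝕜 : Type} [RCLike 𝕜] [NormedSpace 𝕜 ℂ] (F F' : 𝕜 → ℝ → ℂ) (U : Set 𝕜)
    (hU : IsOpen U) {a b : ℝ} (hab : a ≤ b)
    (hd : ∀ x ∈ U, ∀ t ∈ Icc a b, HasDerivAt (fun x => F x t) (F' x t) x)
    (hF : ContinuousOn (Function.uncurry F) (U ×ˢ Icc a b))
    (hF' : ContinuousOn (Function.uncurry F') (U ×ˢ Icc a b)) (x₀ : 𝕜) (hx₀ : x₀ ∈ U) :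
    HasDerivAt (fun x => ∫ t in a..b, F x t) (∫ t in a..b, F' x₀ t) x₀ := by
  have : ProperSpace 𝕜 := inferInstance
  obtain ⟨r, hr, hrU⟩ := Metric.nhds_basis_closedBall.mem_iff.1 (hU.mem_nhds hx₀)
  have hcomp : IsCompact (closedBall x₀ r ×ˢ Icc a b) := (isCompact_closedBall _ _).prod isCompact_Icc
  obtain ⟨M, hM⟩ := hcomp.exists_bound_of_continuousOn (hF'.mono (prod_mono hrU subset_rfl))
  have hslice : ∀ G : 𝕜 → ℝ → ℂ, ContinuousOn (Function.uncurry G) (U ×ˢ Icc a b) → ∀ x ∈ U,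
      ContinuousOn (G x) (Icc a b) := fun G hG x hx =>
    hG.comp (f := fun t : ℝ => (x, t)) (by fun_prop) fun t ht => ⟨hx, ht⟩
  have hsub : Ι a b ⊆ Icc a b := by rw [uIoc_of_le hab]; exact Ioc_subset_Icc_self
  have hmeas : ∀ G : 𝕜 → ℝ → ℂ, ContinuousOn (Function.uncurry G) (U ×ˢ Icc a b) → ∀ x ∈ U,
      AEStronglyMeasurable (G x) (volume.restrict (Ι a b)) := fun G hG x hx =>
    ((hslice G hG x hx).mono hsub).aestronglyMeasurable measurableSet_uIoc
  refine (intervalIntegral.hasDerivAt_integral_of_dominated_loc_of_deriv_le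
    (bound := fun _ => M) (closedBall_mem_nhds x₀ hr) ?_ ?_ (hmeas F' hF' x₀ hx₀) ?_ ?_ ?_).2
  · filter_upwards [hU.mem_nhds hx₀] with x hx using hmeas F hF x hx
  · exact ContinuousOn.intervalIntegrable (by rw [uIcc_of_le hab]; exact hslice F hF x₀ hx₀)
  · exact Eventually.of_forall fun t ht x hx => hM (x, t) ⟨hx, hsub ht⟩
  · simp
  · exact Eventually.of_forall fun t ht x hx => hd x (hrU hx) t (hsub ht)

/-- Cauchy transform of the density `φ` on the curve `γ`. -/
def ct (γ φ : ℝ → ℂ) (z : ℂ) : ℂ := ∫ t in (0:ℝ)..1, φ t / (γ t - z)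

section CT
variable {γ φ : ℝ → ℂ}

theorem ct_hasDerivAt (hγ : ContinuousOn γ (Icc 0 1)) (hφ : ContinuousOn φ (Icc 0 1)) {z : ℂ}
    (hz : z ∉ γ '' Icc 0 1) :
    HasDerivAt (ct γ φ) (∫ t in (0:ℝ)..1, φ t / (γ t - z) ^ 2) z := by
  have hU : IsOpen (γ '' Icc 0 1)ᶜ := (isCompact_Icc.image_of_continuousOn hγ).isClosed.isOpen_compl
  have hne : ∀ w ∈ (γ '' Icc (0:ℝ) 1)ᶜ, ∀ t ∈ Icc (0:ℝ) 1, γ t - w ≠ 0 := by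
    intro w hw t ht h
    exact hw ⟨t, ht, sub_eq_zero.1 h⟩
  have h1 : ContinuousOn (fun p : ℂ × ℝ => φ p.2) ((γ '' Icc 0 1)ᶜ ×ˢ Icc 0 1) :=
    hφ.comp continuousOn_snd fun p hp => hp.2
  have h2 : ContinuousOn (fun p : ℂ × ℝ => γ p.2 - p.1) ((γ '' Icc 0 1)ᶜ ×ˢ Icc 0 1) :=
    (hγ.comp continuousOn_snd fun p hp => hp.2).sub continuousOn_fst
  refine param_deriv (𝕜 := ℂ) (fun z t => φ t / (γ t - z)) (fun z t => φ t / (γ t - z) ^ 2) _ hU zero_le_one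
    ?_ ?_ ?_ z hz
  · intro w hw t ht
    have hn := hne w hw t ht
    have h3 : HasDerivAt (fun w => γ t - w) (-1) w := by
      simpa using (hasDerivAt_id w).const_sub (γ t)
    have := (h3.inv hn).const_mul (φ t)
    simp only [div_eq_mul_inv] at this ⊢
    refine this.congr_deriv ?_
    ring
  · exact h1.div h2 fun p hp => hne _ hp.1 _ hp.2
  · exact h1.div (h2.pow 2) fun p hp => pow_ne_zero _ (hne _ hp.1 _ hp.2)

theorem ct_mul_tendsto (hγ : ContinuousOn γ (Icc 0 1)) (hφ : ContinuousOn φ (Icc 0 1)) :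
    Tendsto (fun z => z * ct γ φ z) (cobounded ℂ) (𝓝 (-∫ t in (0:ℝ)..1, φ t)) := by
  obtain ⟨R, hR⟩ := isCompact_Icc.exists_bound_of_continuousOn hγ
  obtain ⟨M, hM⟩ := isCompact_Icc.exists_bound_of_continuousOn hφ
  have hR0 : 0 ≤ R := (norm_nonneg _).trans (hR 0 (by simp))
  have hM0 : 0 ≤ M := (norm_nonneg _).trans (hM 0 (by simp))
  have key : ∀ᶠ z in cobounded ℂ, ‖z * ct γ φ z - (-∫ t in (0:ℝ)..1, φ t)‖ ≤ (M * R) * (‖z‖ - R)⁻¹ := by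
    have : ∀ᶠ z : ℂ in cobounded ℂ, R < ‖z‖ := tendsto_norm_cobounded_atTop.eventually_gt_atTop R
    filter_upwards [this] with z hz
    have hne : ∀ t ∈ Icc (0:ℝ) 1, γ t - z ≠ 0 := by
      intro t ht h
      have := hR t ht
      rw [sub_eq_zero.1 h] at this
      linarith
    have hi1 : IntervalIntegrable (fun t => φ t / (γ t - z)) volume 0 1 := by
      apply ContinuousOn.intervalIntegrable
      rw [uIcc_of_le zero_le_one]
      exact hφ.div (hγ.sub continuousOn_const) hne
    have hi2 : IntervalIntegrable φ volume 0 1 := by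
      apply ContinuousOn.intervalIntegrable
      rwa [uIcc_of_le zero_le_one]
    have : z * ct γ φ z - (-∫ t in (0:ℝ)..1, φ t) = ∫ t in (0:ℝ)..1, φ t * γ t / (γ t - z) := by
      unfold ct
      rw [← intervalIntegral.integral_const_mul, sub_neg_eq_add,
        ← intervalIntegral.integral_add (hi1.const_mul z) hi2]
      refine intervalIntegral.integral_congr fun t ht => ?_
      rw [uIcc_of_le zero_le_one] at ht
      have := hne t ht
      field_simp
      ring
    rw [this]
    have hb := intervalIntegral.norm_integral_le_of_norm_le_const (a := (0:ℝ)) (b := 1)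
      (f := fun t => φ t * γ t / (γ t - z)) (C := (M * R) * (‖z‖ - R)⁻¹) (fun t ht => ?_)
    · simpa using hb
    · have ht : t ∈ Icc (0:ℝ) 1 := by
        rw [uIoc_of_le zero_le_one] at ht
        exact ⟨ht.1.le, ht.2⟩
      rw [norm_div, norm_mul, div_eq_mul_inv]
      have h1 : ‖z‖ - R ≤ ‖γ t - z‖ := by
        have := norm_sub_norm_le z (γ t)
        rw [norm_sub_rev]
        linarith [hR t ht]
      have h2 : 0 < ‖z‖ - R := by linarith
      gcongr
      · exact hM t ht
      · exact hR t ht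
  rw [tendsto_iff_norm_sub_tendsto_zero]
  refine squeeze_zero' (Eventually.of_forall fun _ => norm_nonneg _) key ?_
  have h1 : Tendsto (fun z : ℂ => (‖z‖ - R)⁻¹) (cobounded ℂ) (𝓝 0) :=
    (tendsto_atTop_add_const_right _ (-R) tendsto_norm_cobounded_atTop).inv_tendsto_atTop
  simpa using h1.const_mul (M * R)

theorem ct_tendsto (hγ : ContinuousOn γ (Icc 0 1)) (hφ : ContinuousOn φ (Icc 0 1)) :
    Tendsto (ct γ φ) (cobounded ℂ) (𝓝 0) := by
  have h1 := (tendsto_inv₀_cobounded (α := ℂ)).mul (ct_mul_tendsto hγ hφ)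
  rw [zero_mul] at h1
  refine h1.congr' ?_
  have : ∀ᶠ z : ℂ in cobounded ℂ, 0 < ‖z‖ := tendsto_norm_cobounded_atTop.eventually_gt_atTop 0
  filter_upwards [this] with z hz
  have : z ≠ 0 := norm_pos_iff.1 hz
  field_simp

end CT

/-- Winding integral has zero derivative. -/
theorem wind_deriv (γ : ℝ → ℂ) (γ' : ℝ → ℂ) (hγ : ∀ t, HasDerivAt γ (γ' t) t) (hγ' : Continuous γ')
    (hcl : γ 0 = γ 1) {z : ℂ} (hz : z ∉ γ '' Icc 0 1) : HasDerivAt (ct γ γ') 0 z := by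
  have hc : Continuous γ := continuous_iff_continuousAt.2 fun t => (hγ t).continuousAt
  refine (ct_hasDerivAt hc.continuousOn hγ'.continuousOn hz).congr_deriv ?_
  have hne : ∀ t ∈ Icc (0:ℝ) 1, γ t - z ≠ 0 := by
    intro t ht h
    exact hz ⟨t, ht, sub_eq_zero.1 h⟩
  have h1 : ∀ t ∈ uIcc (0:ℝ) 1, HasDerivAt (fun t => -(γ t - z)⁻¹) (γ' t / (γ t - z) ^ 2) t := by
    intro t ht
    rw [uIcc_of_le zero_le_one] at ht
    have := (((hγ t).sub_const z).inv (hne t ht)).neg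
    refine this.congr_deriv ?_
    ring
  rw [intervalIntegral.integral_eq_sub_of_hasDerivAt h1, hcl]
  · ring
  · apply ContinuousOn.intervalIntegrable
    rw [uIcc_of_le zero_le_one]
    exact hγ'.continuousOn.div ((hc.continuousOn.sub continuousOn_const).pow 2)
      fun t ht => pow_ne_zero _ (hne t ht)

theorem wind_const (γ : ℝ → ℂ) (γ' : ℝ → ℂ) (hγ : ∀ t, HasDerivAt γ (γ' t) t) (hγ' : Continuous γ')
    (hcl : γ 0 = γ 1) {U : Set ℂ} (hU : IsOpen U) (hUc : IsPreconnected U)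
    (hz : ∀ z ∈ U, z ∉ γ '' Icc 0 1) {z w : ℂ} (hzU : z ∈ U) (hwU : w ∈ U) :
    ct γ γ' z = ct γ γ' w :=
  hU.is_const_of_deriv_eq_zero hUc
    (fun z h => (wind_deriv γ γ' hγ hγ' hcl (hz z h)).differentiableAt.differentiableWithinAt)
    (fun z h => (wind_deriv γ γ' hγ hγ' hcl (hz z h)).deriv) hzU hwU

/-- Homotopy invariance for a family of closed curves `Γ δ t = p t + δ q t`. -/
theorem homotopy_inv (h : ℂ → ℂ) (U : Set ℂ) (hU : IsOpen U) (hh : DifferentiableOn ℂ h U)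
    (p q p' q' : ℝ → ℂ) (hp : ∀ t, HasDerivAt p (p' t) t) (hq : ∀ t, HasDerivAt q (q' t) t)
    (hp' : Continuous p') (hq' : Continuous q') (hp1 : p 0 = p 1) (hq1 : q 0 = q 1)
    (a b : ℝ) (hin : ∀ δ ∈ Ioo a b, ∀ t ∈ Icc (0:ℝ) 1, p t + δ * q t ∈ U) (δ₁ δ₂ : ℝ)
    (h1 : δ₁ ∈ Ioo a b) (h2 : δ₂ ∈ Ioo a b) :
    ∫ t in (0:ℝ)..1, h (p t + δ₁ * q t) * (p' t + δ₁ * q' t) =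
      ∫ t in (0:ℝ)..1, h (p t + δ₂ * q t) * (p' t + δ₂ * q' t) := by
  have hpc : Continuous p := continuous_iff_continuousAt.2 fun t => (hp t).continuousAt
  have hqc : Continuous q := continuous_iff_continuousAt.2 fun t => (hq t).continuousAt
  have hdh : ContinuousOn (deriv h) U := ((hh.analyticOnNhd hU).deriv).continuousOn
  have hΓc : Continuous fun x : ℝ × ℝ => p x.2 + x.1 * q x.2 := by fun_prop
  have hΓ'c : Continuous fun x : ℝ × ℝ => p' x.2 + x.1 * q' x.2 := by fun_prop
  have hmaps : MapsTo (fun x : ℝ × ℝ => p x.2 + x.1 * q x.2) (Ioo a b ×ˢ Icc 0 1) U :=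
    fun x hx => hin _ hx.1 _ hx.2
  let F : ℝ → ℝ → ℂ := fun δ t => h (p t + δ * q t) * (p' t + δ * q' t)
  let F' : ℝ → ℝ → ℂ := fun δ t => deriv h (p t + δ * q t) * q t * (p' t + δ * q' t) +
    h (p t + δ * q t) * q' t
  have hder : ∀ δ ∈ Ioo a b, HasDerivAt (fun δ => ∫ t in (0:ℝ)..1, F δ t) 0 δ := by
    intro δ hδ
    have hc1 : ContinuousOn (fun x : ℝ × ℝ => h (p x.2 + x.1 * q x.2)) (Ioo a b ×ˢ Icc 0 1) :=
      hh.continuousOn.comp hΓc.continuousOn hmaps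
    have hc2 : ContinuousOn (fun x : ℝ × ℝ => deriv h (p x.2 + x.1 * q x.2)) (Ioo a b ×ˢ Icc 0 1) :=
      hdh.comp hΓc.continuousOn hmaps
    have hcF' : ContinuousOn (Function.uncurry F') (Ioo a b ×ˢ Icc 0 1) :=
      ((hc2.mul (by fun_prop : Continuous fun x : ℝ × ℝ => q x.2).continuousOn).mul
        hΓ'c.continuousOn).add (hc1.mul (by fun_prop : Continuous fun x : ℝ × ℝ => q' x.2).continuousOn)
    refine (param_deriv (𝕜 := ℝ) F F' _ isOpen_Ioo zero_le_one ?_ ?_ hcF' δ hδ).congr_deriv ?_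
    · intro x hx t ht
      have e1 : HasDerivAt (fun x : ℝ => p t + x * q t) (q t) x := by
        simpa using ((Complex.ofRealCLM.hasDerivAt (x := x)).mul_const (q t)).const_add (p t)
      have e2 : HasDerivAt (fun x : ℝ => p' t + x * q' t) (q' t) x := by
        simpa using ((Complex.ofRealCLM.hasDerivAt (x := x)).mul_const (q' t)).const_add (p' t)
      have e3 : HasDerivAt h (deriv h (p t + x * q t)) (p t + x * q t) :=
        (hh.differentiableAt (hU.mem_nhds (hin x hx t ht))).hasDerivAt
      exact (e3.comp x e1).mul e2
    · exact hc1.mul hΓ'c.continuousOn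
    · have h5 : ∀ t ∈ uIcc (0:ℝ) 1, HasDerivAt (fun t => h (p t + δ * q t) * q t) (F' δ t) t := by
        intro t ht
        rw [uIcc_of_le zero_le_one] at ht
        have e1 : HasDerivAt (fun t => p t + δ * q t) (p' t + δ * q' t) t := (hp t).add ((hq t).const_mul _)
        have e3 : HasDerivAt h (deriv h (p t + δ * q t)) (p t + δ * q t) :=
          (hh.differentiableAt (hU.mem_nhds (hin δ hδ t ht))).hasDerivAt
        refine ((e3.comp t e1).mul (hq t)).congr_deriv ?_
        simp only [F', Function.comp]
        ring
      rw [intervalIntegral.integral_eq_sub_of_hasDerivAt h5, hp1, hq1, sub_self]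
      apply ContinuousOn.intervalIntegrable
      rw [uIcc_of_le zero_le_one]
      exact hcF'.comp (f := fun t : ℝ => (δ, t)) (by fun_prop) fun t ht => ⟨hδ, ht⟩
  exact isOpen_Ioo.is_const_of_deriv_eq_zero isPreconnected_Ioo
    (fun x hx => (hder x hx).differentiableAt.differentiableWithinAt)
    (fun x hx => (hder x hx).deriv) h1 h2

theorem log_sub_log_neg_of_im_pos {w : ℂ} (h : 0 < w.im) :
    Complex.log w - Complex.log (-w) = Real.pi * Complex.I := by
  simp only [Complex.log, norm_neg, Complex.arg_neg_eq_arg_sub_pi_of_im_pos h]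
  push_cast
  ring

theorem log_sub_log_neg_of_im_neg {w : ℂ} (h : w.im < 0) :
    Complex.log w - Complex.log (-w) = -(Real.pi * Complex.I) := by
  simp only [Complex.log, norm_neg, Complex.arg_neg_eq_arg_add_pi_of_im_neg h]
  push_cast
  ring

namespace SmoothBoundary

variable {K : Set ℂ} (B : SmoothBoundary K)

theorem curve_mem (i : Fin B.n) (t : ℝ) : B.curve i t ∈ frontier K := by
  rw [← B.boundary]; exact mem_iUnion.2 ⟨i, t, rfl⟩

theorem mem_frontier {z : ℂ} (hz : z ∈ frontier K) : ∃ i t, B.curve i t = z := by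
  rw [← B.boundary] at hz
  obtain ⟨i, hi⟩ := mem_iUnion.1 hz
  exact ⟨i, hi⟩

theorem fract_curve (i : Fin B.n) (t : ℝ) : B.curve i (Int.fract t) = B.curve i t := by
  have := curve_add_int (B.curve i) (B.periodic i) (Int.fract t) ⌊t⌋
  rw [Int.fract_add_floor] at this
  exact this.symm

theorem dcurve_per (i : Fin B.n) : Function.Periodic (deriv (B.curve i)) 1 := by
  intro t
  have h1 : (fun x => B.curve i (x + 1)) = B.curve i := funext (B.periodic i)
  have h2 := deriv_comp_add_const (B.curve i) 1 t
  rw [h1] at h2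
  exact h2.symm

theorem fract_dcurve (i : Fin B.n) (t : ℝ) : deriv (B.curve i) (Int.fract t) = deriv (B.curve i) t := by
  have := curve_add_int _ (B.dcurve_per i) (Int.fract t) ⌊t⌋
  rw [Int.fract_add_floor] at this
  exact this.symm

/-- Parallel curve. -/
def nb (i : Fin B.n) (δ t : ℝ) : ℂ := B.curve i t + δ * (-Complex.I * deriv (B.curve i) t)
/-- Derivative of the parallel curve. -/
def dnb (i : Fin B.n) (δ t : ℝ) : ℂ :=
  deriv (B.curve i) t + δ * (-Complex.I * deriv (deriv (B.curve i)) t)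

theorem fract_nb (i : Fin B.n) (δ t : ℝ) : B.nb i δ (Int.fract t) = B.nb i δ t := by
  unfold nb; rw [fract_curve, fract_dcurve]

theorem curve01 (i : Fin B.n) : B.curve i 0 = B.curve i 1 := by
  have := B.periodic i 0
  rw [zero_add] at this
  exact this.symm
theorem dcurve01 (i : Fin B.n) : deriv (B.curve i) 0 = deriv (B.curve i) 1 := by
  have := B.dcurve_per i 0
  rw [zero_add] at this
  exact this.symm

theorem ddcurve_cont (i : Fin B.n) : Continuous (deriv (deriv (B.curve i))) :=
  (B.dcurve_smooth i).continuous_deriv (by simp)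
theorem dcurve_hasDeriv (i : Fin B.n) (t : ℝ) :
    HasDerivAt (deriv (B.curve i)) (deriv (deriv (B.curve i)) t) t :=
  ((B.dcurve_smooth i).differentiable (by simp) t).hasDerivAt

theorem nb_cont (i : Fin B.n) : Continuous fun p : ℝ × ℝ => B.nb i p.1 p.2 := by
  have h1 := B.curve_cont i
  have h2 := B.dcurve_cont i
  unfold nb
  fun_prop
theorem dnb_cont (i : Fin B.n) : Continuous fun p : ℝ × ℝ => B.dnb i p.1 p.2 := by
  have h1 := B.dcurve_cont i
  have h2 := B.ddcurve_cont i
  unfold dnb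
  fun_prop
theorem nb_hasDeriv (i : Fin B.n) (δ t : ℝ) : HasDerivAt (B.nb i δ) (B.dnb i δ t) t :=
  (B.curve_hasDeriv i t).add (((B.dcurve_hasDeriv i t).const_mul _).const_mul _)
theorem nb01 (i : Fin B.n) (δ : ℝ) : B.nb i δ 0 = B.nb i δ 1 := by
  unfold nb; rw [curve01, dcurve01]
theorem nb_zero (i : Fin B.n) (t : ℝ) : B.nb i 0 t = B.curve i t := by simp [nb]
theorem dnb_zero (i : Fin B.n) (t : ℝ) : B.dnb i 0 t = deriv (B.curve i) t := by simp [dnb]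
theorem nb_cont1 (i : Fin B.n) (δ : ℝ) : Continuous (B.nb i δ) :=
  (B.nb_cont i).comp (by fun_prop : Continuous fun t : ℝ => (δ, t))
theorem dnb_cont1 (i : Fin B.n) (δ : ℝ) : Continuous (B.dnb i δ) :=
  (B.dnb_cont i).comp (by fun_prop : Continuous fun t : ℝ => (δ, t))

/-- winding integrals of the single boundary curves vanish in the complement. -/
theorem wind_zero (hK : IsCompact K) (hconn : IsConnected Kᶜ) (j : Fin B.n) {z : ℂ} (hz : z ∈ Kᶜ) :
    ct (B.curve j) (deriv (B.curve j)) z = 0 := by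
  have hopen : IsOpen Kᶜ := hK.isClosed.isOpen_compl
  have hne : ∀ w ∈ Kᶜ, w ∉ B.curve j '' Icc 0 1 := by
    rintro w hw ⟨t, -, rfl⟩
    exact hw (hK.isClosed.frontier_subset (B.curve_mem j t))
  have h1 := ct_tendsto (B.curve_cont j).continuousOn (B.dcurve_cont j).continuousOn
  have h2 : ∀ᶠ w in cobounded ℂ, w ∈ Kᶜ := isBounded_def.1 hK.isBounded
  have h3 : ∀ᶠ w in cobounded ℂ, ct (B.curve j) (deriv (B.curve j)) w =
      ct (B.curve j) (deriv (B.curve j)) z := by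
    filter_upwards [h2] with w hw
    exact wind_const _ _ (B.curve_hasDeriv j) (B.dcurve_cont j) (B.curve01 j) hopen
      hconn.isPreconnected hne hw hz
  exact tendsto_nhds_unique (tendsto_const_nhds.congr' (h3.mono fun _ h => h.symm)) h1

theorem collar_avoid : ∀ᶠ δ : ℝ in 𝓝 0, δ ≠ 0 → ∀ i t, B.nb i δ t ∉ frontier K := by
  have key : ∀ i j, ∀ᶠ δ : ℝ in 𝓝 0, ∀ p ∈ Icc (0:ℝ) 1 ×ˢ Icc (0:ℝ) 1,
      δ ≠ 0 → B.nb i δ p.1 ≠ B.curve j p.2 := by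
    intro i j
    refine (isCompact_Icc.prod isCompact_Icc).eventually_forall_of_forall_eventually
      (P := fun (δ : ℝ) (p : ℝ × ℝ) => δ ≠ 0 → B.nb i δ p.1 ≠ B.curve j p.2) ?_
    rintro ⟨t₀, s₀⟩ -
    by_cases heq : B.curve i t₀ = B.curve j s₀
    · have hij : j = i := by
        by_contra hne
        exact B.curve_ne i j hne s₀ t₀ (sub_eq_zero.2 heq.symm)
      subst hij
      obtain ⟨k, hk⟩ := (B.curve_iff j _ _).1 heq
      set c : ℝ := ‖deriv (B.curve j) t₀‖ / 4 with hc
      have hd0 : 0 < ‖deriv (B.curve j) t₀‖ := norm_pos_iff.2 (B.regular j t₀)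
      have hc0 : 0 < c := by positivity
      have hst : HasStrictDerivAt (B.curve j) (deriv (B.curve j) t₀) t₀ :=
        (B.smooth j).contDiffAt.hasStrictDerivAt (by simp)
      have h1 : ∀ᶠ p : ℝ × ℝ in 𝓝 (t₀, t₀), ‖B.curve j p.1 - B.curve j p.2 -
          (p.1 - p.2) * deriv (B.curve j) t₀‖ ≤ c * |p.1 - p.2| := by
        have := (hst.hasStrictFDerivAt.isLittleO).def hc0
        filter_upwards [this] with p hp
        simpa using hp
      have h2 : ∀ᶠ t in 𝓝 t₀, ‖deriv (B.curve j) t - deriv (B.curve j) t₀‖ ≤ c := by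
        have := (B.dcurve_cont j).continuousAt (x := t₀)
        have h3 := (Metric.continuousAt_iff'.1 this) c hc0
        filter_upwards [h3] with t ht
        rw [← dist_eq_norm]; exact ht.le
      have h1' : Tendsto (fun q : ℝ × ℝ × ℝ => (q.2.2 + k, q.2.1)) (𝓝 (0, t₀, s₀)) (𝓝 (t₀, t₀)) := by
        have : Continuous fun q : ℝ × ℝ × ℝ => ((q.2.2 + k, q.2.1) : ℝ × ℝ) := by fun_prop
        convert this.tendsto (0, t₀, s₀) using 2
        simp only [Prod.mk.injEq, and_true]
        linarith
      have h2' : Tendsto (fun q : ℝ × ℝ × ℝ => q.2.1) (𝓝 (0, t₀, s₀)) (𝓝 t₀) :=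
        (by fun_prop : Continuous fun q : ℝ × ℝ × ℝ => q.2.1).tendsto (0, t₀, s₀)
      filter_upwards [h1'.eventually h1, h2'.eventually h2] with ⟨δ, t, s⟩ e1 e2 hδ e3
      simp only at e1 e2 e3 hδ
      rw [curve_add_int _ (B.periodic j)] at e1
      have e4 : B.curve j s - B.curve j t = δ * (-Complex.I * deriv (B.curve j) t) := by
        rw [← e3]; unfold nb; ring
      rw [e4] at e1
      set x : ℝ := s + k - t with hx
      have hxc : ((s + k : ℝ) : ℂ) - (t : ℂ) = (x : ℂ) := by rw [hx]; push_cast; ring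
      rw [hxc] at e1
      have hz : ‖(x : ℂ) + δ * Complex.I‖ * ‖deriv (B.curve j) t₀‖ ≤ c * |x| + |δ| * c := by
        rw [← norm_mul]
        have : ((x : ℂ) + δ * Complex.I) * deriv (B.curve j) t₀ =
          -(δ * (-Complex.I * deriv (B.curve j) t) - x * deriv (B.curve j) t₀)
          + -(δ * (Complex.I * (deriv (B.curve j) t - deriv (B.curve j) t₀))) := by ring
        rw [this]
        refine (norm_add_le _ _).trans (add_le_add ?_ ?_)
        · rw [norm_neg]; exact e1
        · rw [norm_neg, norm_mul, norm_mul, Complex.norm_I, one_mul, Complex.norm_real, Real.norm_eq_abs]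
          gcongr
      have hxle : |x| ≤ ‖(x : ℂ) + δ * Complex.I‖ := by
        have := Complex.abs_re_le_norm ((x : ℂ) + δ * Complex.I)
        simpa using this
      have hdle : |δ| ≤ ‖(x : ℂ) + δ * Complex.I‖ := by
        have := Complex.abs_im_le_norm ((x : ℂ) + δ * Complex.I)
        simpa using this
      have hpos : 0 < |δ| := abs_pos.2 hδ
      have h4 : ‖deriv (B.curve j) t₀‖ = 4 * c := by rw [hc]; ring
      rw [h4] at hz
      nlinarith
    · have hcont : Continuous fun q : ℝ × ℝ × ℝ => B.nb i q.1 q.2.1 - B.curve j q.2.2 := by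
        have e1 := (B.nb_cont i).comp (by fun_prop : Continuous fun q : ℝ × ℝ × ℝ => (q.1, q.2.1))
        have e2 := (B.curve_cont j).comp (by fun_prop : Continuous fun q : ℝ × ℝ × ℝ => q.2.2)
        exact e1.sub e2
      have hne : (fun q : ℝ × ℝ × ℝ => B.nb i q.1 q.2.1 - B.curve j q.2.2) (0, t₀, s₀) ≠ 0 := by
        simp only [nb_zero]
        exact sub_ne_zero.2 heq
      filter_upwards [hcont.continuousAt.eventually_ne hne] with q hq _
      exact sub_ne_zero.1 hq
  have key2 : ∀ᶠ δ : ℝ in 𝓝 0, ∀ i j, ∀ p ∈ Icc (0:ℝ) 1 ×ˢ Icc (0:ℝ) 1,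
      δ ≠ 0 → B.nb i δ p.1 ≠ B.curve j p.2 :=
    eventually_all.2 fun i => eventually_all.2 fun j => key i j
  filter_upwards [key2] with δ h hδ i t hmem
  obtain ⟨j, s, hs⟩ := B.mem_frontier hmem
  refine h i j (Int.fract t, Int.fract s) ⟨⟨Int.fract_nonneg _, (Int.fract_lt_one _).le⟩,
    ⟨Int.fract_nonneg _, (Int.fract_lt_one _).le⟩⟩ hδ ?_
  simp only
  rw [fract_nb, fract_curve, hs]

/-- normalized local coordinate. -/
def gl (i : Fin B.n) (t₀ s : ℝ) : ℂ := (B.curve i s - B.curve i t₀) / deriv (B.curve i) t₀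

theorem gl_self (i : Fin B.n) (t₀ : ℝ) : B.gl i t₀ t₀ = 0 := by simp [gl]

theorem gl_hasDeriv (i : Fin B.n) (t₀ s : ℝ) :
    HasDerivAt (B.gl i t₀) (deriv (B.curve i) s / deriv (B.curve i) t₀) s :=
  ((B.curve_hasDeriv i s).sub_const _).div_const _

theorem gl_local (i : Fin B.n) (t₀ : ℝ) : ∃ η₀ > 0, η₀ < 1 / 2 ∧ ∀ s, |s - t₀| < η₀ →
    ‖B.gl i t₀ s - ((s - t₀ : ℝ) : ℂ)‖ ≤ 1 / 2 * |s - t₀| := by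
  have h := (B.gl_hasDeriv i t₀ t₀).isLittleO.def (show (0:ℝ) < 1 / 2 by norm_num)
  rw [div_self (B.regular i t₀)] at h
  obtain ⟨r, hr, hball⟩ := Metric.eventually_nhds_iff.1 h
  refine ⟨min r (1 / 4), by positivity, by
    exact lt_of_le_of_lt (min_le_right _ _) (by norm_num), fun s hs => ?_⟩
  have := hball (y := s) (by rw [Real.dist_eq]; exact lt_of_lt_of_le hs (min_le_left _ _))
  simpa [gl_self] using this

theorem gl_re (i : Fin B.n) (t₀ s : ℝ)
    (h : ‖B.gl i t₀ s - ((s - t₀ : ℝ) : ℂ)‖ ≤ 1 / 2 * |s - t₀|) :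
    |(B.gl i t₀ s).re - (s - t₀)| ≤ 1 / 2 * |s - t₀| := by
  have := (Complex.abs_re_le_norm _).trans h
  rwa [Complex.sub_re, Complex.ofReal_re] at this

theorem arc_log (i : Fin B.n) (t₀ η₀ : ℝ) (hη₀ : ∀ s, |s - t₀| < η₀ →
    ‖B.gl i t₀ s - ((s - t₀ : ℝ) : ℂ)‖ ≤ 1 / 2 * |s - t₀|) (σ : ℝ) (hσ : σ = 1 ∨ σ = -1)
    (η ε : ℝ) (hη : 0 < η) (hηη : η < η₀) (hε : 0 < ε) :
    ∫ s in (t₀ - η)..(t₀ + η), deriv (B.curve i) s / (B.curve i s - B.nb i (σ * ε) t₀) =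
      Complex.log (-σ * Complex.I * B.gl i t₀ (t₀ + η) + ε) -
      Complex.log (-σ * Complex.I * B.gl i t₀ (t₀ - η) + ε) := by
  have hσ2 : (σ : ℂ) * σ = 1 := by rcases hσ with h | h <;> simp [h]
  have hσ0 : σ ≠ 0 := by rcases hσ with h | h <;> simp [h]
  have hu : uIcc (t₀ - η) (t₀ + η) = Icc (t₀ - η) (t₀ + η) := uIcc_of_le (by linarith)
  have hslit : ∀ s ∈ Icc (t₀ - η) (t₀ + η), -σ * Complex.I * B.gl i t₀ s + ε ∈ slitPlane := by
    intro s hs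
    rw [Complex.mem_slitPlane_iff]
    by_cases h : s = t₀
    · left
      rw [h, gl_self]; simpa using hε
    · right
      have h1 : |s - t₀| < η₀ := by
        rw [abs_lt]; constructor <;> linarith [hs.1, hs.2]
      have h2 := B.gl_re i t₀ s (hη₀ s h1)
      have h3 : 0 < |s - t₀| := abs_pos.2 (sub_ne_zero.2 h)
      have h4 : (B.gl i t₀ s).re ≠ 0 := by
        intro h0
        rw [h0, zero_sub, abs_neg] at h2
        linarith
      simp [hσ0, h4]
  have hne : ∀ s ∈ Icc (t₀ - η) (t₀ + η), B.curve i s - B.nb i (σ * ε) t₀ ≠ 0 := by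
    intro s hs h
    have h1 := Complex.slitPlane_ne_zero (hslit s hs)
    apply h1
    have hr := B.regular i t₀
    unfold gl
    unfold nb at h
    push_cast at h
    field_simp
    linear_combination (-(σ:ℂ) * Complex.I) * h - (ε * deriv (B.curve i) t₀ : ℂ) * hσ2 + (σ * σ * ε * deriv (B.curve i) t₀ : ℂ) * (Complex.I_sq)
  have hcont : ContinuousOn (fun s => deriv (B.curve i) s / (B.curve i s - B.nb i (σ * ε) t₀))
      (Icc (t₀ - η) (t₀ + η)) :=
    (B.dcurve_cont i).continuousOn.div ((B.curve_cont i).continuousOn.sub continuousOn_const) hne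
  rw [intervalIntegral.integral_eq_sub_of_hasDerivAt
    (f := fun s => Complex.log (-σ * Complex.I * B.gl i t₀ s + ε))]
  · intro s hs
    rw [hu] at hs
    have h1 := (((B.gl_hasDeriv i t₀ s).const_mul (-σ * Complex.I : ℂ)).add_const (ε : ℂ)).clog_real (hslit s hs)
    refine h1.congr_deriv ?_
    have h2 := hne s hs
    have h3 := Complex.slitPlane_ne_zero (hslit s hs)
    have hr := B.regular i t₀
    rw [div_eq_div_iff h3 h2]
    unfold gl nb
    push_cast
    field_simp
    linear_combination (deriv (B.curve i) s * deriv (B.curve i) t₀ * ε : ℂ) * hσ2 - (deriv (B.curve i) s * σ * σ * ε * deriv (B.curve i) t₀ : ℂ) * (Complex.I_sq)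
  · exact ContinuousOn.intervalIntegrable (by rw [hu]; exact hcont)

end SmoothBoundary

namespace SmoothBoundary

variable {K : Set ℂ} (B : SmoothBoundary K)

theorem nb_tendsto (i : Fin B.n) (σ t₀ : ℝ) :
    Tendsto (fun ε : ℝ => B.nb i (σ * ε) t₀) (𝓝[>] 0) (𝓝 (B.curve i t₀)) := by
  have h : Continuous fun ε : ℝ => B.nb i (σ * ε) t₀ :=
    (B.nb_cont i).comp (by fun_prop : Continuous fun ε : ℝ => (σ * ε, t₀))
  have h2 := h.tendsto 0
  rw [mul_zero, nb_zero] at h2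
  exact h2.mono_left nhdsWithin_le_nhds

theorem collar_avoid' {σ : ℝ} (hσ : σ ≠ 0) :
    ∀ᶠ ε : ℝ in 𝓝[>] 0, ∀ i t, B.nb i (σ * ε) t ∉ frontier K := by
  have h1 : Tendsto (fun ε : ℝ => σ * ε) (𝓝[>] 0) (𝓝 0) := by
    have h : Continuous fun ε : ℝ => σ * ε := by fun_prop
    have h2 := h.tendsto 0
    rw [mul_zero] at h2
    exact h2.mono_left nhdsWithin_le_nhds
  filter_upwards [h1.eventually B.collar_avoid, self_mem_nhdsWithin] with ε h hε
  exact h (mul_ne_zero hσ (ne_of_gt hε))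

/-- integral away from the singular point -/
def outer (i : Fin B.n) (t₀ η : ℝ) : ℂ :=
  ∫ s in (t₀ + η)..(t₀ + 1 - η), deriv (B.curve i) s / (B.curve i s - B.curve i t₀)

theorem outer_ne (i : Fin B.n) (t₀ η : ℝ) (hη : 0 < η) {s : ℝ} (hs : s ∈ Icc (t₀ + η) (t₀ + 1 - η)) :
    ¬ ∃ k : ℤ, s - t₀ = k := by
  rintro ⟨k, hk⟩
  have h1 : (0:ℝ) < k := by rw [← hk]; linarith [hs.1]
  have h2 : (k:ℝ) < 1 := by rw [← hk]; linarith [hs.2]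
  norm_cast at h1 h2
  omega

theorem ct_side (i : Fin B.n) (t₀ η₀ : ℝ) (hη₀ : ∀ s, |s - t₀| < η₀ →
    ‖B.gl i t₀ s - ((s - t₀ : ℝ) : ℂ)‖ ≤ 1 / 2 * |s - t₀|) (σ : ℝ) (hσ : σ = 1 ∨ σ = -1)
    (η : ℝ) (hη : 0 < η) (hηη : η < η₀) (hη2 : η < 1 / 2) :
    Tendsto (fun ε : ℝ => ct (B.curve i) (deriv (B.curve i)) (B.nb i (σ * ε) t₀)) (𝓝[>] 0)
      (𝓝 (B.outer i t₀ η + (Complex.log (-σ * Complex.I * B.gl i t₀ (t₀ + η)) -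
      Complex.log (-σ * Complex.I * B.gl i t₀ (t₀ - η))))) := by
  have hσ0 : σ ≠ 0 := by rcases hσ with h | h <;> simp [h]
  -- split
  have hsplit : ∀ᶠ ε : ℝ in 𝓝[>] 0, ct (B.curve i) (deriv (B.curve i)) (B.nb i (σ * ε) t₀) =
      (∫ s in (t₀ + η)..(t₀ + 1 - η), deriv (B.curve i) s / (B.curve i s - B.nb i (σ * ε) t₀)) +
      (Complex.log (-σ * Complex.I * B.gl i t₀ (t₀ + η) + ε) -
      Complex.log (-σ * Complex.I * B.gl i t₀ (t₀ - η) + ε)) := by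
    filter_upwards [B.collar_avoid' hσ0, self_mem_nhdsWithin] with ε hε hε0
    rw [← B.arc_log i t₀ η₀ hη₀ σ hσ η ε hη hηη hε0]
    set z := B.nb i (σ * ε) t₀ with hz
    have hne : ∀ s, B.curve i s - z ≠ 0 := by
      intro s h
      apply hε i t₀
      rw [← hz, ← sub_eq_zero.1 h]
      exact B.curve_mem i s
    have hc : Continuous fun s => deriv (B.curve i) s / (B.curve i s - z) :=
      (B.dcurve_cont i).div ((B.curve_cont i).sub continuous_const) hne
    have hper : Function.Periodic (fun s => deriv (B.curve i) s / (B.curve i s - z)) 1 := by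
      intro s
      simp only [B.dcurve_per i s, B.periodic i s]
    have h1 := hper.intervalIntegral_add_eq 0 (t₀ - η)
    rw [zero_add] at h1
    unfold ct
    rw [h1, ← intervalIntegral.integral_add_adjacent_intervals (b := t₀ + η)
      (hc.intervalIntegrable _ _) (hc.intervalIntegrable _ _), add_comm,
      show t₀ - η + 1 = t₀ + 1 - η by ring]
  refine Tendsto.congr' (hsplit.mono fun _ h => h.symm) ?_
  refine Tendsto.add ?_ (Tendsto.sub ?_ ?_)
  · set S : Set ℂ := (B.curve i '' Icc (t₀ + η) (t₀ + 1 - η))ᶜ with hS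
    have hSo : IsOpen S := (isCompact_Icc.image (B.curve_cont i)).isClosed.isOpen_compl
    have hmem : B.curve i t₀ ∈ S := by
      rintro ⟨s, hs, h⟩
      exact outer_ne B i t₀ η hη hs ((B.curve_iff i _ _).1 h)
    have hpc := param_cont (fun (z : ℂ) s => deriv (B.curve i) s / (B.curve i s - z)) S
      (a := t₀ + η) (b := t₀ + 1 - η) (by linarith) (by
        refine ContinuousOn.div ?_ ?_ ?_
        · exact ((B.dcurve_cont i).comp continuous_snd).continuousOn
        · exact (((B.curve_cont i).comp continuous_snd).sub continuous_fst).continuousOn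
        · rintro ⟨z, s⟩ ⟨hz, hs⟩ h
          exact hz ⟨s, hs, sub_eq_zero.1 h⟩)
    exact (hpc.continuousAt (hSo.mem_nhds hmem)).tendsto.comp (B.nb_tendsto i σ t₀)
  all_goals
    have hlog : ∀ s, |s - t₀| = η → Tendsto (fun ε : ℝ => Complex.log (-σ * Complex.I * B.gl i t₀ s + ε))
        (𝓝[>] 0) (𝓝 (Complex.log (-σ * Complex.I * B.gl i t₀ s))) := by
      intro s hs
      have h2 := B.gl_re i t₀ s (hη₀ s (by rw [hs]; exact hηη))
      have h4 : (B.gl i t₀ s).re ≠ 0 := by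
        intro h0
        rw [h0, zero_sub, abs_neg, hs] at h2
        linarith
      have h5 : -σ * Complex.I * B.gl i t₀ s ∈ slitPlane := by
        rw [Complex.mem_slitPlane_iff]; right
        simp [hσ0, h4]
      have h6 : Continuous fun ε : ℝ => -σ * Complex.I * B.gl i t₀ s + (ε : ℂ) := by fun_prop
      have h7 := h6.tendsto 0
      simp only [Complex.ofReal_zero, add_zero] at h7
      exact (h7.mono_left nhdsWithin_le_nhds).clog h5
  · exact hlog _ (by simp [abs_of_pos hη])
  · exact hlog _ (by simp [abs_of_pos hη])

/-- total winding integral -/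
def W (z : ℂ) : ℂ := ∑ j, ct (B.curve j) (deriv (B.curve j)) z

theorem W_int {z : ℂ} (hz : z ∈ interior K) : B.W z = 2 * Real.pi * Complex.I := B.orientation z hz
theorem W_compl (hK : IsCompact K) (hconn : IsConnected Kᶜ) {z : ℂ} (hz : z ∈ Kᶜ) : B.W z = 0 :=
  Finset.sum_eq_zero fun j _ => B.wind_zero hK hconn j hz

theorem notMem_image (j : Fin B.n) {z : ℂ} (hz : z ∉ frontier K) : z ∉ B.curve j '' Icc 0 1 := by
  rintro ⟨t, -, rfl⟩
  exact hz (B.curve_mem j t)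

theorem ct_other (i j : Fin B.n) (h : j ≠ i) (t₀ : ℝ) :
    ContinuousAt (ct (B.curve j) (deriv (B.curve j))) (B.curve i t₀) := by
  refine (ct_hasDerivAt (B.curve_cont j).continuousOn (B.dcurve_cont j).continuousOn ?_).continuousAt
  rintro ⟨s, -, hs⟩
  exact B.curve_ne i j h s t₀ (sub_eq_zero.2 hs)

theorem W_jump (i : Fin B.n) (t₀ : ℝ) : ∃ a : ℂ,
    Tendsto (fun ε : ℝ => B.W (B.nb i (1 * ε) t₀)) (𝓝[>] 0) (𝓝 a) ∧
    Tendsto (fun ε : ℝ => B.W (B.nb i (-1 * ε) t₀)) (𝓝[>] 0) (𝓝 (a + 2 * Real.pi * Complex.I)) := by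
  obtain ⟨η₀, hη0, hη2, hη₀⟩ := B.gl_local i t₀
  have h := fun σ hσ => B.ct_side i t₀ η₀ hη₀ σ hσ (η₀ / 2) (by linarith) (by linarith) (by linarith)
  have h1 := h 1 (Or.inl rfl)
  have h2 := h (-1) (Or.inr rfl)
  set a := B.outer i t₀ (η₀ / 2) + (Complex.log (-(1:ℝ) * Complex.I * B.gl i t₀ (t₀ + η₀ / 2)) -
      Complex.log (-(1:ℝ) * Complex.I * B.gl i t₀ (t₀ - η₀ / 2))) with ha
  have hb : B.outer i t₀ (η₀ / 2) + (Complex.log (-(-1:ℝ) * Complex.I * B.gl i t₀ (t₀ + η₀ / 2)) -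
      Complex.log (-(-1:ℝ) * Complex.I * B.gl i t₀ (t₀ - η₀ / 2))) = a + 2 * Real.pi * Complex.I := by
    have e1 := B.gl_re i t₀ (t₀ + η₀ / 2) (hη₀ _ (by rw [add_sub_cancel_left, abs_of_pos] <;> linarith))
    have e2 := B.gl_re i t₀ (t₀ - η₀ / 2) (hη₀ _ (by rw [sub_sub_cancel_left, abs_neg, abs_of_pos] <;> linarith))
    rw [add_sub_cancel_left, abs_of_pos (by linarith : 0 < η₀ / 2), abs_le] at e1
    rw [sub_sub_cancel_left, abs_neg, abs_of_pos (by linarith : 0 < η₀ / 2), abs_le] at e2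
    have f1 : 0 < (Complex.I * B.gl i t₀ (t₀ + η₀ / 2)).im := by simp; linarith
    have f2 : (Complex.I * B.gl i t₀ (t₀ - η₀ / 2)).im < 0 := by simp; linarith
    have g1 := log_sub_log_neg_of_im_pos f1
    have g2 := log_sub_log_neg_of_im_neg f2
    rw [ha]
    push_cast
    simp only [neg_neg, one_mul, neg_mul]
    linear_combination g1 - g2
  rw [hb] at h2
  have hsplit : ∀ z, B.W z = ct (B.curve i) (deriv (B.curve i)) z +
      ∑ j ∈ Finset.univ.erase i, ct (B.curve j) (deriv (B.curve j)) z := fun z =>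
    (Finset.add_sum_erase _ _ (Finset.mem_univ i)).symm
  have hoth : Tendsto (fun z => ∑ j ∈ Finset.univ.erase i, ct (B.curve j) (deriv (B.curve j)) z)
      (𝓝 (B.curve i t₀)) (𝓝 (∑ j ∈ Finset.univ.erase i, ct (B.curve j) (deriv (B.curve j)) (B.curve i t₀))) :=
    tendsto_finsetSum _ fun j hj => B.ct_other i j (Finset.ne_of_mem_erase hj) t₀
  refine ⟨a + ∑ j ∈ Finset.univ.erase i, ct (B.curve j) (deriv (B.curve j)) (B.curve i t₀), ?_, ?_⟩
  · simp only [hsplit]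
    exact h1.add (hoth.comp (B.nb_tendsto i 1 t₀))
  · simp only [hsplit]
    have := h2.add (hoth.comp (B.nb_tendsto i (-1) t₀))
    rw [add_right_comm]
    exact this

theorem side_or (hK : IsCompact K) {σ δ₀ : ℝ}
    (h : ∀ ε, 0 < ε → ε < δ₀ → ∀ i t, B.nb i (σ * ε) t ∉ frontier K) (i : Fin B.n) :
    (∀ ε, 0 < ε → ε < δ₀ → ∀ t, B.nb i (σ * ε) t ∈ interior K) ∨
    (∀ ε, 0 < ε → ε < δ₀ → ∀ t, B.nb i (σ * ε) t ∈ Kᶜ) := by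
  have hpre : IsPreconnected ((fun p : ℝ × ℝ => B.nb i (σ * p.1) p.2) '' (Ioo 0 δ₀ ×ˢ univ)) := by
    refine IsPreconnected.image (isPreconnected_Ioo.prod isPreconnected_univ) _ ?_
    exact ((B.nb_cont i).comp (by fun_prop : Continuous fun p : ℝ × ℝ => (σ * p.1, p.2))).continuousOn
  have hd : Disjoint (interior K) Kᶜ :=
    disjoint_compl_right.mono_left interior_subset
  have hsub : ((fun p : ℝ × ℝ => B.nb i (σ * p.1) p.2) '' (Ioo 0 δ₀ ×ˢ univ)) ⊆ interior K ∪ Kᶜ := by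
    rintro _ ⟨⟨ε, t⟩, ⟨hε, -⟩, rfl⟩
    have h1 := h ε hε.1 hε.2 i t
    by_cases hk : B.nb i (σ * ε) t ∈ K
    · left
      rw [hK.isClosed.frontier_eq] at h1
      by_contra h2
      exact h1 ⟨hk, h2⟩
    · right; exact hk
  rcases hpre.subset_or_subset isOpen_interior hK.isClosed.isOpen_compl hd hsub with h1 | h1
  · left; intro ε h2 h3 t; exact h1 ⟨(ε, t), ⟨⟨h2, h3⟩, mem_univ _⟩, rfl⟩
  · right; intro ε h2 h3 t; exact h1 ⟨(ε, t), ⟨⟨h2, h3⟩, mem_univ _⟩, rfl⟩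

theorem collar_sides (hK : IsCompact K) (hconn : IsConnected Kᶜ) : ∃ δ₀ > 0, ∀ ε, 0 < ε → ε < δ₀ →
    ∀ i t, B.nb i (1 * ε) t ∈ Kᶜ ∧ B.nb i (-1 * ε) t ∈ interior K := by
  have h1 := (B.collar_avoid' (σ := 1) (by norm_num)).and (B.collar_avoid' (σ := -1) (by norm_num))
  obtain ⟨δ₀, hδ₀, hsub⟩ := mem_nhdsGT_iff_exists_Ioo_subset.1 h1
  have hδ0 : (0:ℝ) < δ₀ := hδ₀
  refine ⟨δ₀, hδ₀, ?_⟩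
  have key : ∀ i, (∀ ε, 0 < ε → ε < δ₀ → ∀ t, B.nb i (1 * ε) t ∈ Kᶜ) ∧
      (∀ ε, 0 < ε → ε < δ₀ → ∀ t, B.nb i (-1 * ε) t ∈ interior K) := by
    intro i
    have ha := B.side_or hK (σ := 1) (δ₀ := δ₀) (fun ε h2 h3 => (hsub ⟨h2, h3⟩).1) i
    have hb := B.side_or hK (σ := -1) (δ₀ := δ₀) (fun ε h2 h3 => (hsub ⟨h2, h3⟩).2) i
    obtain ⟨a, j1, j2⟩ := B.W_jump i 0
    have hev : ∀ᶠ ε : ℝ in 𝓝[>] 0, ε ∈ Ioo 0 δ₀ := Ioo_mem_nhdsGT hδ0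
    have hlimi : ∀ σ b, (∀ ε, 0 < ε → ε < δ₀ → ∀ t, B.nb i (σ * ε) t ∈ interior K) →
        Tendsto (fun ε : ℝ => B.W (B.nb i (σ * ε) 0)) (𝓝[>] 0) (𝓝 b) → b = 2 * Real.pi * Complex.I := by
      intro σ b hs ht
      refine tendsto_nhds_unique ht (tendsto_const_nhds.congr' ?_)
      filter_upwards [hev] with ε hε
      exact (B.W_int (hs ε hε.1 hε.2 0)).symm
    have hlimo : ∀ σ b, (∀ ε, 0 < ε → ε < δ₀ → ∀ t, B.nb i (σ * ε) t ∈ Kᶜ) →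
        Tendsto (fun ε : ℝ => B.W (B.nb i (σ * ε) 0)) (𝓝[>] 0) (𝓝 b) → b = 0 := by
      intro σ b hs ht
      refine tendsto_nhds_unique ht (tendsto_const_nhds.congr' ?_)
      filter_upwards [hev] with ε hε
      exact (B.W_compl hK hconn (hs ε hε.1 hε.2 0)).symm
    have hpi := two_pi_I_ne
    rcases ha with ha | ha <;> rcases hb with hb | hb
    · have e1 := hlimi 1 _ ha j1
      have e2 := hlimi (-1) _ hb j2
      exact absurd (by linear_combination e2 - e1) hpi
    · have e1 := hlimi 1 _ ha j1
      have e2 := hlimo (-1) _ hb j2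
      exact absurd (by linear_combination (e2 - e1) / 2) hpi
    · exact ⟨ha, hb⟩
    · have e1 := hlimo 1 _ ha j1
      have e2 := hlimo (-1) _ hb j2
      exact absurd (by linear_combination (e2 - e1)) hpi
  intro ε h2 h3 i t
  exact ⟨(key i).1 ε h2 h3 t, (key i).2 ε h2 h3 t⟩

theorem gl_ratio (i : Fin B.n) (t₀ : ℝ) (σ : ℝ) (hσ : σ ≠ 0) :
    Tendsto (fun η : ℝ => (η⁻¹ : ℂ) * B.gl i t₀ (t₀ + σ * η)) (𝓝[>] 0) (𝓝 σ) := by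
  have h := B.gl_hasDeriv i t₀ t₀
  rw [div_self (B.regular i t₀)] at h
  have h0 : HasDerivAt (fun η : ℝ => t₀ + σ * η) σ 0 := by
    simpa using ((hasDerivAt_id (0:ℝ)).const_mul σ).const_add t₀
  have h1 : HasDerivAt (fun η : ℝ => B.gl i t₀ (t₀ + σ * η)) (σ * 1 : ℂ) 0 := by
    have := HasDerivAt.scomp (𝕜 := ℝ) (g₁ := B.gl i t₀) (h := fun η : ℝ => t₀ + σ * η) (x := (0:ℝ))
      (by simpa using h) h0
    exact this.congr_deriv (by simp)
  have h2 := (hasDerivAt_iff_tendsto_slope_zero.1 h1).mono_left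
    (nhdsWithin_mono 0 (fun x (hx : (0:ℝ) < x) => ne_of_gt hx))
  simp only [mul_one] at h2
  refine h2.congr fun η => ?_
  simp [gl_self]

theorem alp_eq_zero (hK : IsCompact K) (hconn : IsConnected Kᶜ) (i : Fin B.n) : B.alp i = 0 := by
  obtain ⟨η₀, hη0, hη2, hη₀⟩ := B.gl_local i 0
  obtain ⟨δ₀, hδ0, hδ₀⟩ := B.collar_sides hK hconn
  have hz : ∀ η, 0 < η → η < η₀ → B.outer i 0 η + (Complex.log (-(1:ℝ) * Complex.I * B.gl i 0 (0 + η)) -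
      Complex.log (-(1:ℝ) * Complex.I * B.gl i 0 (0 - η))) = 0 := by
    intro η h1 h2
    refine tendsto_nhds_unique (B.ct_side i 0 η₀ hη₀ 1 (Or.inl rfl) η h1 h2 (by linarith))
      (tendsto_const_nhds.congr' ?_)
    filter_upwards [Ioo_mem_nhdsGT hδ0] with ε hε
    exact (B.wind_zero hK hconn i (hδ₀ ε hε.1 hε.2 i 0).1).symm
  set k : ℝ → ℝ := fun s => Real.pi + (B.dL i s 0).im with hk
  have hdc : Continuous fun s => B.dL i s 0 :=
      (B.dL_smooth i).continuous.comp (by fun_prop : Continuous fun s : ℝ => ((s, (0:ℝ)) : ℝ × ℝ))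
  have hkc : Continuous k := continuous_const.add (Complex.continuous_im.comp hdc)
  have hout : ∀ η, 0 < η → η < η₀ → (B.outer i 0 η).im = ∫ s in (0 + η)..(0 + 1 - η), k s := by
    intro η h1 h2
    unfold outer
    have hintg : IntervalIntegrable (fun s => deriv (B.curve i) s / (B.curve i s - B.curve i 0)) volume
        (0 + η) (0 + 1 - η) := by
      apply ContinuousOn.intervalIntegrable
      rw [uIcc_of_le (by linarith)]
      refine (B.dcurve_cont i).continuousOn.div ((B.curve_cont i).continuousOn.sub continuousOn_const) ?_
      intro s hs h
      exact B.outer_ne i 0 η h1 hs ((B.curve_iff i _ _).1 (sub_eq_zero.1 h))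
    have := Complex.imCLM.intervalIntegral_comp_comm hintg
    simp only [Complex.imCLM_apply] at this
    rw [← this]
    apply intervalIntegral.integral_congr
    intro s hs
    rw [uIcc_of_le (by linarith)] at hs
    exact B.im_deriv_div i s 0 (B.outer_ne i 0 η h1 hs)
  have hlim1 : Tendsto (fun η : ℝ => ∫ s in (0 + η)..(0 + 1 - η), k s) (𝓝[>] 0)
      (𝓝 (Real.pi + (B.alp i).im)) := by
    have hP := intervalIntegral.continuous_primitive (fun a b => hkc.intervalIntegrable a b) (μ := volume) 0
    have h1 : ∀ η : ℝ, ∫ s in (0 + η)..(0 + 1 - η), k s =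
        (∫ s in (0:ℝ)..(0 + 1 - η), k s) - ∫ s in (0:ℝ)..(0+η), k s := fun η => by
      rw [intervalIntegral.integral_interval_sub_left] <;> exact hkc.intervalIntegrable _ _
    have h2 : Continuous fun η : ℝ => (∫ s in (0:ℝ)..(0 + 1 - η), k s) - ∫ s in (0:ℝ)..(0+η), k s :=
      (hP.comp (by fun_prop : Continuous fun η : ℝ => 0 + 1 - η)).sub
        (hP.comp (by fun_prop : Continuous fun η : ℝ => 0 + η))
    have h3 := h2.tendsto 0
    simp only [← h1] at h3
    refine (h3.mono_left nhdsWithin_le_nhds).congr' EventuallyEq.rfl |>.trans (le_of_eq ?_)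
    congr 1
    have hic : Continuous fun s => (B.dL i s 0).im := Complex.continuous_im.comp hdc
    rw [sub_zero, add_zero, hk, intervalIntegral.integral_add
      (continuous_const.intervalIntegrable _ _) (hic.intervalIntegrable _ _)]
    have h4 := Complex.imCLM.intervalIntegral_comp_comm (hdc.intervalIntegrable (μ := volume) 0 (0 + 1))
    simp only [Complex.imCLM_apply] at h4
    rw [h4, int_dL]
    simp
  have hlim2 : ∀ σ : ℝ, σ = 1 ∨ σ = -1 → Tendsto (fun η : ℝ => (Complex.log (-(1:ℝ) * Complex.I * B.gl i 0 (0 + σ * η))).im)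
      (𝓝[>] 0) (𝓝 (-(σ * (Real.pi / 2)))) := by
    intro σ hσ
    have h1 := (B.gl_ratio i 0 σ (by rcases hσ with h | h <;> simp [h])).const_mul (-Complex.I)
    have hs : -Complex.I * (σ : ℂ) ∈ slitPlane := by
      rw [Complex.mem_slitPlane_iff]; right
      rcases hσ with h | h <;> simp [h]
    have h2 := (Complex.continuousAt_arg hs).tendsto.comp h1
    have h3 : Complex.arg (-Complex.I * (σ : ℂ)) = -(σ * (Real.pi / 2)) := by
      rcases hσ with h | h <;> simp [h, Complex.arg_neg_I]
    rw [h3] at h2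
    refine h2.congr' ?_
    filter_upwards [self_mem_nhdsWithin] with η hη
    rw [Complex.log_im]
    simp only [Function.comp]
    rw [show -Complex.I * ((η⁻¹ : ℂ) * B.gl i 0 (0 + σ * η)) = ((η⁻¹ : ℝ) : ℂ) * (-(1:ℝ) * Complex.I * B.gl i 0 (0 + σ * η)) by
      push_cast; ring, Complex.arg_real_mul _ (inv_pos.2 hη)]
  have hfin := hlim1.add ((hlim2 1 (Or.inl rfl)).sub (hlim2 (-1) (Or.inr rfl)))
  have him : (B.alp i).im = 0 := by
    have : Real.pi + (B.alp i).im + (-(1 * (Real.pi / 2)) - -(-1 * (Real.pi / 2))) = 0 := by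
      refine tendsto_nhds_unique hfin (tendsto_const_nhds.congr' ?_)
      filter_upwards [Ioo_mem_nhdsGT hη0] with η hη
      have h1 := congrArg Complex.im (hz η hη.1 hη.2)
      rw [Complex.add_im, Complex.sub_im, hout η hη.1 hη.2] at h1
      rw [one_mul, show (0 : ℝ) + -1 * η = 0 - η by ring, h1]
      rfl
    linarith
  obtain ⟨k, hk⟩ := Complex.exp_eq_one_iff.1 (B.exp_alp i)
  rw [hk] at him ⊢
  have : (k : ℝ) * (2 * Real.pi) = 0 := by simpa using him
  have hk0 : (k : ℝ) = 0 := by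
    rcases mul_eq_zero.1 this with h | h
    · exact h
    · exact absurd h (by positivity)
  have hk1 : k = 0 := by exact_mod_cast hk0
  simp [hk1]

end SmoothBoundary

namespace SmoothBoundary

variable {K : Set ℂ} (B : SmoothBoundary K)

/-- Contour integral over the parallel curves. -/
def Nint (h : ℂ → ℂ) (ε : ℝ) : ℂ := ∑ i, ∫ t in (0:ℝ)..1, h (B.nb i ε t) * B.dnb i ε t

/-- Cauchy integral over the parallel curves. -/
def cn (g : ℂ → ℂ) (ε : ℝ) (z : ℂ) : ℂ :=
  ∑ i, ct (B.nb i ε) (fun t => g (B.nb i ε t) * B.dnb i ε t) z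

/-- Winding integral of the parallel curves. -/
def wn (ε : ℝ) (z : ℂ) : ℂ := ∑ i, ct (B.nb i ε) (B.dnb i ε) z

theorem wn_zero (z : ℂ) : B.wn 0 z = B.W z := by
  unfold wn W
  refine Finset.sum_congr rfl fun i _ => ?_
  rw [show B.nb i 0 = B.curve i from funext (B.nb_zero i),
    show B.dnb i 0 = deriv (B.curve i) from funext (B.dnb_zero i)]

theorem Nint_zero (h : ℂ → ℂ) : B.Nint h 0 = contourIntegralOf B.curve h := by
  unfold Nint contourIntegralOf
  simp only [nb_zero, dnb_zero]

theorem cn_eq (g : ℂ → ℂ) (ε : ℝ) (z : ℂ) : B.cn g ε z = B.Nint (fun w => g w / (w - z)) ε := by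
  unfold cn Nint ct
  refine Finset.sum_congr rfl fun i _ => ?_
  congr 1
  ext t
  ring

theorem wn_eq (ε : ℝ) (z : ℂ) : B.wn ε z = B.Nint (fun w => (w - z)⁻¹) ε := by
  unfold wn Nint ct
  refine Finset.sum_congr rfl fun i _ => ?_
  congr 1
  ext t
  ring

theorem Nint_const {U : Set ℂ} (hU : IsOpen U) {σ δ₀ : ℝ}
    (hN : ∀ ε, 0 < ε → ε < δ₀ → ∀ i t, B.nb i (σ * ε) t ∈ U)
    {h : ℂ → ℂ} (hh : DifferentiableOn ℂ h U) {ε₁ ε₂ : ℝ} (h1 : 0 < ε₁) (h1' : ε₁ < δ₀)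
    (h2 : 0 < ε₂) (h2' : ε₂ < δ₀) : B.Nint h (σ * ε₁) = B.Nint h (σ * ε₂) := by
  have hnb : ∀ i (ε t : ℝ), B.curve i t + ε * (σ * (-Complex.I * deriv (B.curve i) t)) = B.nb i (σ * ε) t := by
    intro i ε t; unfold nb; push_cast; ring
  have hdnb : ∀ i (ε t : ℝ), deriv (B.curve i) t + ε * (σ * (-Complex.I * deriv (deriv (B.curve i)) t)) =
      B.dnb i (σ * ε) t := by
    intro i ε t; unfold dnb; push_cast; ring
  unfold Nint
  refine Finset.sum_congr rfl fun i _ => ?_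
  have hc1 := B.dcurve_cont i
  have hc2 := B.ddcurve_cont i
  have := homotopy_inv h U hU hh (B.curve i) (fun t => σ * (-Complex.I * deriv (B.curve i) t))
    (deriv (B.curve i)) (fun t => σ * (-Complex.I * deriv (deriv (B.curve i)) t))
    (B.curve_hasDeriv i) (fun t => ((B.dcurve_hasDeriv i t).const_mul _).const_mul _)
    (B.dcurve_cont i) (by fun_prop) (B.curve01 i) (by simp only [dcurve01]) 0 δ₀
    (fun ε hε t _ => by rw [hnb]; exact hN ε hε.1 hε.2 i t) ε₁ ε₂ ⟨h1, h1'⟩ ⟨h2, h2'⟩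
  simpa only [hnb, hdnb] using this

theorem Nint_cont (σ δ₁ : ℝ) {A : Set ℂ} {G : ℂ → ℂ} (hG : ContinuousOn G A)
    (hA : ∀ ε, 0 ≤ ε → ε < δ₁ → ∀ i t, B.nb i (σ * ε) t ∈ A) (hδ : 0 < δ₁) :
    Tendsto (fun ε : ℝ => B.Nint G (σ * ε)) (𝓝[>] 0) (𝓝 (contourIntegralOf B.curve G)) := by
  have h : ContinuousOn (fun ε : ℝ => B.Nint G (σ * ε)) (Ico 0 δ₁) := by
    unfold Nint
    refine continuousOn_finsetSum _ fun i _ => ?_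
    refine param_cont (fun (ε : ℝ) t => G (B.nb i (σ * ε) t) * B.dnb i (σ * ε) t) _ zero_le_one ?_
    refine ContinuousOn.mul (hG.comp ?_ ?_) ?_
    · exact ((B.nb_cont i).comp (by fun_prop : Continuous fun p : ℝ × ℝ => (σ * p.1, p.2))).continuousOn
    · rintro ⟨ε, t⟩ ⟨hε, -⟩
      exact hA ε hε.1 hε.2 i t
    · exact ((B.dnb_cont i).comp (by fun_prop : Continuous fun p : ℝ × ℝ => (σ * p.1, p.2))).continuousOn
  have h1 := h 0 ⟨le_refl _, hδ⟩
  have h2 := h1.tendsto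
  rw [mul_zero, Nint_zero] at h2
  refine h2.mono_left ?_
  rw [← nhdsWithin_Ioo_eq_nhdsGT hδ]
  exact nhdsWithin_mono _ Ioo_subset_Ico_self

theorem nb_far {z : ℂ} (hz : z ∉ frontier K) : ∀ᶠ δ : ℝ in 𝓝 0, ∀ i t, B.nb i δ t ≠ z := by
  have key : ∀ i, ∀ᶠ δ : ℝ in 𝓝 0, ∀ t ∈ Icc (0:ℝ) 1, B.nb i δ t ≠ z := by
    intro i
    refine isCompact_Icc.eventually_forall_of_forall_eventually
      (P := fun (δ : ℝ) (t : ℝ) => B.nb i δ t ≠ z) ?_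
    intro t _
    refine (B.nb_cont i).continuousAt.eventually_ne ?_
    simp only [nb_zero]
    rintro rfl
    exact hz (B.curve_mem i t)
  filter_upwards [eventually_all.2 key] with δ h i t
  have := h i (Int.fract t) ⟨Int.fract_nonneg _, (Int.fract_lt_one _).le⟩
  rwa [fract_nb] at this

theorem nb_far' {z : ℂ} (hz : z ∉ frontier K) (σ : ℝ) : ∃ δ₁ > 0, ∀ ε, 0 ≤ ε → ε < δ₁ →
    ∀ i t, B.nb i (σ * ε) t ≠ z := by
  have h : Tendsto (fun ε : ℝ => σ * ε) (𝓝 0) (𝓝 0) := by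
    have h : Continuous fun ε : ℝ => σ * ε := by fun_prop
    have h2 := h.tendsto 0
    rwa [mul_zero] at h2
  obtain ⟨r, hr, hb⟩ := Metric.eventually_nhds_iff.1 (h.eventually (B.nb_far hz))
  exact ⟨r, hr, fun ε h1 h2 => hb (by rw [Real.dist_eq, sub_zero, abs_of_nonneg h1]; exact h2)⟩

theorem cn_diff {g : ℂ → ℂ} {ε : ℝ} (hg : ∀ i, Continuous fun t => g (B.nb i ε t)) {z : ℂ}
    (hz : ∀ i t, B.nb i ε t ≠ z) : DifferentiableAt ℂ (B.cn g ε) z := by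
  unfold cn
  refine DifferentiableAt.fun_sum fun i _ => ?_
  refine (ct_hasDerivAt (B.nb_cont1 i ε).continuousOn ((hg i).mul (B.dnb_cont1 i ε)).continuousOn
    ?_).differentiableAt
  rintro ⟨t, -, h⟩; exact hz i t h

theorem wn_deriv {ε : ℝ} {z : ℂ} (hz : ∀ i t, B.nb i ε t ≠ z) : HasDerivAt (B.wn ε) 0 z := by
  unfold wn
  have := HasDerivAt.fun_sum (u := Finset.univ) (x := z) fun i _ =>
    wind_deriv (B.nb i ε) (B.dnb i ε) (B.nb_hasDeriv i ε) (B.dnb_cont1 i ε) (B.nb01 i ε) (z := z) (by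
      rintro ⟨t, -, h⟩; exact hz i t h)
  simpa using this

theorem nb_avoid_open (ε : ℝ) : IsOpen {z : ℂ | ∀ i t, B.nb i ε t ≠ z} := by
  have : {z : ℂ | ∀ i t, B.nb i ε t ≠ z} = (⋃ i, B.nb i ε '' Icc 0 1)ᶜ := by
    ext z
    simp only [mem_ofPred_eq, mem_compl_iff, mem_iUnion, not_exists]
    constructor
    · rintro h i ⟨t, -, ht⟩; exact h i t ht
    · intro h i t ht
      exact h i ⟨Int.fract t, ⟨Int.fract_nonneg _, (Int.fract_lt_one _).le⟩, by rw [fract_nb]; exact ht⟩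
  rw [this]
  exact (isClosed_iUnion_of_finite fun i => (isCompact_Icc.image (B.nb_cont1 i ε)).isClosed).isOpen_compl

theorem nb_bounded (ε : ℝ) : ∀ᶠ z in cobounded ℂ, ∀ i t, B.nb i ε t ≠ z := by
  have hc : IsCompact (⋃ i, B.nb i ε '' Icc (0:ℝ) 1) :=
    isCompact_iUnion fun i => isCompact_Icc.image (B.nb_cont1 i ε)
  have h1 : ∀ᶠ z in cobounded ℂ, z ∈ (⋃ i, B.nb i ε '' Icc (0:ℝ) 1)ᶜ := isBounded_def.1 hc.isBounded
  filter_upwards [h1] with z hz i t h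
  exact hz (mem_iUnion.2 ⟨i, Int.fract t, ⟨Int.fract_nonneg _, (Int.fract_lt_one _).le⟩, by
    rw [fract_nb]; exact h⟩)

theorem cn_tendsto {g : ℂ → ℂ} {ε : ℝ} (hg : ∀ i, Continuous fun t => g (B.nb i ε t)) :
    Tendsto (B.cn g ε) (cobounded ℂ) (𝓝 0) := by
  have := tendsto_finsetSum Finset.univ fun i (_ : i ∈ Finset.univ) =>
    ct_tendsto (B.nb_cont1 i ε).continuousOn ((hg i).mul (B.dnb_cont1 i ε)).continuousOn
  rw [Finset.sum_const_zero] at this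
  exact this

theorem cn_mul_tendsto {g : ℂ → ℂ} {ε : ℝ} (hg : ∀ i, Continuous fun t => g (B.nb i ε t)) :
    Tendsto (fun z => z * B.cn g ε z) (cobounded ℂ) (𝓝 (-B.Nint g ε)) := by
  have := tendsto_finsetSum Finset.univ fun i (_ : i ∈ Finset.univ) =>
    ct_mul_tendsto (B.nb_cont1 i ε).continuousOn ((hg i).mul (B.dnb_cont1 i ε)).continuousOn
  simp only [← Finset.mul_sum, Finset.sum_neg_distrib] at this
  exact this

theorem Nint_one (ε : ℝ) : B.Nint (fun _ => 1) ε = 0 := by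
  unfold Nint
  refine Finset.sum_eq_zero fun i _ => ?_
  simp only [one_mul]
  rw [intervalIntegral.integral_eq_sub_of_hasDerivAt (fun t _ => B.nb_hasDeriv i ε t)
    ((B.dnb_cont1 i ε).intervalIntegrable _ _), nb01, sub_self]

theorem wn_eq_cn (ε : ℝ) : B.wn ε = B.cn (fun _ => 1) ε := by
  ext z; simp [wn, cn]

theorem wn_mul_tendsto (ε : ℝ) : Tendsto (fun z => z * B.wn ε z) (cobounded ℂ) (𝓝 0) := by
  rw [wn_eq_cn]
  have := B.cn_mul_tendsto (g := fun _ => 1) (ε := ε) (fun i => continuous_const)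
  rwa [Nint_one, neg_zero] at this

theorem wn_tendsto (ε : ℝ) : Tendsto (B.wn ε) (cobounded ℂ) (𝓝 0) := by
  rw [wn_eq_cn]
  exact B.cn_tendsto (g := fun _ => 1) (ε := ε) (fun i => continuous_const)

theorem glue {U : Set ℂ} (hU : IsOpen U) (hUF : ∀ z ∈ U, z ∉ frontier K) {σ δ₀ : ℝ}
    (hN : ∀ ε, 0 < ε → ε < δ₀ → ∀ i t, B.nb i (σ * ε) t ∈ U) {v : ℂ}
    (hv : ∀ ε, 0 < ε → ε < δ₀ → ∀ z ∉ U, B.wn (σ * ε) z = v) {g : ℂ → ℂ}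
    (hg : DifferentiableOn ℂ g U) {l : ℂ} (hl : Tendsto g (cobounded ℂ ⊓ 𝓟 U) (𝓝 l))
    (hc : (∀ᶠ z in cobounded ℂ, z ∈ U) ∨ (v = 0 ∧ ∀ᶠ z in cobounded ℂ, z ∉ U))
    {ε : ℝ} (h0 : 0 < ε) (h1 : ε < δ₀) {z : ℂ} (hz : ∀ i t, B.nb i (σ * ε) t ≠ z) :
    B.cn g (σ * ε) z + (v - B.wn (σ * ε) z) * g z = v * l := by
  classical
  have hgc : ∀ ε, 0 < ε → ε < δ₀ → ∀ i, Continuous fun t => g (B.nb i (σ * ε) t) := fun ε h0 h1 i =>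
    hg.continuousOn.comp_continuous (B.nb_cont1 i _) (fun t => hN ε h0 h1 i t)
  -- independence of ε
  have hE : ∀ z ∈ U, ∀ ε, 0 < ε → ε < δ₀ → (∀ i t, B.nb i (σ * ε) t ≠ z) →
      B.Nint (dslope g z) (σ * ε) = B.cn g (σ * ε) z - B.wn (σ * ε) z * g z := by
    intro z hzU ε h0 h1 hz
    unfold Nint cn wn
    rw [Finset.sum_mul, ← Finset.sum_sub_distrib]
    refine Finset.sum_congr rfl fun i _ => ?_
    unfold ct
    have hne : ∀ t, B.nb i (σ * ε) t - z ≠ 0 := fun t => sub_ne_zero.2 (hz i t)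
    have c1 : Continuous fun t => g (B.nb i (σ * ε) t) * B.dnb i (σ * ε) t / (B.nb i (σ * ε) t - z) :=
      ((hgc ε h0 h1 i).mul (B.dnb_cont1 i _)).div ((B.nb_cont1 i _).sub continuous_const) hne
    have c2 : Continuous fun t => B.dnb i (σ * ε) t / (B.nb i (σ * ε) t - z) :=
      (B.dnb_cont1 i _).div ((B.nb_cont1 i _).sub continuous_const) hne
    have c3 : Continuous fun t => B.dnb i (σ * ε) t / (B.nb i (σ * ε) t - z) * g z := c2.mul continuous_const
    rw [← intervalIntegral.integral_mul_const, ← intervalIntegral.integral_sub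
      (c1.intervalIntegrable _ _) (c3.intervalIntegrable _ _)]
    congr 1
    ext t
    rw [dslope_of_ne _ (hz i t), slope_def_field]
    ring
  have hEc : ∀ z ∈ U, ∀ ε₁ ε₂, 0 < ε₁ → ε₁ < δ₀ → 0 < ε₂ → ε₂ < δ₀ →
      B.Nint (dslope g z) (σ * ε₁) = B.Nint (dslope g z) (σ * ε₂) := by
    intro z hzU ε₁ ε₂ a1 a2 b1 b2
    exact B.Nint_const hU hN ((Complex.differentiableOn_dslope (hU.mem_nhds hzU)).2 hg) a1 a2 b1 b2
  set F : ℂ → ℂ := fun z => if z ∈ U then B.Nint (dslope g z) (σ * ε) + v * g z else B.cn g (σ * ε) z with hF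
  have hF1 : ∀ z, (∀ i t, B.nb i (σ * ε) t ≠ z) → F z = B.cn g (σ * ε) z + (v - B.wn (σ * ε) z) * g z := by
    intro z hz
    by_cases hzU : z ∈ U
    · simp only [hF, if_pos hzU]
      rw [hE z hzU ε h0 h1 hz]; ring
    · simp only [hF, if_neg hzU]
      rw [hv ε h0 h1 z hzU]; ring
  have hFd : Differentiable ℂ F := by
    intro z
    by_cases hzU : z ∈ U
    · obtain ⟨δ₁, hδ₁, hfar⟩ := B.nb_far' (hUF z hzU) σ
      set e := min δ₁ ε / 2 with he
      have hm : 0 < min δ₁ ε := lt_min hδ₁ h0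
      have e0 : 0 < e := by linarith
      have e1 : e < δ₁ := by linarith [min_le_left δ₁ ε]
      have e2 : e < δ₀ := by linarith [min_le_right δ₁ ε]
      have hze := hfar e e0.le e1
      have : F =ᶠ[𝓝 z] fun z => B.cn g (σ * e) z + (v - B.wn (σ * e) z) * g z := by
        filter_upwards [hU.mem_nhds hzU, (B.nb_avoid_open (σ * e)).mem_nhds hze] with w hw hw2
        simp only [hF, if_pos hw]
        rw [hEc w hw ε e h0 h1 e0 e2, hE w hw e e0 e2 hw2]; ring
      refine DifferentiableAt.congr_of_eventuallyEq ?_ this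
      exact (B.cn_diff (hgc e e0 e2) hze).add (((B.wn_deriv hze).differentiableAt.const_sub v).mul
        (hg.differentiableAt (hU.mem_nhds hzU)))
    · have hze : ∀ i t, B.nb i (σ * ε) t ≠ z := by
        rintro i t rfl; exact hzU (hN ε h0 h1 i t)
      have hw : ∀ᶠ w in 𝓝 z, B.wn (σ * ε) w = v := by
        obtain ⟨r, hr, hball⟩ := Metric.isOpen_iff.1 (B.nb_avoid_open (σ * ε)) z hze
        filter_upwards [ball_mem_nhds z hr] with w hw
        rw [← hv ε h0 h1 z hzU]
        exact isOpen_ball.is_const_of_deriv_eq_zero (convex_ball z r).isPreconnected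
          (fun x hx => (B.wn_deriv (hball hx)).differentiableAt.differentiableWithinAt)
          (fun x hx => (B.wn_deriv (hball hx)).deriv) hw (mem_ball_self hr)
      have : F =ᶠ[𝓝 z] B.cn g (σ * ε) := by
        filter_upwards [hw, (B.nb_avoid_open (σ * ε)).mem_nhds hze] with w hw hw2
        rw [hF1 w hw2, hw]; ring
      exact (B.cn_diff (hgc ε h0 h1) hze).congr_of_eventuallyEq this
  have hlim : Tendsto F (cocompact ℂ) (𝓝 (v * l)) := by
    rw [← Metric.cobounded_eq_cocompact]
    have hav := B.nb_bounded (σ * ε)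
    rcases hc with hc | ⟨hv0, hc⟩
    · have hle : cobounded ℂ ⊓ 𝓟 U = cobounded ℂ := inf_eq_left.2 (le_principal_iff.2 hc)
      rw [hle] at hl
      have := (B.cn_tendsto (hgc ε h0 h1)).add (((B.wn_tendsto (σ * ε)).const_sub v).mul hl)
      rw [zero_add, sub_zero] at this
      exact this.congr' (hav.mono fun w hw => (hF1 w hw).symm)
    · rw [hv0, zero_mul]
      refine (B.cn_tendsto (hgc ε h0 h1)).congr' ?_
      filter_upwards [hc] with w hw
      simp [hF, if_neg hw]
  rw [← hF1 z hz]
  exact hFd.apply_eq_of_tendsto_cocompact z hlim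

/-- The winding integrals of parallel curves. -/
theorem wn_side {U : Set ℂ} (hU : IsOpen U) {σ δ₀ : ℝ}
    (hN : ∀ ε, 0 < ε → ε < δ₀ → ∀ i t, B.nb i (σ * ε) t ∈ U) {v : ℂ} {S : Set ℂ}
    (hS : ∀ z ∈ S, z ∉ frontier K ∧ z ∉ U ∧ B.W z = v) (hcl : Uᶜ ⊆ closure S)
    (ε : ℝ) (h0 : 0 < ε) (h1 : ε < δ₀) (z : ℂ) (hz : z ∉ U) : B.wn (σ * ε) z = v := by
  have hone : ∀ z ∈ S, B.wn (σ * ε) z = v := by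
    intro z hzS
    obtain ⟨hzf, hzU, hW⟩ := hS z hzS
    have hd : DifferentiableOn ℂ (fun w => (w - z)⁻¹) U := by
      intro w hw
      refine ((differentiableAt_id.sub_const z).inv ?_).differentiableWithinAt
      simp only [id]
      intro h
      exact hzU (by rw [← sub_eq_zero.1 h]; exact hw)
    have hconst : ∀ e, 0 < e → e < δ₀ → B.wn (σ * e) z = B.wn (σ * ε) z := by
      intro e a1 a2
      rw [wn_eq, wn_eq]
      exact B.Nint_const hU hN hd a1 a2 h0 h1
    obtain ⟨δ₁, hδ₁, hfar⟩ := B.nb_far' hzf σ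
    have ht := B.Nint_cont σ δ₁ (A := {z}ᶜ) (G := fun w => (w - z)⁻¹) (by
      refine ContinuousOn.inv₀ (by fun_prop) ?_
      intro w hw; exact sub_ne_zero.2 hw) hfar hδ₁
    rw [← Nint_zero, ← wn_eq, wn_zero, hW] at ht
    refine tendsto_nhds_unique (tendsto_const_nhds.congr' ?_) ht
    filter_upwards [Ioo_mem_nhdsGT (lt_trans h0 h1)] with e he
    rw [← wn_eq]; exact (hconst e he.1 he.2).symm
  have hze : ∀ i t, B.nb i (σ * ε) t ≠ z := by
    rintro i t rfl; exact hz (hN ε h0 h1 i t)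
  have hc := (B.wn_deriv hze).continuousAt.continuousWithinAt (s := S)
  have hcls : z ∈ closure S := hcl hz
  have : (𝓝[S] z).NeBot := mem_closure_iff_nhdsWithin_neBot.1 hcls
  refine tendsto_nhds_unique hc.tendsto (tendsto_const_nhds.congr' ?_)
  filter_upwards [self_mem_nhdsWithin] with w hw
  exact (hone w hw).symm

end SmoothBoundary

namespace SmoothBoundary

variable {K : Set ℂ} (B : SmoothBoundary K)

theorem curve_mem_K (hK : IsCompact K) (i : Fin B.n) (t : ℝ) : B.curve i t ∈ K :=
  hK.isClosed.frontier_subset (B.curve_mem i t)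

theorem curve_notMem_int (i : Fin B.n) (t : ℝ) : B.curve i t ∈ (interior K)ᶜ :=
  (B.curve_mem i t).2

theorem K_subset_closure (B : SmoothBoundary K) (hK : IsCompact K) (hconn : IsConnected Kᶜ) : K ⊆ closure (interior K) := by
  intro z hz
  by_cases hzi : z ∈ interior K
  · exact subset_closure hzi
  · obtain ⟨i, t, rfl⟩ := B.mem_frontier (z := z) (by rw [hK.isClosed.frontier_eq]; exact ⟨hz, hzi⟩)
    obtain ⟨δ₀, hδ0, hδ₀⟩ := B.collar_sides hK hconn
    refine mem_closure_of_tendsto (B.nb_tendsto i (-1) t) ?_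
    filter_upwards [Ioo_mem_nhdsGT hδ0] with ε hε
    exact (hδ₀ ε hε.1 hε.2 i t).2

theorem compl_cobounded (hK : IsCompact K) : ∀ᶠ z in cobounded ℂ, z ∈ Kᶜ := isBounded_def.1 hK.isBounded

theorem cobounded_inf (hK : IsCompact K) : cobounded ℂ ⊓ 𝓟 Kᶜ = cobounded ℂ :=
  inf_eq_left.2 (le_principal_iff.2 (compl_cobounded hK))

theorem notMem_frontier_of_compl (hK : IsCompact K) {z : ℂ} (hz : z ∈ Kᶜ) : z ∉ frontier K :=
  fun h => hz (hK.isClosed.frontier_subset h)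

theorem glue_out (hK : IsCompact K) (hconn : IsConnected Kᶜ) : ∃ δ₀ > 0,
    (∀ ε, 0 < ε → ε < δ₀ → ∀ i t, B.nb i (1 * ε) t ∈ Kᶜ) ∧
    ∀ (g : ℂ → ℂ) (l : ℂ), DifferentiableOn ℂ g Kᶜ → Tendsto g (cobounded ℂ) (𝓝 l) →
      ∀ ε, 0 < ε → ε < δ₀ → ∀ z, (∀ i t, B.nb i (1 * ε) t ≠ z) →
    B.cn g (1 * ε) z + (2 * Real.pi * Complex.I - B.wn (1 * ε) z) * g z = 2 * Real.pi * Complex.I * l := by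
  obtain ⟨δ₀, hδ0, hδ₀⟩ := B.collar_sides hK hconn
  have hN : ∀ ε, 0 < ε → ε < δ₀ → ∀ i t, B.nb i (1 * ε) t ∈ Kᶜ := fun ε a b i t => (hδ₀ ε a b i t).1
  refine ⟨δ₀, hδ0, hN, ?_⟩
  intro g l hg hl ε h0 h1 z hz
  refine B.glue hK.isClosed.isOpen_compl (fun z hz => notMem_frontier_of_compl hK hz) hN ?_ hg
    (by rw [cobounded_inf hK]; exact hl) (Or.inl (compl_cobounded hK)) h0 h1 hz
  refine B.wn_side hK.isClosed.isOpen_compl hN (S := interior K) ?_ ?_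
  · intro z hz
    exact ⟨fun h => h.2 hz, fun h => h (interior_subset hz), B.W_int hz⟩
  · rw [compl_compl]; exact B.K_subset_closure hK hconn

theorem glue_in (hK : IsCompact K) (hconn : IsConnected Kᶜ) : ∃ δ₀ > 0,
    (∀ ε, 0 < ε → ε < δ₀ → ∀ i t, B.nb i (-1 * ε) t ∈ interior K) ∧
    ∀ (g : ℂ → ℂ), DifferentiableOn ℂ g (interior K) →
      ∀ ε, 0 < ε → ε < δ₀ → ∀ z, (∀ i t, B.nb i (-1 * ε) t ≠ z) →
    B.cn g (-1 * ε) z = B.wn (-1 * ε) z * g z := by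
  obtain ⟨δ₀, hδ0, hδ₀⟩ := B.collar_sides hK hconn
  have hN : ∀ ε, 0 < ε → ε < δ₀ → ∀ i t, B.nb i (-1 * ε) t ∈ interior K := fun ε a b i t => (hδ₀ ε a b i t).2
  refine ⟨δ₀, hδ0, hN, ?_⟩
  intro g hg ε h0 h1 z hz
  have hcob : ∀ᶠ z in cobounded ℂ, z ∉ interior K :=
    (compl_cobounded hK).mono fun z hz h => hz (interior_subset h)
  have hbot : cobounded ℂ ⊓ 𝓟 (interior K) = ⊥ := inf_principal_eq_bot.2 hcob
  have := B.glue isOpen_interior (fun z hz h => h.2 hz) hN (v := 0) ?_ hg (l := 0)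
    (by rw [hbot]; exact tendsto_bot) (Or.inr ⟨rfl, hcob⟩) h0 h1 hz
  · linear_combination this
  refine B.wn_side isOpen_interior hN (S := Kᶜ) ?_ ?_
  · intro z hz
    exact ⟨notMem_frontier_of_compl hK hz, fun h => hz (interior_subset h), B.W_compl hK hconn hz⟩
  · rw [closure_compl]

theorem out_tendsto_nb (hK : IsCompact K) (hconn : IsConnected Kᶜ) : ∃ δ₀ > 0,
    (∀ ε, 0 < ε → ε < δ₀ → ∀ i t, B.nb i (1 * ε) t ∈ Kᶜ) ∧
    ∀ (g : ℂ → ℂ) (l : ℂ), DifferentiableOn ℂ g Kᶜ → Tendsto g (cobounded ℂ) (𝓝 l) →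
      ∀ ε, 0 < ε → ε < δ₀ → Tendsto (fun z => z * (g z - l)) (cobounded ℂ)
        (𝓝 ((2 * Real.pi * Complex.I)⁻¹ * B.Nint g (1 * ε))) := by
  obtain ⟨δ₀, hδ0, hN, hgl⟩ := B.glue_out hK hconn
  refine ⟨δ₀, hδ0, hN, fun g l hg hl ε h0 h1 => ?_⟩
  have hgc : ∀ i, Continuous fun t => g (B.nb i (1 * ε) t) := fun i =>
    hg.continuousOn.comp_continuous (B.nb_cont1 i _) (fun t => hN ε h0 h1 i t)
  have := (((B.wn_mul_tendsto (1 * ε)).mul hl).sub (B.cn_mul_tendsto hgc)).const_mul (2 * Real.pi * Complex.I)⁻¹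
  rw [zero_mul, zero_sub, neg_neg] at this
  refine this.congr' ?_
  filter_upwards [B.nb_bounded (1 * ε)] with z hz
  have h := hgl g l hg hl ε h0 h1 z hz
  have hpi := two_pi_I_ne
  field_simp
  field_simp at h
  linear_combination (-z) * h

theorem memA_iff (hK : IsCompact K) {g : ℂ → ℂ} {l : ℂ} : MemA K g l ↔
    ContinuousOn g (interior K)ᶜ ∧ DifferentiableOn ℂ g Kᶜ ∧ Tendsto g (cobounded ℂ) (𝓝 l) := by
  unfold MemA; rw [cobounded_inf hK]

theorem out_deriv (hK : IsCompact K) (hconn : IsConnected Kᶜ) {g : ℂ → ℂ} {l : ℂ} (hg : MemA K g l) :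
    Tendsto (fun z => z * (g z - l)) (cobounded ℂ)
        (𝓝 ((2 * Real.pi * Complex.I)⁻¹ * contourIntegralOf B.curve g)) := by
  obtain ⟨δ₀, hδ0, hN, hgl⟩ := B.out_tendsto_nb hK hconn
  obtain ⟨g1, g2, g3⟩ := (memA_iff hK).1 hg
  have h2 := hgl g l g2 g3 (δ₀ / 2) (by linarith) (by linarith)
  have h3 := B.Nint_cont 1 δ₀ g1 (fun ε a b i t => by
    rcases a.eq_or_lt with h | h
    · rw [← h, mul_zero, nb_zero]; exact B.curve_notMem_int i t
    · exact fun h' => hN ε h b i t (interior_subset h')) hδ0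
  have h4 : B.Nint g (1 * (δ₀ / 2)) = contourIntegralOf B.curve g := by
    refine tendsto_nhds_unique (tendsto_const_nhds.congr' ?_) h3
    filter_upwards [Ioo_mem_nhdsGT hδ0] with ε hε
    exact B.Nint_const hK.isClosed.isOpen_compl hN g2 (by linarith) (by linarith) hε.1 hε.2
  rwa [h4] at h2

/-- Cauchy integral over the boundary. -/
def cb (g : ℂ → ℂ) (z : ℂ) : ℂ := contourIntegralOf B.curve (fun w => g w / (w - z))

theorem wn_lim {z : ℂ} (hz : z ∉ frontier K) (σ : ℝ) :
    Tendsto (fun ε : ℝ => B.wn (σ * ε) z) (𝓝[>] 0) (𝓝 (B.W z)) := by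
  obtain ⟨δ₁, hδ₁, hfar⟩ := B.nb_far' hz σ
  have ht := B.Nint_cont σ δ₁ (A := {z}ᶜ) (G := fun w => (w - z)⁻¹) (by
      refine ContinuousOn.inv₀ (by fun_prop) ?_
      intro w hw; exact sub_ne_zero.2 hw) hfar hδ₁
  simp only [← Nint_zero, ← wn_eq, wn_zero] at ht
  exact ht

theorem cn_lim {z : ℂ} (hz : z ∉ frontier K) (σ : ℝ) {g : ℂ → ℂ} {A : Set ℂ} (hg : ContinuousOn g A)
    {δ₀ : ℝ} (hδ0 : 0 < δ₀) (hA : ∀ ε, 0 ≤ ε → ε < δ₀ → ∀ i t, B.nb i (σ * ε) t ∈ A) :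
    Tendsto (fun ε : ℝ => B.cn g (σ * ε) z) (𝓝[>] 0) (𝓝 (B.cb g z)) := by
  obtain ⟨δ₁, hδ₁, hfar⟩ := B.nb_far' hz σ
  have ht := B.Nint_cont σ (min δ₀ δ₁) (A := A \ {z}) (G := fun w => g w / (w - z)) (by
      refine ContinuousOn.div (hg.mono sdiff_subset) (by fun_prop) ?_
      intro w hw; exact sub_ne_zero.2 hw.2)
      (fun ε a b i t => ⟨hA ε a (b.trans_le (min_le_left _ _)) i t,
        hfar ε a (b.trans_le (min_le_right _ _)) i t⟩) (lt_min hδ0 hδ₁)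
  simp only [← cn_eq] at ht
  exact ht

theorem nb_far_ev {z : ℂ} (hz : z ∉ frontier K) (σ : ℝ) :
    ∀ᶠ ε : ℝ in 𝓝[>] 0, ∀ i t, B.nb i (σ * ε) t ≠ z := by
  obtain ⟨δ₁, hδ₁, hfar⟩ := B.nb_far' hz σ
  filter_upwards [Ioo_mem_nhdsGT hδ₁] with ε hε
  exact hfar ε hε.1.le hε.2

theorem cauchy_out (hK : IsCompact K) (hconn : IsConnected Kᶜ) {g : ℂ → ℂ} {l : ℂ} (hg : MemA K g l)
    {z : ℂ} (hz : z ∉ frontier K) :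
    B.cb g z + (2 * Real.pi * Complex.I - B.W z) * g z = 2 * Real.pi * Complex.I * l := by
  obtain ⟨δ₀, hδ0, hN, hgl⟩ := B.glue_out hK hconn
  obtain ⟨g1, g2, g3⟩ := (memA_iff hK).1 hg
  have h1 := B.cn_lim hz 1 g1 hδ0 (fun ε a b i t => by
    rcases a.eq_or_lt with h | h
    · rw [← h, mul_zero, nb_zero]; exact B.curve_notMem_int i t
    · exact fun h' => hN ε h b i t (interior_subset h'))
  have h2 := h1.add (((B.wn_lim hz 1).const_sub (2 * Real.pi * Complex.I)).mul_const (g z))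
  refine tendsto_nhds_unique h2 (tendsto_const_nhds.congr' ?_)
  filter_upwards [Ioo_mem_nhdsGT hδ0, B.nb_far_ev hz 1] with ε hε hε2
  exact (hgl g l g2 g3 ε hε.1 hε.2 z hε2).symm

theorem cauchy_out_compl (hK : IsCompact K) (hconn : IsConnected Kᶜ) {g : ℂ → ℂ} {l : ℂ} (hg : MemA K g l)
    {z : ℂ} (hz : z ∈ Kᶜ) : B.cb g z = 2 * Real.pi * Complex.I * (l - g z) := by
  have := B.cauchy_out hK hconn hg (notMem_frontier_of_compl hK hz)
  rw [B.W_compl hK hconn hz] at this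
  linear_combination this

theorem cauchy_in (hK : IsCompact K) (hconn : IsConnected Kᶜ) {g : ℂ → ℂ}
    (hg1 : ContinuousOn g K) (hg2 : DifferentiableOn ℂ g (interior K))
    {z : ℂ} (hz : z ∈ Kᶜ) : B.cb g z = 0 := by
  have hzf := notMem_frontier_of_compl hK hz
  obtain ⟨δ₀, hδ0, hN, hgl⟩ := B.glue_in hK hconn
  have h1 := B.cn_lim hzf (-1) hg1 hδ0 (fun ε a b i t => by
    rcases a.eq_or_lt with h | h
    · rw [← h, mul_zero, nb_zero]; exact B.curve_mem_K hK i t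
    · exact interior_subset (hN ε h b i t))
  have h2 := (B.wn_lim hzf (-1)).mul_const (g z)
  rw [B.W_compl hK hconn hz, zero_mul] at h2
  refine tendsto_nhds_unique h1 (h2.congr' ?_)
  filter_upwards [Ioo_mem_nhdsGT hδ0, B.nb_far_ev hzf (-1)] with ε hε hε2
  exact (hgl g hg2 ε hε.1 hε.2 z hε2).symm

theorem cn_zero (g : ℂ → ℂ) : B.cn g 0 = B.cb g := by
  ext z; rw [cn_eq, Nint_zero]; rfl

theorem cb_mul_tendsto {g : ℂ → ℂ} (hg : ∀ i, Continuous fun t => g (B.curve i t)) :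
    Tendsto (fun z => z * B.cb g z) (cobounded ℂ) (𝓝 (-contourIntegralOf B.curve g)) := by
  have := B.cn_mul_tendsto (g := g) (ε := 0) (by simpa only [nb_zero] using hg)
  rwa [cn_zero, Nint_zero] at this

theorem cb_tendsto {g : ℂ → ℂ} (hg : ∀ i, Continuous fun t => g (B.curve i t)) :
    Tendsto (B.cb g) (cobounded ℂ) (𝓝 0) := by
  have := B.cn_tendsto (g := g) (ε := 0) (by simpa only [nb_zero] using hg)
  rwa [cn_zero] at this

theorem cb_diff {g : ℂ → ℂ} (hg : ∀ i, Continuous fun t => g (B.curve i t)) {z : ℂ} (hz : z ∉ frontier K) :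
    DifferentiableAt ℂ (B.cb g) z := by
  have := B.cn_diff (g := g) (ε := 0) (z := z) (by simpa only [nb_zero] using hg) (by
    intro i t h; rw [nb_zero] at h; exact hz (by rw [← h]; exact B.curve_mem i t))
  rwa [cn_zero] at this

theorem int_in (hK : IsCompact K) (hconn : IsConnected Kᶜ) {g : ℂ → ℂ}
    (hg1 : ContinuousOn g K) (hg2 : DifferentiableOn ℂ g (interior K)) :
    contourIntegralOf B.curve g = 0 := by
  have h1 := B.cb_mul_tendsto (g := g) (fun i => hg1.comp_continuous (B.curve_cont i) (B.curve_mem_K hK i))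
  have h2 : Tendsto (fun z => z * B.cb g z) (cobounded ℂ) (𝓝 0) := by
    refine tendsto_const_nhds.congr' ?_
    filter_upwards [compl_cobounded hK] with z hz
    rw [B.cauchy_in hK hconn hg1 hg2 hz, mul_zero]
  exact neg_eq_zero.1 (tendsto_nhds_unique h1 h2)

end SmoothBoundary

namespace SmoothBoundary

variable {K : Set ℂ} (B : SmoothBoundary K)

theorem exists_quot (μ : Fin B.n → ℝ → ℂ) (hμ : ∀ i, ContDiff ℝ ∞ (μ i))
    (hp : ∀ i, Function.Periodic (μ i) 1) (j i : Fin B.n) : ∃ Q : ℝ × ℝ → ℂ, ContDiff ℝ ∞ Q ∧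
    ∀ s t, μ j s - μ i t = (B.curve j s - B.curve i t) * Q (s, t) := by
  by_cases h : j = i
  · subst h
    obtain ⟨H, hH, hH1, -⟩ := exists_div_ee (fun p => μ j p.1 - μ j p.2)
      (((hμ j).comp contDiff_fst).sub ((hμ j).comp contDiff_snd)) (by
        intro s t k hk
        simp only
        rw [show s = t + k by linarith, curve_add_int _ (hp j), sub_self])
    refine ⟨fun p => H p / Complex.exp (B.L j p), cdiv hH (B.L_smooth j).cexp (fun _ => Complex.exp_ne_zero _), ?_⟩
    intro s t
    have h1 := hH1 s t
    simp only at h1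
    rw [h1, B.chord]
    have := Complex.exp_ne_zero (B.L j (s, t))
    field_simp
  · refine ⟨fun p => (μ j p.1 - μ i p.2) / (B.curve j p.1 - B.curve i p.2), ?_, ?_⟩
    · exact cdiv (((hμ j).comp contDiff_fst).sub ((hμ i).comp contDiff_snd))
        (((B.smooth j).comp contDiff_fst).sub ((B.smooth i).comp contDiff_snd))
        (fun p => B.curve_ne i j h p.1 p.2)
    · intro s t
      have := B.curve_ne i j h s t
      field_simp

/-- Lipschitz on the boundary. -/
def LipB (_ : SmoothBoundary K) (m : ℂ → ℂ) : Prop :=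
  ∃ M : ℝ, 0 ≤ M ∧ ∀ z ∈ frontier K, ∀ w ∈ frontier K, ‖m z - m w‖ ≤ M * ‖z - w‖

theorem exists_dens (μ : Fin B.n → ℝ → ℂ) (hμ : ∀ i, ContDiff ℝ ∞ (μ i))
    (hp : ∀ i, Function.Periodic (μ i) 1) : ∃ m : ℂ → ℂ, (∀ i t, m (B.curve i t) = μ i t) ∧ B.LipB m := by
  classical
  set m : ℂ → ℂ := fun z => if h : ∃ i t, B.curve i t = z then μ h.choose h.choose_spec.choose else 0 with hm
  have h1 : ∀ i t, m (B.curve i t) = μ i t := by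
    intro i t
    have h : ∃ j s, B.curve j s = B.curve i t := ⟨i, t, rfl⟩
    simp only [hm, dif_pos h]
    have e1 := h.choose_spec.choose_spec
    set s := h.choose_spec.choose with hs
    set j := h.choose with hj
    by_cases hji : j = i
    · rw [hji] at e1 ⊢
      obtain ⟨k, hk⟩ := (B.curve_iff i _ _).1 e1
      rw [show s = t + k by linarith, curve_add_int _ (hp i)]
    · exact absurd (sub_eq_zero.2 e1) (B.curve_ne i j hji s t)
  refine ⟨m, h1, ?_⟩
  have h2 : ∀ j i, ∃ M : ℝ, 0 ≤ M ∧ ∀ s t, ‖μ j s - μ i t‖ ≤ M * ‖B.curve j s - B.curve i t‖ := by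
    intro j i
    obtain ⟨Q, hQ, hQ1⟩ := B.exists_quot μ hμ hp j i
    obtain ⟨M, hM⟩ := (isCompact_Icc.prod isCompact_Icc).exists_bound_of_continuousOn
      (s := Icc (0:ℝ) 1 ×ˢ Icc (0:ℝ) 1) hQ.continuous.continuousOn
    have hf : ∀ s : ℝ, Int.fract s ∈ Icc (0:ℝ) 1 := fun s => ⟨Int.fract_nonneg _, (Int.fract_lt_one _).le⟩
    have hμf : ∀ j (s : ℝ), μ j (Int.fract s) = μ j s := by
      intro j s
      have := curve_add_int _ (hp j) (Int.fract s) ⌊s⌋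
      rw [Int.fract_add_floor] at this
      exact this.symm
    refine ⟨M, (norm_nonneg _).trans (hM (0, 0) (by simp)), fun s t => ?_⟩
    rw [← hμf j s, ← hμf i t, ← B.fract_curve j s, ← B.fract_curve i t, hQ1, norm_mul, mul_comm]
    exact mul_le_mul_of_nonneg_right (hM _ ⟨hf s, hf t⟩) (norm_nonneg _)
  choose M hM0 hM using h2
  refine ⟨∑ j, ∑ i, M j i, Finset.sum_nonneg fun j _ => Finset.sum_nonneg fun i _ => hM0 j i, ?_⟩
  intro z hz w hw
  obtain ⟨j, s, rfl⟩ := B.mem_frontier hz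
  obtain ⟨i, t, rfl⟩ := B.mem_frontier hw
  rw [h1, h1]
  refine (hM j i s t).trans (mul_le_mul_of_nonneg_right ?_ (norm_nonneg _))
  have e1 : M j i ≤ ∑ i, M j i := Finset.single_le_sum (f := fun i => M j i) (fun i _ => hM0 j i) (Finset.mem_univ i)
  have e2 : ∑ i, M j i ≤ ∑ j, ∑ i, M j i := Finset.single_le_sum (f := fun j => ∑ i, M j i)
    (fun j _ => Finset.sum_nonneg fun i _ => hM0 j i) (Finset.mem_univ j)
  exact e1.trans e2

variable {B} in
theorem LipB.cont {m : ℂ → ℂ} (hm : B.LipB m) (i : Fin B.n) : Continuous fun t => m (B.curve i t) := by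
  obtain ⟨M, hM0, hM⟩ := hm
  have h : ContinuousOn m (frontier K) :=
    (LipschitzOnWith.of_dist_le_mul (K := ⟨M, hM0⟩) (fun z hz w hw => by
      rw [dist_eq_norm, dist_eq_norm]; exact hM z hz w hw)).continuousOn
  exact h.comp_continuous (B.curve_cont i) (B.curve_mem i)

/-- desingularized boundary integral -/
def pv (m : ℂ → ℂ) (z₀ : ℂ) : ℂ := contourIntegralOf B.curve (fun w => (m w - m z₀) / (w - z₀))

theorem curve_countable (i : Fin B.n) (z₀ : ℂ) : ∀ᵐ t : ℝ, B.curve i t ≠ z₀ := by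
  have : {t : ℝ | B.curve i t = z₀}.Countable := by
    by_cases h : ∃ t₀, B.curve i t₀ = z₀
    · obtain ⟨t₀, rfl⟩ := h
      refine (countable_range fun k : ℤ => t₀ + k).mono ?_
      intro t ht
      obtain ⟨k, hk⟩ := (B.curve_iff i t t₀).1 ht
      exact ⟨k, by simp only; linarith⟩
    · push Not at h
      convert countable_empty
      ext t; simp [h t]
  have h2 := this.measure_zero volume
  rw [ae_iff]
  simpa using h2

theorem plemelj (hK : IsCompact K) {m : ℂ → ℂ} (hm : B.LipB m) {U : Set ℂ} {v : ℂ}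
    (hU : ∀ z ∈ U, z ∉ frontier K ∧ B.W z = v) {z₀ : ℂ} (hz₀ : z₀ ∈ frontier K) :
    Tendsto (B.cb m) (𝓝[U] z₀) (𝓝 (B.pv m z₀ + v * m z₀)) := by
  obtain ⟨M, hM0, hM⟩ := id hm
  have hFc : IsCompact (frontier K) := hK.of_isClosed_subset isClosed_frontier hK.isClosed.frontier_subset
  have hex : ∀ z : ℂ, ∃ p ∈ frontier K, ∀ w ∈ frontier K, ‖z - p‖ ≤ ‖z - w‖ := by
    intro z
    obtain ⟨p, hp, hmin⟩ := hFc.exists_isMinOn ⟨z₀, hz₀⟩ (f := fun w => ‖z - w‖) (by fun_prop)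
    exact ⟨p, hp, fun w hw => hmin hw⟩
  choose p hpF hpmin using hex
  have hmp : Tendsto (fun z => m (p z)) (𝓝[U] z₀) (𝓝 (m z₀)) := by
    rw [tendsto_iff_norm_sub_tendsto_zero]
    have hlim : Tendsto (fun z => M * (2 * ‖z - z₀‖)) (𝓝[U] z₀) (𝓝 0) := by
      have : Continuous fun z : ℂ => M * (2 * ‖z - z₀‖) := by fun_prop
      have h2 := this.tendsto z₀
      simp only [sub_self, norm_zero, mul_zero] at h2
      exact h2.mono_left nhdsWithin_le_nhds
    refine squeeze_zero (fun _ => norm_nonneg _) (fun z => ?_) hlim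
    refine (hM _ (hpF z) _ hz₀).trans (mul_le_mul_of_nonneg_left ?_ hM0)
    have h1 : ‖p z - z₀‖ ≤ ‖z - p z‖ + ‖z - z₀‖ := by
      have := norm_sub_le (z - z₀) (z - p z)
      rw [show z - z₀ - (z - p z) = p z - z₀ by ring] at this
      linarith
    linarith [hpmin z z₀ hz₀]
  have hdecomp : ∀ z ∈ U, B.cb m z = (∑ i, ∫ t in (0:ℝ)..1,
      (m (B.curve i t) - m (p z)) / (B.curve i t - z) * deriv (B.curve i) t) + v * m (p z) := by
    intro z hz
    obtain ⟨hzf, hW⟩ := hU z hz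
    rw [← hW]
    unfold cb contourIntegralOf W
    rw [Finset.sum_mul, ← Finset.sum_add_distrib]
    refine Finset.sum_congr rfl fun i _ => ?_
    unfold ct
    have hne : ∀ t, B.curve i t - z ≠ 0 := fun t h => hzf (by
      rw [← sub_eq_zero.1 h]; exact B.curve_mem i t)
    have c1 : Continuous fun t => (m (B.curve i t) - m (p z)) / (B.curve i t - z) * deriv (B.curve i) t :=
      (((hm.cont i).sub continuous_const).div ((B.curve_cont i).sub continuous_const) hne).mul (B.dcurve_cont i)
    have c2 : Continuous fun t => deriv (B.curve i) t / (B.curve i t - z) * m (p z) :=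
      ((B.dcurve_cont i).div ((B.curve_cont i).sub continuous_const) hne).mul continuous_const
    rw [← intervalIntegral.integral_mul_const, ← intervalIntegral.integral_add
      (c1.intervalIntegrable _ _) (c2.intervalIntegrable _ _)]
    congr 1
    ext t
    ring
  have hmain : Tendsto (fun z => ∑ i, ∫ t in (0:ℝ)..1,
      (m (B.curve i t) - m (p z)) / (B.curve i t - z) * deriv (B.curve i) t) (𝓝[U] z₀) (𝓝 (B.pv m z₀)) := by
    unfold pv contourIntegralOf
    refine tendsto_finsetSum _ fun i _ => ?_
    refine intervalIntegral.tendsto_integral_filter_of_dominated_convergence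
      (fun t => 2 * M * ‖deriv (B.curve i) t‖) ?_ ?_ ?_ ?_
    · filter_upwards [self_mem_nhdsWithin] with z hz
      have hne : ∀ t, B.curve i t - z ≠ 0 := fun t h => (hU z hz).1 (by
        rw [← sub_eq_zero.1 h]; exact B.curve_mem i t)
      have c1 : Continuous fun t => (m (B.curve i t) - m (p z)) / (B.curve i t - z) * deriv (B.curve i) t :=
        (((hm.cont i).sub continuous_const).div ((B.curve_cont i).sub continuous_const) hne).mul (B.dcurve_cont i)
      exact c1.aestronglyMeasurable
    · filter_upwards [self_mem_nhdsWithin] with z hz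
      refine Eventually.of_forall fun t _ => ?_
      have hne : B.curve i t - z ≠ 0 := fun h => (hU z hz).1 (by
        rw [← sub_eq_zero.1 h]; exact B.curve_mem i t)
      rw [norm_mul, norm_div]
      refine mul_le_mul_of_nonneg_right ?_ (norm_nonneg _)
      rw [div_le_iff₀ (norm_pos_iff.2 hne)]
      have h1 := hM _ (B.curve_mem i t) _ (hpF z)
      have h2 := hpmin z _ (B.curve_mem i t)
      have h3 : ‖B.curve i t - p z‖ ≤ 2 * ‖B.curve i t - z‖ := by
        have := norm_add_le (B.curve i t - z) (z - p z)
        rw [sub_add_sub_cancel] at this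
        rw [norm_sub_rev z (B.curve i t)] at h2
        linarith
      nlinarith
    · have := B.dcurve_cont i
      exact Continuous.intervalIntegrable (by fun_prop) _ _
    · filter_upwards [B.curve_countable i z₀] with t ht _
      have hid : Tendsto (fun z : ℂ => z) (𝓝[U] z₀) (𝓝 z₀) := nhdsWithin_le_nhds
      exact ((hmp.const_sub _).div (hid.const_sub _) (sub_ne_zero.2 ht)).mul_const _
  refine (hmain.add (hmp.const_mul v)).congr' ?_
  filter_upwards [self_mem_nhdsWithin] with z hz
  exact (hdecomp z hz).symm

theorem plemelj_ext (hK : IsCompact K) {m : ℂ → ℂ} (hm : B.LipB m) {U A : Set ℂ} {v : ℂ} (hUo : IsOpen U)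
    (hU : ∀ z ∈ U, z ∉ frontier K ∧ B.W z = v) (hA : A ⊆ closure U) (hA2 : A ⊆ U ∪ frontier K)
    (hA3 : frontier K ⊆ A) :
    ∃ D : ℂ → ℂ, ContinuousOn D A ∧ (∀ z ∈ U, D z = B.cb m z) ∧
      ∀ z ∈ frontier K, D z = B.pv m z + v * m z := by
  have hin : ∀ z ∈ U, Tendsto (B.cb m) (𝓝[U] z) (𝓝 (B.cb m z)) := fun z hz =>
    (B.cb_diff hm.cont (hU z hz).1).continuousAt.continuousWithinAt
  refine ⟨extendFrom U (B.cb m), continuousOn_extendFrom hA ?_, ?_, ?_⟩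
  · intro z hz
    rcases hA2 hz with h | h
    · exact ⟨_, hin z h⟩
    · exact ⟨_, B.plemelj hK hm hU h⟩
  · intro z hz
    exact extendFrom_eq (subset_closure hz) (hin z hz)
  · intro z hz
    exact extendFrom_eq (hA (hA3 hz)) (B.plemelj hK hm hU hz)

theorem plemelj_out (hK : IsCompact K) (hconn : IsConnected Kᶜ) {m : ℂ → ℂ} (hm : B.LipB m) :
    ∃ D : ℂ → ℂ, MemA K D 0 ∧ (∀ z ∈ Kᶜ, D z = B.cb m z) ∧ ∀ z ∈ frontier K, D z = B.pv m z := by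
  have hopen : IsOpen Kᶜ := hK.isClosed.isOpen_compl
  obtain ⟨D, h1, h2, h3⟩ := B.plemelj_ext hK hm (U := Kᶜ) (A := (interior K)ᶜ) (v := 0) hopen
    (fun z hz => ⟨notMem_frontier_of_compl hK hz, B.W_compl hK hconn hz⟩) (by rw [closure_compl])
    (by
      intro z hz
      by_cases h : z ∈ K
      · right; rw [hK.isClosed.frontier_eq]; exact ⟨h, hz⟩
      · left; exact h) (fun z hz => hz.2)
  refine ⟨D, (memA_iff hK).2 ⟨h1, ?_, ?_⟩, h2, fun z hz => by rw [h3 z hz]; ring⟩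
  · refine DifferentiableOn.congr (f := B.cb m) ?_ h2
    intro z hz
    exact (B.cb_diff hm.cont (notMem_frontier_of_compl hK hz)).differentiableWithinAt
  · refine (B.cb_tendsto hm.cont).congr' ?_
    filter_upwards [compl_cobounded hK] with z hz
    exact (h2 z hz).symm

theorem plemelj_in (hK : IsCompact K) (hconn : IsConnected Kᶜ) {m : ℂ → ℂ} (hm : B.LipB m) :
    ∃ D : ℂ → ℂ, ContinuousOn D K ∧ DifferentiableOn ℂ D (interior K) ∧
      (∀ z ∈ interior K, D z = B.cb m z) ∧
      ∀ z ∈ frontier K, D z = B.pv m z + 2 * Real.pi * Complex.I * m z := by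
  obtain ⟨D, h1, h2, h3⟩ := B.plemelj_ext hK hm (U := interior K) (A := K) (v := 2 * Real.pi * Complex.I)
    isOpen_interior (fun z hz => ⟨fun h => h.2 hz, B.W_int hz⟩) (B.K_subset_closure hK hconn)
    (by
      intro z hz
      by_cases h : z ∈ interior K
      · left; exact h
      · right; rw [hK.isClosed.frontier_eq]; exact ⟨hz, h⟩) hK.isClosed.frontier_subset
  refine ⟨D, h1, ?_, h2, h3⟩
  refine DifferentiableOn.congr (f := B.cb m) ?_ h2
  intro z hz
  exact (B.cb_diff hm.cont (fun h => h.2 hz)).differentiableWithinAt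

end SmoothBoundary

theorem skew_solve {H : Type} [NormedAddCommGroup H] [InnerProductSpace ℝ H] [CompleteSpace H]
    (T : H →L[ℝ] H) (hT : ∀ u, inner ℝ (T u) u = (0:ℝ)) (g : H) : ∃ u, u + T u = g := by
  have hc : IsCoercive ((innerSL ℝ).comp (ContinuousLinearMap.id ℝ H + T)) := by
    refine ⟨1, one_pos, fun u => ?_⟩
    change 1 * ‖u‖ * ‖u‖ ≤ inner ℝ (u + T u) u
    rw [inner_add_left, hT, real_inner_self_eq_norm_mul_norm]
    linarith
  refine ⟨hc.continuousLinearEquivOfBilin.symm g, ?_⟩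
  set u := hc.continuousLinearEquivOfBilin.symm g
  have h1 : hc.continuousLinearEquivOfBilin u = g := by simp [u]
  rw [← h1]
  refine hc.unique_continuousLinearEquivOfBilin fun w => ?_
  rfl

theorem skew_solve_cont {α : Type} [TopologicalSpace α] [CompactSpace α] [T2Space α] [NormalSpace α]
    [SecondCountableTopology α] [MeasurableSpace α] [BorelSpace α]
    (μ : Measure α) [IsFiniteMeasure μ] [μ.WeaklyRegular]
    (k : C(α × α, ℝ)) (hk : ∀ x y, k (x, y) = - k (y, x)) (g : C(α, ℝ)) :
    ∃ v : C(α, ℝ), ∀ x, v x + ∫ y, k (x, y) * v y ∂μ = g x := by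
  let ι : C(α, ℝ) →L[ℝ] Lp ℝ 2 μ := ContinuousMap.toLp 2 μ ℝ
  let κ : C(α, Lp ℝ 2 μ) := (⟨ι, ι.continuous⟩ : C(C(α, ℝ), Lp ℝ 2 μ)).comp k.curry
  let S : Lp ℝ 2 μ →L[ℝ] C(α, ℝ) := LinearMap.mkContinuous
    { toFun := fun u => ⟨fun x => inner ℝ (κ x) u, by fun_prop⟩
      map_add' := fun u v => by ext x; simp [inner_add_right]
      map_smul' := fun c v => by ext x; simp [inner_smul_right] } ‖κ‖ (by
        intro u
        rw [ContinuousMap.norm_le _ (by positivity)]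
        intro x
        refine (norm_inner_le_norm (𝕜 := ℝ) (κ x) u).trans ?_
        gcongr
        exact κ.norm_coe_le_norm x)
  have hS : ∀ (v : C(α, ℝ)) x, S (ι v) x = ∫ y, k (x, y) * v y ∂μ := by
    intro v x
    change inner ℝ (ι (k.curry x)) (ι v) = _
    rw [ContinuousMap.inner_toLp]
    refine integral_congr_ae (.of_forall fun y => ?_)
    simp [mul_comm]
  have hskew : ∀ u, inner ℝ (ι (S u)) u = (0:ℝ) := by
    have hcl : IsClosed {u : Lp ℝ 2 μ | inner ℝ (ι (S u)) u = (0:ℝ)} :=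
      isClosed_eq (by fun_prop) continuous_const
    have hd : DenseRange ι := ContinuousMap.toLp_denseRange ℝ μ ℝ (by simp)
    refine fun u => hd.induction_on u hcl fun v => ?_
    change inner ℝ (ι (S (ι v))) (ι v) = (0:ℝ)
    rw [ContinuousMap.inner_toLp]
    have hF : Integrable (fun p : α × α => v p.1 * (k p * v p.2)) (μ.prod μ) :=
      Continuous.integrable_of_hasCompactSupport (by fun_prop) (HasCompactSupport.of_compactSpace _)
    have e1 : ∫ x, v x * (starRingEnd ℝ) (S (ι v) x) ∂μ = ∫ p, v p.1 * (k p * v p.2) ∂(μ.prod μ) := by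
      rw [integral_prod _ hF]
      refine integral_congr_ae (.of_forall fun x => ?_)
      simp only [hS, conj_trivial]
      rw [integral_const_mul]
    rw [e1]
    have e2 := integral_prod_swap (μ := μ) (ν := μ) (fun p : α × α => v p.1 * (k p * v p.2))
    have e3 : (fun p : α × α => v p.swap.1 * (k p.swap * v p.swap.2)) = fun p => - (v p.1 * (k p * v p.2)) := by
      ext ⟨x, y⟩
      simp only [Prod.swap]
      rw [hk y x]; ring
    rw [e3, integral_neg] at e2
    linarith
  obtain ⟨u, hu⟩ := skew_solve (ι.comp S) hskew (ι g)
  have hu' : u = ι (g - S u) := by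
    rw [map_sub, ← hu]; simp
  refine ⟨g - S u, fun x => ?_⟩
  rw [← hS, ← hu']
  simp

theorem fred_solve {n : ℕ} (k : Fin n → Fin n → ℝ × ℝ → ℝ) (hk : ∀ j i, ContDiff ℝ ∞ (k j i))
    (hanti : ∀ j i s t, k j i (s, t) = - k i j (t, s)) (g : Fin n → ℝ → ℝ) (hg : ∀ i, ContDiff ℝ ∞ (g i)) :
    ∃ X : Fin n → ℝ → ℝ, (∀ i, ContDiff ℝ ∞ (X i)) ∧
      ∀ i t, X i t + ∑ j, ∫ s in (0:ℝ)..1, k j i (s, t) * X j s = g i t := by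
  let α := Fin n × Icc (0:ℝ) 1
  let μ : Measure α := (Measure.count : Measure (Fin n)).prod volume
  let kk : C(α × α, ℝ) := ⟨fun p => k p.2.1 p.1.1 ((p.2.2 : ℝ), (p.1.2 : ℝ)), by
    have h : ∀ ij : Fin n × Fin n, Continuous fun p : Icc (0:ℝ) 1 × Icc (0:ℝ) 1 => k ij.2 ij.1 ((p.2 : ℝ), (p.1 : ℝ)) :=
      fun ij => (hk _ _).continuous.comp (by fun_prop)
    have h2 : Continuous fun q : (Fin n × Fin n) × (Icc (0:ℝ) 1 × Icc (0:ℝ) 1) => k q.1.2 q.1.1 ((q.2.2 : ℝ), (q.2.1 : ℝ)) :=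
      continuous_prod_of_discrete_left.2 h
    exact h2.comp (g := fun q : (Fin n × Fin n) × (Icc (0:ℝ) 1 × Icc (0:ℝ) 1) => k q.1.2 q.1.1 ((q.2.2 : ℝ), (q.2.1 : ℝ)))
      (f := fun p : α × α => ((p.1.1, p.2.1), (p.1.2, p.2.2)))
      (((continuous_fst.comp continuous_fst).prodMk (continuous_fst.comp continuous_snd)).prodMk
        ((continuous_snd.comp continuous_fst).prodMk (continuous_snd.comp continuous_snd)))⟩
  let gg : C(α, ℝ) := ⟨fun p => g p.1 p.2, by
    refine continuous_prod_of_discrete_left.2 fun i => ?_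
    exact (hg i).continuous.comp continuous_subtype_val⟩
  obtain ⟨v, hv⟩ := skew_solve_cont μ kk (fun x y => hanti _ _ _ _) gg
  let w : Fin n → ℝ → ℝ := fun j s => v (j, projIcc 0 1 zero_le_one s)
  have hw : ∀ j, Continuous (w j) := fun j => by
    have : Continuous (projIcc (0:ℝ) 1 zero_le_one) := continuous_projIcc
    exact v.continuous.comp (by fun_prop)
  have hintg : ∀ i (t : ℝ), Continuous fun y : α => k y.1 i ((y.2 : ℝ), t) * v y := by
    intro i t
    refine Continuous.mul ?_ v.continuous
    refine continuous_prod_of_discrete_left.2 fun j => ?_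
    exact (hk j i).continuous.comp (f := fun s : Icc (0:ℝ) 1 => ((s : ℝ), t)) (by fun_prop)
  have hI : ∀ i (t : ℝ), ∫ y, k y.1 i ((y.2 : ℝ), t) * v y ∂μ = ∑ j, ∫ s in (0:ℝ)..1, k j i (s, t) * w j s := by
    intro i t
    rw [integral_prod _ ((hintg i t).integrable_of_hasCompactSupport (HasCompactSupport.of_compactSpace _)),
      integral_count]
    refine Finset.sum_congr rfl fun j _ => ?_
    rw [intervalIntegral.integral_of_le zero_le_one, ← integral_Icc_eq_integral_Ioc,
      ← integral_subtype_comap measurableSet_Icc]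
    refine integral_congr_ae (.of_forall fun s => ?_)
    simp [w]
  refine ⟨fun i t => g i t - ∑ j, ∫ s in (0:ℝ)..1, k j i (s, t) * w j s, ?_, ?_⟩
  · intro i
    refine (hg i).sub (ContDiff.sum fun j _ => ?_)
    have := param_contDiff (w j) ((hw j).intervalIntegrable 0 1) (fun p : ℝ × ℝ => k j i (p.2, p.1))
      ((hk j i).comp (contDiff_snd.prodMk contDiff_fst))
    simpa [mul_comm] using this
  · intro i t
    have e : ∀ j, ∀ s ∈ Icc (0:ℝ) 1, g j s - ∑ l, ∫ r in (0:ℝ)..1, k l j (r, s) * w l r = w j s := by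
      intro j s hs
      rw [← hI]
      have := hv (j, ⟨s, hs⟩)
      simp only [kk, gg, ContinuousMap.coe_mk] at this
      simp only [w, projIcc_of_mem _ hs]
      linarith
    have e2 : ∀ j, ∫ s in (0:ℝ)..1, k j i (s, t) * (g j s - ∑ l, ∫ r in (0:ℝ)..1, k l j (r, s) * w l r)
        = ∫ s in (0:ℝ)..1, k j i (s, t) * w j s := by
      intro j
      refine intervalIntegral.integral_congr fun s hs => ?_
      rw [uIcc_of_le zero_le_one] at hs
      simp only [e j s hs]
    simp only [e2]
    ring

theorem conj_ee (t : ℝ) : (starRingEnd ℂ) (ee t) = (ee t)⁻¹ := by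
  unfold ee
  rw [← Complex.exp_conj, ← Complex.exp_neg]
  congr 1
  simp only [map_mul, Complex.conj_ofReal, Complex.conj_I, Complex.conj_ofNat]
  ring

theorem conj_smooth {V : Type} [NormedAddCommGroup V] [NormedSpace ℝ V] {f : V → ℂ} (hf : ContDiff ℝ ∞ f) :
    ContDiff ℝ ∞ fun x => (starRingEnd ℂ) (f x) :=
  Complex.conjCLE.contDiff.comp hf

theorem re_smooth {V : Type} [NormedAddCommGroup V] [NormedSpace ℝ V] {f : V → ℂ} (hf : ContDiff ℝ ∞ f) :
    ContDiff ℝ ∞ fun x => (f x).re :=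
  Complex.reCLM.contDiff.comp hf

theorem im_smooth {V : Type} [NormedAddCommGroup V] [NormedSpace ℝ V] {f : V → ℂ} (hf : ContDiff ℝ ∞ f) :
    ContDiff ℝ ∞ fun x => (f x).im :=
  Complex.imCLM.contDiff.comp hf

theorem ofReal_smooth {V : Type} [NormedAddCommGroup V] [NormedSpace ℝ V] {f : V → ℝ} (hf : ContDiff ℝ ∞ f) :
    ContDiff ℝ ∞ fun x => (f x : ℂ) :=
  Complex.ofRealCLM.contDiff.comp hf

namespace SmoothBoundary

variable {K : Set ℂ} (B : SmoothBoundary K)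

theorem E_add_int (i : Fin B.n) (t : ℝ) (k : ℤ) : B.E i (t + k) = B.E i t ∨ B.E i (t + k) = - B.E i t := by
  rw [← sq_eq_sq_iff_eq_or_eq_neg, B.E_sq, B.E_sq, curve_add_int _ (B.dcurve_per i)]

theorem expL_add_int (i : Fin B.n) (s t : ℝ) (k : ℤ) :
    Complex.exp (B.L i (s + k, t)) = Complex.exp (B.L i (s, t)) :=
  curve_add_int (fun s => Complex.exp (B.L i (s, t))) (fun s => B.expL_left i s t) s k

/-- The kernel `E_j(s) E_i(t) / (C_j(s) - C_i(t))`. -/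
def NN (j i : Fin B.n) (s t : ℝ) : ℂ := B.E j s * B.E i t / (B.curve j s - B.curve i t)

theorem NN_anti (j i : Fin B.n) (s t : ℝ) : B.NN j i s t = - B.NN i j t s := by
  unfold NN
  rw [← neg_sub (B.curve i t), div_neg, mul_comm (B.E j s)]

theorem NN_add_one (j i : Fin B.n) (s t : ℝ) : B.NN j i s (t + 1) = - B.NN j i s t := by
  unfold NN
  rw [B.E_add_one, B.periodic]; ring

theorem exists_imN_diag (i : Fin B.n) : ∃ H : ℝ × ℝ → ℝ, ContDiff ℝ ∞ H ∧
    ∀ s t, B.curve i s ≠ B.curve i t → (B.NN i i s t).im = H (s, t) := by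
  let a : ℝ × ℝ → ℂ := fun p => B.E i p.1 * B.E i p.2 * Complex.exp (- B.L i p)
  have ha : ContDiff ℝ ∞ a :=
    (((B.E_smooth i).comp contDiff_fst).mul ((B.E_smooth i).comp contDiff_snd)).mul (B.L_smooth i).neg.cexp
  let F : ℝ × ℝ → ℂ := fun p => a p + (starRingEnd ℂ) (a p) * (ee p.1 * ee p.2)
  have hF : ContDiff ℝ ∞ F :=
    ha.add ((conj_smooth ha).mul ((ee_smooth.comp contDiff_fst).mul (ee_smooth.comp contDiff_snd)))
  obtain ⟨H, hH, hH1, -⟩ := exists_div_ee F hF (by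
    intro s t k hk
    obtain rfl : s = t + k := by linarith
    have hne := Complex.exp_ne_zero (B.L i (t, t))
    have h1 : B.E i t * B.E i t * (Complex.exp (B.L i (t, t)))⁻¹ = 2 * Real.pi * Complex.I * ee t := by
      have := B.E_sq i t
      rw [sq] at this
      rw [this, B.deriv_eq]
      field_simp
    have h0 := ee_ne_zero t
    have h2 : a (t + k, t) = 2 * Real.pi * Complex.I * ee t ∨ a (t + k, t) = -(2 * Real.pi * Complex.I * ee t) := by
      simp only [a]
      rw [Complex.exp_neg, B.expL_add_int]
      rcases B.E_add_int i t k with h | h <;> rw [h]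
      · exact Or.inl h1
      · right; rw [← h1]; ring
    simp only [F]
    rw [ee_add_int]
    rcases h2 with h | h <;> rw [h] <;> simp only [map_neg, map_mul, conj_ee, Complex.conj_I,
      Complex.conj_ofReal, Complex.conj_ofNat] <;> field_simp <;> ring)
  refine ⟨fun p => (H p / (2 * Complex.I)).re, re_smooth (cdiv hH contDiff_const fun _ => by simp), ?_⟩
  intro s t hst
  have hne : ee s - ee t ≠ 0 := by
    rw [sub_ne_zero]
    intro h
    exact hst ((B.curve_iff i s t).2 ((ee_eq_iff s t).1 h))
  have h0 := ee_ne_zero t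
  have h0s := ee_ne_zero s
  have e1 : B.NN i i s t = a (s, t) / (ee s - ee t) := by
    unfold NN
    rw [B.chord]
    simp only [a]
    rw [Complex.exp_neg]
    have := Complex.exp_ne_zero (B.L i (s, t))
    field_simp
  have e2 : (starRingEnd ℂ) (B.NN i i s t) = - ((starRingEnd ℂ) (a (s, t)) * (ee s * ee t)) / (ee s - ee t) := by
    rw [e1, map_div₀, map_sub, conj_ee, conj_ee]
    have : (ee s)⁻¹ - (ee t)⁻¹ = (ee t - ee s) / (ee s * ee t) := by field_simp
    rw [this, ← neg_sub (ee s)]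
    field_simp
  have e3 : ((B.NN i i s t).im : ℂ) = H (s, t) / (2 * Complex.I) := by
    rw [Complex.im_eq_sub_conj, e2, e1]
    have := hH1 s t
    simp only [F] at this
    rw [show a (s, t) / (ee s - ee t) - -((starRingEnd ℂ) (a (s, t)) * (ee s * ee t)) / (ee s - ee t) =
      (a (s, t) + (starRingEnd ℂ) (a (s, t)) * (ee s * ee t)) / (ee s - ee t) by ring, this]
    field_simp
  simp only
  rw [← e3, Complex.ofReal_re]

theorem exists_imN : ∃ k : Fin B.n → Fin B.n → ℝ × ℝ → ℝ, (∀ j i, ContDiff ℝ ∞ (k j i)) ∧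
    (∀ j i s t, k j i (s, t) = - k i j (t, s)) ∧
    ∀ j i s t, B.curve j s ≠ B.curve i t → (B.NN j i s t).im = k j i (s, t) := by
  have h : ∀ j i, ∃ H : ℝ × ℝ → ℝ, ContDiff ℝ ∞ H ∧
    ∀ s t, B.curve j s ≠ B.curve i t → (B.NN j i s t).im = H (s, t) := by
    intro j i
    by_cases hji : j = i
    · subst hji; exact B.exists_imN_diag j
    · refine ⟨fun p => (B.NN j i p.1 p.2).im, im_smooth ?_, fun s t _ => rfl⟩
      exact cdiv (((B.E_smooth j).comp contDiff_fst).mul ((B.E_smooth i).comp contDiff_snd))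
        (((B.smooth j).comp contDiff_fst).sub ((B.smooth i).comp contDiff_snd))
        (fun p => B.curve_ne i j hji p.1 p.2)
  choose H hH hH1 using h
  refine ⟨fun j i p => (H j i p - H i j (p.2, p.1)) / 2, ?_, ?_, ?_⟩
  · intro j i
    exact ((hH j i).sub ((hH i j).comp (contDiff_snd.prodMk contDiff_fst))).div_const 2
  · intro j i s t; simp only; ring
  · intro j i s t hst
    simp only
    rw [← hH1 j i s t hst, ← hH1 i j t s hst.symm, B.NN_anti i j t s]
    simp

theorem wind_other (hK : IsCompact K) (hconn : IsConnected Kᶜ) (i j : Fin B.n) (h : j ≠ i) (t : ℝ) :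
    ∫ s in (0:ℝ)..1, deriv (B.curve j) s / (B.curve j s - B.curve i t) = 0 := by
  have h1 := (B.ct_other i j h t).tendsto.comp (B.nb_tendsto i 1 t)
  obtain ⟨δ₀, hδ0, hδ⟩ := B.collar_sides hK hconn
  have h2 : Tendsto (ct (B.curve j) (deriv (B.curve j)) ∘ fun ε : ℝ => B.nb i (1 * ε) t) (𝓝[>] 0) (𝓝 0) := by
    refine tendsto_const_nhds.congr' ?_
    filter_upwards [Ioo_mem_nhdsGT hδ0] with ε hε
    exact (B.wind_zero hK hconn j (hδ ε hε.1 hε.2 i t).1).symm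
  exact tendsto_nhds_unique h1 h2

variable {μ : Fin B.n → ℝ → ℂ} {m : ℂ → ℂ}

theorem pv_ae (hm : ∀ i t, m (B.curve i t) = μ i t) {i j : Fin B.n} {Q : ℝ × ℝ → ℂ}
    (hQ : ∀ s t, μ j s - μ i t = (B.curve j s - B.curve i t) * Q (s, t)) (t : ℝ) :
    ∀ᵐ s : ℝ, (m (B.curve j s) - m (B.curve i t)) / (B.curve j s - B.curve i t) * deriv (B.curve j) s =
      Q (s, t) * deriv (B.curve j) s := by
  filter_upwards [B.curve_countable j (B.curve i t)] with s hs
  rw [hm, hm, hQ]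
  have := sub_ne_zero.2 hs
  field_simp

theorem pv_intble (hμ : ∀ i, ContDiff ℝ ∞ (μ i))
    (hp : ∀ i, Function.Periodic (μ i) 1) (hm : ∀ i t, m (B.curve i t) = μ i t) (i j : Fin B.n) (t : ℝ) :
    IntervalIntegrable (fun s => (m (B.curve j s) - m (B.curve i t)) / (B.curve j s - B.curve i t) *
      deriv (B.curve j) s) volume 0 1 := by
  obtain ⟨Q, hQ, hQ1⟩ := B.exists_quot μ hμ hp j i
  have c : Continuous fun s => Q (s, t) * deriv (B.curve j) s :=
    (hQ.continuous.comp (by fun_prop : Continuous fun s : ℝ => (s, t))).mul (B.dcurve_cont j)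
  refine (c.intervalIntegrable 0 1).congr_ae (ae_restrict_of_ae ?_)
  filter_upwards [B.pv_ae hm hQ1 t] with s hs using hs.symm

theorem pv_smooth (hμ : ∀ i, ContDiff ℝ ∞ (μ i))
    (hp : ∀ i, Function.Periodic (μ i) 1) (hm : ∀ i t, m (B.curve i t) = μ i t) (i : Fin B.n) :
    ContDiff ℝ ∞ fun t => B.pv m (B.curve i t) := by
  choose Q hQ hQ1 using fun j => B.exists_quot μ hμ hp j i
  have e : (fun t => B.pv m (B.curve i t)) = fun t => ∑ j, ∫ s in (0:ℝ)..1, Q j (s, t) * deriv (B.curve j) s := by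
    funext t
    unfold pv contourIntegralOf
    refine Finset.sum_congr rfl fun j _ => ?_
    refine intervalIntegral.integral_congr_ae ?_
    filter_upwards [B.pv_ae hm (hQ1 j) t] with s hs _ using hs
  rw [e]
  refine ContDiff.sum fun j _ => ?_
  exact param_contDiff' (fun p : ℝ × ℝ => Q j (p.2, p.1) * deriv (B.curve j) p.2)
    (((hQ j).comp (contDiff_snd.prodMk contDiff_fst)).mul ((B.dcurve_smooth j).comp contDiff_snd))

/-- Main computation: imaginary part of the singular integral for a real half-density. -/
theorem pv_real (hK : IsCompact K) (hconn : IsConnected Kᶜ) {k : Fin B.n → Fin B.n → ℝ × ℝ → ℝ}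
    (hk : ∀ j i, ContDiff ℝ ∞ (k j i))
    (hkN : ∀ j i s t, B.curve j s ≠ B.curve i t → (B.NN j i s t).im = k j i (s, t))
    {X : Fin B.n → ℝ → ℝ} (hX : ∀ i, ContDiff ℝ ∞ (X i)) (hXp : ∀ i t, X i (t + 1) = - X i t)
    (hm : ∀ i t, m (B.curve i t) = X i t / B.E i t) (i : Fin B.n) (t : ℝ) :
    (B.pv m (B.curve i t) * B.E i t).im = (∑ j, ∫ s in (0:ℝ)..1, k j i (s, t) * X j s) - Real.pi * X i t := by
  have hμ : ∀ i, ContDiff ℝ ∞ (fun t => (X i t : ℂ) / B.E i t) :=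
    fun i => cdiv (ofReal_smooth (hX i)) (B.E_smooth i) (B.E_ne i)
  have hp : ∀ i, Function.Periodic (fun t => (X i t : ℂ) / B.E i t) 1 := by
    intro i t
    simp only [hXp, B.E_add_one]
    push_cast
    rw [neg_div_neg_eq]
  have h1 : (B.pv m (B.curve i t) * B.E i t).im = ∑ j, ∫ s in (0:ℝ)..1,
      ((m (B.curve j s) - m (B.curve i t)) / (B.curve j s - B.curve i t) * deriv (B.curve j) s * B.E i t).im := by
    unfold pv contourIntegralOf
    rw [Finset.sum_mul, Complex.im_sum]
    refine Finset.sum_congr rfl fun j _ => ?_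
    rw [← intervalIntegral.integral_mul_const]
    have hi := (B.pv_intble hμ hp hm i j t).mul_const (B.E i t)
    exact (Complex.imCLM.intervalIntegral_comp_comm hi).symm
  rw [h1]
  have hI : ∀ j s, B.curve j s ≠ B.curve i t →
      ((m (B.curve j s) - m (B.curve i t)) / (B.curve j s - B.curve i t) * deriv (B.curve j) s * B.E i t).im
      = k j i (s, t) * X j s - X i t * (deriv (B.curve j) s / (B.curve j s - B.curve i t)).im := by
    intro j s hs
    have hd := sub_ne_zero.2 hs
    have e1 := B.E_ne i t
    have e2 := B.E_ne j s
    rw [← hkN j i s t hs, hm, hm]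
    have : ((X j s : ℂ) / B.E j s - X i t / B.E i t) / (B.curve j s - B.curve i t) * deriv (B.curve j) s * B.E i t
      = X j s * B.NN j i s t - X i t * (deriv (B.curve j) s / (B.curve j s - B.curve i t)) := by
      unfold NN
      rw [← B.E_sq]
      field_simp
    rw [this, Complex.sub_im, Complex.im_ofReal_mul, Complex.im_ofReal_mul]
    ring
  have ck : ∀ j, Continuous fun s => k j i (s, t) * X j s := fun j =>
    ((hk j i).continuous.comp (by fun_prop : Continuous fun s : ℝ => (s, t))).mul (hX j).continuous
  have hJ : ∀ j, ∫ s in (0:ℝ)..1,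
      ((m (B.curve j s) - m (B.curve i t)) / (B.curve j s - B.curve i t) * deriv (B.curve j) s * B.E i t).im
      = (∫ s in (0:ℝ)..1, k j i (s, t) * X j s) - if j = i then Real.pi * X i t else 0 := by
    intro j
    split_ifs with hji
    · subst hji
      have cd : Continuous fun s => X j t * (Real.pi + (B.dL j s t).im) := by
        have : Continuous fun s => B.dL j s t :=
          (B.dL_smooth j).continuous.comp (by fun_prop : Continuous fun s : ℝ => ((s, t) : ℝ × ℝ))
        fun_prop
      have cd' : Continuous fun s => B.dL j s t :=
          (B.dL_smooth j).continuous.comp (by fun_prop : Continuous fun s : ℝ => ((s, t) : ℝ × ℝ))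
      have ci : Continuous fun s => (B.dL j s t).im := Complex.continuous_im.comp cd'
      have e : ∫ s in (0:ℝ)..1, X j t * (Real.pi + (B.dL j s t).im) = Real.pi * X j t := by
        rw [intervalIntegral.integral_const_mul, intervalIntegral.integral_add
          (by simp) (ci.intervalIntegrable _ _)]
        have h2 := B.int_dL j t 0
        rw [B.alp_eq_zero hK hconn, zero_add] at h2
        have h3 := Complex.imCLM.intervalIntegral_comp_comm (cd'.intervalIntegrable (μ := volume) 0 1)
        rw [h2] at h3
        simp only [Complex.imCLM_apply, Complex.zero_im] at h3
        rw [h3]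
        simp [mul_comm]
      rw [← e, ← intervalIntegral.integral_sub ((ck j).intervalIntegrable _ _) (cd.intervalIntegrable _ _)]
      refine intervalIntegral.integral_congr_ae ?_
      filter_upwards [B.curve_countable j (B.curve j t)] with s hs _
      rw [hI j s hs, B.im_deriv_div]
      exact fun h => hs ((B.curve_iff j s t).2 h)
    · have hne := B.curve_ne i j hji
      have cw : Continuous fun s => deriv (B.curve j) s / (B.curve j s - B.curve i t) :=
        (B.dcurve_cont j).div ((B.curve_cont j).sub continuous_const) fun s => hne s t
      have cd : Continuous fun s => X i t * (deriv (B.curve j) s / (B.curve j s - B.curve i t)).im := by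
        have := Complex.continuous_im.comp cw
        exact continuous_const.mul this
      have h3 := Complex.imCLM.intervalIntegral_comp_comm (cw.intervalIntegrable (μ := volume) 0 1)
      rw [B.wind_other hK hconn i j hji t] at h3
      simp only [Complex.imCLM_apply, Complex.zero_im] at h3
      have e : ∫ s in (0:ℝ)..1, X i t * (deriv (B.curve j) s / (B.curve j s - B.curve i t)).im = 0 := by
        rw [intervalIntegral.integral_const_mul, h3, mul_zero]
      refine Eq.trans ?_ (congrArg (fun x : ℝ => (∫ s in (0:ℝ)..1, k j i (s, t) * X j s) - x) e)
      rw [← intervalIntegral.integral_sub ((ck j).intervalIntegrable _ _) (cd.intervalIntegrable _ _)]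
      refine intervalIntegral.integral_congr fun s _ => ?_
      exact hI j s (sub_ne_zero.1 (hne s t))
  simp only [hJ]
  rw [Finset.sum_sub_distrib]
  simp

/-- Solvability of the Riemann-Hilbert problem for half-densities. -/
theorem riemann_hilbert (hK : IsCompact K) (hconn : IsConnected Kᶜ) (y : Fin B.n → ℝ → ℝ)
    (hy : ∀ i, ContDiff ℝ ∞ (y i)) (hyp : ∀ i t, y i (t + 1) = - y i t) :
    ∃ (R : ℂ → ℂ) (X : Fin B.n → ℝ → ℝ), MemA K R 0 ∧ (∀ i, ContDiff ℝ ∞ (X i)) ∧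
      ∀ i t, R (B.curve i t) * B.E i t = X i t + y i t * Complex.I := by
  obtain ⟨k, hk, hkanti, hkN⟩ := B.exists_imN
  have hπ : (Real.pi : ℝ) ≠ 0 := Real.pi_ne_zero
  have hμy : ∀ i, ContDiff ℝ ∞ (fun t => (y i t * Complex.I : ℂ) / B.E i t) :=
    fun i => cdiv ((ofReal_smooth (hy i)).mul contDiff_const) (B.E_smooth i) (B.E_ne i)
  have hpy : ∀ i, Function.Periodic (fun t => (y i t * Complex.I : ℂ) / B.E i t) 1 := by
    intro i t
    simp only [hyp, B.E_add_one]
    push_cast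
    rw [neg_mul, neg_div_neg_eq]
  obtain ⟨my, hmy, hmyL⟩ := B.exists_dens _ hμy hpy
  let G : Fin B.n → ℝ → ℝ := fun i t => (B.pv my (B.curve i t) * B.E i t).im
  have hG : ∀ i, ContDiff ℝ ∞ (G i) := fun i =>
    im_smooth ((B.pv_smooth hμy hpy hmy i).mul (B.E_smooth i))
  have hGp : ∀ i t, G i (t + 1) = - G i t := by
    intro i t
    simp only [G]
    rw [B.periodic, B.E_add_one, mul_neg, Complex.neg_im]
  obtain ⟨X, hX, hXe⟩ := fred_solve (fun j i p => Real.pi⁻¹ * k j i p) (fun j i => contDiff_const.mul (hk j i))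
    (fun j i s t => by rw [hkanti]; ring) (fun i t => - (Real.pi⁻¹ * G i t)) (fun i => (contDiff_const.mul (hG i)).neg)
  have hXp : ∀ i t, X i (t + 1) = - X i t := by
    intro i t
    have h1 := hXe i t
    have h2 := hXe i (t + 1)
    have h3 : ∀ j, ∫ s in (0:ℝ)..1, Real.pi⁻¹ * k j i (s, t + 1) * X j s =
        - ∫ s in (0:ℝ)..1, Real.pi⁻¹ * k j i (s, t) * X j s := by
      intro j
      rw [← intervalIntegral.integral_neg]
      refine intervalIntegral.integral_congr_ae ?_
      filter_upwards [B.curve_countable j (B.curve i t)] with s hs _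
      rw [← hkN j i s t hs, ← hkN j i s (t + 1) (by rw [B.periodic]; exact hs), B.NN_add_one, Complex.neg_im]
      ring
    simp only [h3, Finset.sum_neg_distrib] at h2
    rw [hGp] at h2
    linarith
  have hμX : ∀ i, ContDiff ℝ ∞ (fun t => (X i t : ℂ) / B.E i t) :=
    fun i => cdiv (ofReal_smooth (hX i)) (B.E_smooth i) (B.E_ne i)
  have hpX : ∀ i, Function.Periodic (fun t => (X i t : ℂ) / B.E i t) 1 := by
    intro i t
    simp only [hXp, B.E_add_one]
    push_cast
    rw [neg_div_neg_eq]
  obtain ⟨mX, hmX, hmXL⟩ := B.exists_dens _ hμX hpX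
  obtain ⟨m, hm, hmL⟩ := B.exists_dens (fun i t => (X i t : ℂ) / B.E i t + (y i t * Complex.I : ℂ) / B.E i t)
    (fun i => (hμX i).add (hμy i)) (fun i t => by
      have h1 := hpX i t
      have h2 := hpy i t
      simp only at h1 h2 ⊢
      rw [h1, h2])
  have hpv : ∀ i t, B.pv m (B.curve i t) = B.pv mX (B.curve i t) + B.pv my (B.curve i t) := by
    intro i t
    unfold pv contourIntegralOf
    rw [← Finset.sum_add_distrib]
    refine Finset.sum_congr rfl fun j _ => ?_
    rw [← intervalIntegral.integral_add (B.pv_intble hμX hpX hmX i j t) (B.pv_intble hμy hpy hmy i j t)]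
    refine intervalIntegral.integral_congr fun s _ => ?_
    simp only [hm, hmX, hmy]
    ring
  obtain ⟨D, hD1, hD2, -, hD3⟩ := B.plemelj_in hK hconn hmL
  have hmE : ∀ i t, m (B.curve i t) * B.E i t = X i t + y i t * Complex.I := by
    intro i t
    rw [hm]
    have := B.E_ne i t
    field_simp
  have hDE : ∀ i t, (D (B.curve i t) * B.E i t).im = 0 := by
    intro i t
    rw [hD3 _ (B.curve_mem i t), hpv, add_mul, add_mul, mul_assoc _ (m _), hmE, Complex.add_im, Complex.add_im,
      B.pv_real hK hconn hk hkN hX hXp hmX]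
    have h1 := hXe i t
    have h2 : ∑ j, ∫ s in (0:ℝ)..1, Real.pi⁻¹ * k j i (s, t) * X j s =
        Real.pi⁻¹ * ∑ j, ∫ s in (0:ℝ)..1, k j i (s, t) * X j s := by
      rw [Finset.mul_sum]
      refine Finset.sum_congr rfl fun j _ => ?_
      rw [← intervalIntegral.integral_const_mul]
      simp only [mul_assoc]
    rw [h2] at h1
    have h3 : (2 * Real.pi * Complex.I * (X i t + y i t * Complex.I : ℂ)).im = 2 * Real.pi * X i t := by
      simp
    rw [h3]
    change _ - _ + G i t + _ = 0
    field_simp at h1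
    linarith
  have hD0 : ∀ i t, D (B.curve i t) = 0 := by
    have cD : ∀ i, Continuous fun t => D (B.curve i t) * B.E i t := fun i =>
      (hD1.comp_continuous (B.curve_cont i) (B.curve_mem_K hK i)).mul (B.E_smooth i).continuous
    have hre : ∀ i t, D (B.curve i t) * B.E i t = ((D (B.curve i t) * B.E i t).re : ℂ) := by
      intro i t
      apply Complex.ext <;> simp only [Complex.ofReal_re, Complex.ofReal_im, hDE]
    have cr : ∀ i, Continuous fun t => (D (B.curve i t) * B.E i t).re ^ 2 := fun i =>
      (Complex.continuous_re.comp (cD i)).pow 2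
    have h1 := B.int_in hK hconn (hD1.pow 2) (hD2.pow 2)
    unfold contourIntegralOf at h1
    have h2 : ∀ i, ∫ t in (0:ℝ)..1, (D ^ 2) (B.curve i t) * deriv (B.curve i) t =
        ((∫ t in (0:ℝ)..1, (D (B.curve i t) * B.E i t).re ^ 2 : ℝ) : ℂ) := by
      intro i
      rw [← intervalIntegral.integral_ofReal]
      refine intervalIntegral.integral_congr fun t _ => ?_
      simp only [Pi.pow_apply]
      rw [← B.E_sq, ← mul_pow, Complex.ofReal_pow, ← hre]
    simp only [h2] at h1
    rw [← Complex.ofReal_sum, Complex.ofReal_eq_zero, Finset.sum_eq_zero_iff_of_nonneg (fun i _ =>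
      intervalIntegral.integral_nonneg zero_le_one fun t _ => sq_nonneg _)] at h1
    intro i t
    rw [← B.fract_curve i t]
    have h3 := h1 i (Finset.mem_univ i)
    by_contra hne
    have h4 : 0 < ∫ t in (0:ℝ)..1, (D (B.curve i t) * B.E i t).re ^ 2 := by
      refine intervalIntegral.integral_pos zero_lt_one (cr i).continuousOn (fun _ _ => sq_nonneg _)
        ⟨Int.fract t, ⟨Int.fract_nonneg t, (Int.fract_lt_one t).le⟩, ?_⟩
      have h5 : (D (B.curve i (Int.fract t)) * B.E i (Int.fract t)).re ≠ 0 := by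
        intro h
        have h6 := hre i (Int.fract t)
        rw [h, Complex.ofReal_zero] at h6
        exact hne ((mul_eq_zero.1 h6).resolve_right (B.E_ne i _))
      positivity
    linarith
  obtain ⟨F, hF1, -, hF3⟩ := B.plemelj_out hK hconn hmL
  refine ⟨fun z => -(2 * Real.pi * Complex.I)⁻¹ * F z, X, ?_, hX, ?_⟩
  · obtain ⟨a, b, c⟩ := hF1
    refine ⟨continuousOn_const.mul a, (differentiableOn_const _).mul b, ?_⟩
    simpa using c.const_mul (-(2 * Real.pi * Complex.I)⁻¹)
  · intro i t
    simp only
    rw [← hmE, hF3 _ (B.curve_mem i t)]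
    have h1 := hD3 _ (B.curve_mem i t)
    rw [hD0] at h1
    rw [eq_neg_of_add_eq_zero_left h1.symm]
    have := two_pi_I_ne
    field_simp

end SmoothBoundary

theorem log_incr {F ℓ : ℝ → ℂ} (hF : ContDiff ℝ ∞ F) (hℓ : ContDiff ℝ ∞ ℓ) (h : ∀ t, Complex.exp (ℓ t) = F t)
    {c₀ : ℂ} {a b : ℝ} (hab : a ≤ b) (hs : ∀ t ∈ Icc a b, c₀ * F t ∈ Complex.slitPlane) :
    ℓ b - ℓ a = Complex.log (c₀ * F b) - Complex.log (c₀ * F a) := by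
  have hF0 : ∀ t, F t ≠ 0 := fun t => by rw [← h]; exact Complex.exp_ne_zero _
  have dF : ∀ t, HasDerivAt F (deriv F t) t := fun t => (hF.differentiable (by simp) t).hasDerivAt
  have dℓ : ∀ t, HasDerivAt ℓ (deriv F t / F t) t := by
    intro t
    have h1 := (hℓ.differentiable (by simp) t).hasDerivAt
    have h2 : HasDerivAt (fun t => Complex.exp (ℓ t)) _ t := h1.cexp
    rw [show (fun t => Complex.exp (ℓ t)) = F from funext h] at h2
    have h3 := (dF t).unique h2
    refine h1.congr_deriv ?_
    rw [h3, h]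
    have := hF0 t
    field_simp
  have dd : ∀ t ∈ Icc a b, HasDerivAt (fun t => ℓ t - Complex.log (c₀ * F t)) 0 t := by
    intro t ht
    have hne := Complex.slitPlane_ne_zero (hs t ht)
    have h1 := (dℓ t).sub (((dF t).const_mul c₀).clog_real (hs t ht))
    refine h1.congr_deriv ?_
    rw [mul_div_mul_left _ _ (left_ne_zero_of_mul hne), sub_self]
  have h1 := constant_of_has_deriv_right_zero (f := fun t => ℓ t - Complex.log (c₀ * F t)) (a := a) (b := b)
    (fun t ht => (dd t ht).continuousAt.continuousWithinAt)
    (fun t ht => (dd t ⟨ht.1, ht.2.le⟩).hasDerivWithinAt) b ⟨hab, le_rfl⟩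
  linear_combination h1

namespace SmoothBoundary

variable {K : Set ℂ} (B : SmoothBoundary K)

theorem half_anti {G : ℂ → ℂ} {F : Fin B.n → ℝ → ℂ} (hF : ∀ i t, G (B.curve i t) * B.E i t = F i t) (i : Fin B.n)
    (t : ℝ) : F i (t + 1) = - F i t := by
  rw [← hF, ← hF, B.periodic, B.E_add_one, mul_neg]

/-- `A(Ω)` functions whose boundary values admit a smooth periodic logarithm are zero-free. -/
theorem zero_free_of_log (hK : IsCompact K) (hconn : IsConnected Kᶜ) {G : ℂ → ℂ} {κ : ℂ} (hκ : κ ≠ 0)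
    (hG : MemA K G κ) (lam : Fin B.n → ℝ → ℂ) (hlam : ∀ i, ContDiff ℝ ∞ (lam i))
    (hp : ∀ i, Function.Periodic (lam i) 1) (he : ∀ i t, Complex.exp (lam i t) = G (B.curve i t)) :
    ∀ z ∈ Kᶜ, G z ≠ 0 := by
  obtain ⟨m, hm, hmL⟩ := B.exists_dens lam hlam hp
  obtain ⟨Do, ho1, -, ho3⟩ := B.plemelj_out hK hconn hmL
  obtain ⟨Di, hi1, hi2, -, hi3⟩ := B.plemelj_in hK hconn hmL
  obtain ⟨o1, o2, o3⟩ := (memA_iff hK).1 ho1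
  obtain ⟨g1, g2, g3⟩ := (memA_iff hK).1 hG
  set u : ℂ := (2 * Real.pi * Complex.I)⁻¹ with hu
  have hA : MemA K (fun z => G z * Complex.exp (u * Do z)) κ := by
    rw [memA_iff hK]
    refine ⟨g1.mul (continuousOn_const.mul o1).cexp, g2.mul ((differentiableOn_const _).mul o2).cexp, ?_⟩
    have := g3.mul (o3.const_mul u).cexp
    simpa using this
  intro z hz hz0
  have h1 := B.cauchy_out_compl hK hconn hA hz
  have h2 := B.cauchy_in hK hconn (g := fun z => Complex.exp (u * Di z)) (continuousOn_const.mul hi1).cexp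
    ((differentiableOn_const _).mul hi2).cexp hz
  have h3 : B.cb (fun z => G z * Complex.exp (u * Do z)) z = B.cb (fun z => Complex.exp (u * Di z)) z := by
    unfold cb contourIntegralOf
    refine Finset.sum_congr rfl fun i _ => ?_
    refine intervalIntegral.integral_congr fun t _ => ?_
    simp only
    rw [ho3 _ (B.curve_mem i t), hi3 _ (B.curve_mem i t), mul_add, Complex.exp_add, hm, ← he]
    have : u * (2 * Real.pi * Complex.I * lam i t) = lam i t := by
      rw [← mul_assoc, hu, inv_mul_cancel₀ two_pi_I_ne, one_mul]
    rw [this]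
    ring
  rw [h3, h2, hz0] at h1
  have := mul_ne_zero two_pi_I_ne hκ
  apply this
  linear_combination -h1

theorem zero_free_pert (hK : IsCompact K) (hconn : IsConnected Kᶜ) {G : ℂ → ℂ} {κ : ℂ} (hκ : κ ≠ 0)
    (hG : MemA K G κ) (F : Fin B.n → ℝ → ℂ) (hFs : ∀ i, ContDiff ℝ ∞ (F i))
    (hF : ∀ i t, G (B.curve i t) * B.E i t = F i t)
    (c σ : Fin B.n → ℝ) (hc : ∀ i, 0 < σ i * (F i (c i)).re)
    (hpos : ∀ i, ∀ t ∈ Ioo (c i) (c i + 1), 0 < σ i * (F i t).im) :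
    ∀ z ∈ Kᶜ, G z ≠ 0 := by
  have hanti := fun i t => B.half_anti hF i t
  have hslit : ∀ i, ∀ t ∈ Icc (c i) (c i + 1), (-Complex.I * σ i) * F i t ∈ Complex.slitPlane := by
    intro i t ht
    rw [Complex.mem_slitPlane_iff]
    have e1 : ((-Complex.I * σ i) * F i t).re = σ i * (F i t).im := by simp
    have e2 : ((-Complex.I * σ i) * F i t).im = - (σ i * (F i t).re) := by simp
    rw [e1, e2]
    rcases eq_or_lt_of_le ht.1 with h | h
    · right; rw [← h]; have := hc i; linarith
    rcases eq_or_lt_of_le ht.2 with h' | h'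
    · right; rw [h', hanti, Complex.neg_re]; have := hc i; linarith
    · left; exact hpos i t ⟨h, h'⟩
  have hne : ∀ i t, F i t ≠ 0 := by
    intro i t
    have h1 : ∀ t ∈ Icc (c i) (c i + 1), F i t ≠ 0 := fun t ht =>
      right_ne_zero_of_mul (Complex.slitPlane_ne_zero (hslit i t ht))
    intro h0
    have hGC : G (B.curve i t) = 0 := by
      have := hF i t
      rw [h0] at this
      exact (mul_eq_zero.1 this).resolve_right (B.E_ne i t)
    have h2 : B.curve i (c i + Int.fract (t - c i)) = B.curve i t := by
      rw [B.curve_iff]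
      refine ⟨-⌊t - c i⌋, ?_⟩
      have := Int.self_sub_floor (t - c i)
      push_cast
      linarith
    refine h1 (c i + Int.fract (t - c i)) ⟨by linarith [Int.fract_nonneg (t - c i)],
      by linarith [Int.fract_lt_one (t - c i)]⟩ ?_
    rw [← hF, h2, hGC, zero_mul]
  choose ℓ hℓs hℓ using fun i => exists_smooth_log (F i) (hFs i) (hne i)
  have hexp : ∀ i t, Complex.exp (ℓ i t - B.logE i t) = G (B.curve i t) := by
    intro i t
    rw [Complex.exp_sub, hℓ, ← hF]
    change _ / B.E i t = _
    rw [mul_div_cancel_right₀ _ (B.E_ne i t)]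
  refine B.zero_free_of_log hK hconn hκ hG (fun i t => ℓ i t - B.logE i t) (fun i => (hℓs i).sub (B.logE_smooth i)) ?_ hexp
  intro i t
  have hs : ContDiff ℝ ∞ fun t => (ℓ i (t + 1) - B.logE i (t + 1)) - (ℓ i t - B.logE i t) := by
    have h1 : ContDiff ℝ ∞ fun t => (ℓ i t - B.logE i t) := (hℓs i).sub (B.logE_smooth i)
    exact (h1.comp (contDiff_id.add contDiff_const)).sub h1
  have h1 := const_of_exp_eq_one _ hs (fun t => by
    rw [Complex.exp_sub, hexp, hexp, B.periodic, div_self]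
    rw [← hexp]; exact Complex.exp_ne_zero _) t (c i)
  simp only at h1 ⊢
  have h2 := log_incr (hFs i) (hℓs i) (hℓ i) (by linarith : c i ≤ c i + 1) (hslit i)
  have h3 : -Complex.I * σ i * F i (c i) = -(-Complex.I * σ i * F i (c i + 1)) := by
    rw [hanti]; ring
  rw [h3, log_sub_log_neg_of_im_pos] at h2
  · have h4 := B.logE_add_one i (c i)
    rw [B.alp_eq_zero hK hconn] at h4
    linear_combination h1 + h2 - h4
  · rw [hanti]
    have e2 : ((-Complex.I * σ i) * -F i (c i)).im = (σ i * (F i (c i)).re) := by simp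
    rw [e2]; exact hc i

theorem not_zero_curve (hK : IsCompact K) (hconn : IsConnected Kᶜ) {P : ℂ → ℂ} {κ : ℂ} (hκ : κ ≠ 0)
    (hP : MemA K P κ) (i : Fin B.n) : ∃ t, P (B.curve i t) ≠ 0 := by
  by_contra! hcon
  obtain ⟨g1, g2, g3⟩ := (memA_iff hK).1 hP
  have hopen : IsOpen Kᶜ := hK.isClosed.isOpen_compl
  -- the Cauchy integral does not see curve `i`
  let Φ : ℂ → ℂ := fun z => ∑ j ∈ Finset.univ.erase i,
    ct (B.curve j) (fun t => P (B.curve j t) * deriv (B.curve j) t) z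
  have hPc : ∀ j, Continuous fun t => P (B.curve j t) := fun j =>
    g1.comp_continuous (B.curve_cont j) (fun t => B.curve_notMem_int j t)
  have hΦcb : ∀ z, B.cb P z = Φ z := by
    intro z
    simp only [cb, contourIntegralOf, Φ, ct]
    rw [← Finset.add_sum_erase _ _ (Finset.mem_univ i)]
    simp only [hcon, zero_div, zero_mul, intervalIntegral.integral_zero, zero_add]
    refine Finset.sum_congr rfl fun j _ => ?_
    refine intervalIntegral.integral_congr fun t _ => ?_
    ring
  have hcl : IsClosed (⋃ j ∈ Finset.univ.erase i, B.curve j '' Icc 0 1) :=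
    isClosed_biUnion_finset fun j _ => (isCompact_Icc.image (B.curve_cont j)).isClosed
  set O : Set ℂ := (⋃ j ∈ Finset.univ.erase i, B.curve j '' Icc 0 1)ᶜ with hO
  have hOo : IsOpen O := hcl.isOpen_compl
  have hmem : B.curve i 0 ∈ O := by
    simp only [hO, mem_compl_iff, mem_iUnion, not_exists]
    rintro j hj ⟨s, -, hs⟩
    exact B.curve_ne i j (Finset.ne_of_mem_erase hj) s 0 (sub_eq_zero.2 hs)
  have hΦd : DifferentiableOn ℂ Φ O := by
    intro z hz
    refine DifferentiableAt.differentiableWithinAt ?_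
    refine DifferentiableAt.fun_sum fun j hj => ?_
    refine (ct_hasDerivAt (B.curve_cont j).continuousOn ((hPc j).mul (B.dcurve_cont j)).continuousOn ?_).differentiableAt
    intro h
    exact hz (mem_biUnion hj h)
  obtain ⟨r, hr, hball⟩ := Metric.isOpen_iff.1 hOo _ hmem
  obtain ⟨δ₀, hδ0, hδ⟩ := B.collar_sides hK hconn
  have hev : ∀ σ : ℝ, ∀ᶠ ε in 𝓝[>] (0:ℝ), B.nb i (σ * ε) 0 ∈ ball (B.curve i 0) r :=
    fun σ => (B.nb_tendsto i σ 0).eventually (Metric.ball_mem_nhds _ hr)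
  obtain ⟨ε, ⟨h1, h2⟩, h3⟩ := (((hev 1).and (hev (-1))).and (Ioo_mem_nhdsGT hδ0)).exists
  obtain ⟨hz1, hz2⟩ := hδ ε h3.1 h3.2 i 0
  set zo := B.nb i (1 * ε) 0
  set zi := B.nb i (-1 * ε) 0
  have hin : ∀ z ∈ interior K, Φ z = 2 * Real.pi * Complex.I * κ := by
    intro z hz
    have := B.cauchy_out hK hconn hP (z := z) (fun h => h.2 hz)
    rw [B.W_int hz] at this
    rw [← hΦcb]; linear_combination this
  have hΦan : AnalyticOnNhd ℂ Φ (ball (B.curve i 0) r) := (hΦd.mono hball).analyticOnNhd isOpen_ball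
  have heq := hΦan.eqOn_of_preconnected_of_eventuallyEq (analyticOnNhd_const (v := 2 * Real.pi * Complex.I * κ))
    (convex_ball _ _).isPreconnected h2 (by
      filter_upwards [isOpen_interior.mem_nhds hz2] with z hz using hin z hz)
  have hPan : AnalyticOnNhd ℂ P Kᶜ := g2.analyticOnNhd hopen
  have hP0 := hPan.eqOn_zero_of_preconnected_of_eventuallyEq_zero hconn.isPreconnected hz1 (by
    filter_upwards [hopen.mem_nhds hz1, isOpen_ball.mem_nhds h1] with z hz hzb
    have e1 := heq hzb
    have e2 := B.cauchy_out_compl hK hconn hP hz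
    rw [hΦcb, e1] at e2
    simp only at e2
    have e3 : (2 * Real.pi * Complex.I) * P z = 0 := by linear_combination e2
    exact (mul_eq_zero.1 e3).resolve_left two_pi_I_ne)
  have : Tendsto P (cobounded ℂ) (𝓝 0) := by
    refine tendsto_const_nhds.congr' ?_
    filter_upwards [compl_cobounded hK] with z hz using (hP0 hz).symm
  exact hκ (tendsto_nhds_unique g3 this)

theorem hurwitz (hK : IsCompact K) (hconn : IsConnected Kᶜ) {P R : ℂ → ℂ} {κ : ℂ} (hκ : κ ≠ 0)
    (hP : MemA K P κ) (hR : DifferentiableOn ℂ R Kᶜ) {ε₀ : ℝ} (hε₀ : 0 < ε₀)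
    (h : ∀ ε : ℝ, 0 < ε → ε < ε₀ → ∀ z ∈ Kᶜ, P z + ε * R z ≠ 0) : ∀ z ∈ Kᶜ, P z ≠ 0 := by
  intro z₀ hz₀ h0
  obtain ⟨g1, g2, g3⟩ := (memA_iff hK).1 hP
  have hopen : IsOpen Kᶜ := hK.isClosed.isOpen_compl
  have hPan : AnalyticOnNhd ℂ P Kᶜ := g2.analyticOnNhd hopen
  have hnz : ∀ᶠ z in 𝓝[≠] z₀, P z ≠ 0 := by
    rcases (hPan z₀ hz₀).eventually_eq_zero_or_eventually_ne_zero with h1 | h1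
    · exfalso
      have hP0 := hPan.eqOn_zero_of_preconnected_of_eventuallyEq_zero hconn.isPreconnected hz₀ h1
      have : Tendsto P (cobounded ℂ) (𝓝 0) := by
        refine tendsto_const_nhds.congr' ?_
        filter_upwards [compl_cobounded hK] with z hz using (hP0 hz).symm
      exact hκ (tendsto_nhds_unique g3 this)
    · exact h1
  rw [eventually_nhdsWithin_iff] at hnz
  obtain ⟨r, hr, hball⟩ := Metric.eventually_nhds_iff_ball.1 (hnz.and (hopen.mem_nhds hz₀))
  have hcb : closedBall z₀ (r / 2) ⊆ Kᶜ := fun z hz => (hball z (closedBall_subset_ball (by linarith) hz)).2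
  have hsph : sphere z₀ (r / 2) ⊆ Kᶜ := sphere_subset_closedBall.trans hcb
  obtain ⟨w, hw, hmin⟩ := (isCompact_sphere z₀ (r / 2)).exists_isMinOn (NormedSpace.sphere_nonempty.2 (by linarith))
    (f := fun z => ‖P z‖) (g2.continuousOn.mono hsph).norm
  obtain ⟨b, hb⟩ := (isCompact_sphere z₀ (r / 2)).exists_bound_of_continuousOn (hR.continuousOn.mono hsph)
  have hwn : w ≠ z₀ := by
    rintro rfl
    simp at hw
    linarith
  have ha : 0 < ‖P w‖ := norm_pos_iff.2 ((hball w (closedBall_subset_ball (by linarith) (sphere_subset_closedBall hw))).1 hwn)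
  set a := ‖P w‖ with hadef
  have hb0 : 0 ≤ b := (norm_nonneg _).trans (hb w hw)
  have hbd : ∀ᶠ ε : ℝ in 𝓝[>] 0, a / 2 ≤ ε * ‖R z₀‖ := by
    have e1 : ∀ᶠ ε : ℝ in 𝓝[>] 0, ε * b < a / 2 := by
      have : Tendsto (fun ε : ℝ => ε * b) (𝓝[>] 0) (𝓝 (0 * b)) :=
        ((continuous_id.mul continuous_const).tendsto 0).mono_left nhdsWithin_le_nhds
      rw [zero_mul] at this
      exact this.eventually (gt_mem_nhds (by linarith))
    filter_upwards [e1, Ioo_mem_nhdsGT hε₀] with ε he hε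
    have hd : DiffContOnCl ℂ (fun z => (P z + ε * R z)⁻¹) (ball z₀ (r / 2)) := by
      refine DifferentiableOn.diffContOnCl ?_
      rw [closure_ball _ (by linarith)]
      refine DifferentiableOn.inv ((g2.mono hcb).add ((differentiableOn_const _).mul (hR.mono hcb))) ?_
      exact fun z hz => h ε hε.1 hε.2 z (hcb hz)
    have hle := Complex.norm_le_of_forall_mem_frontier_norm_le isBounded_ball hd (C := (a / 2)⁻¹) (by
      intro z hz
      rw [frontier_ball _ (by linarith)] at hz
      rw [norm_inv]
      refine inv_anti₀ (by linarith) ?_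
      have m1 : a ≤ ‖P z‖ := hmin hz
      have m2 : ‖(ε : ℂ) * R z‖ ≤ ε * b := by
        rw [norm_mul, Complex.norm_real, Real.norm_of_nonneg hε.1.le]
        exact mul_le_mul_of_nonneg_left (hb z hz) hε.1.le
      have m3 := norm_sub_le (P z + ε * R z) (ε * R z)
      rw [add_sub_cancel_right] at m3
      linarith) (subset_closure (mem_ball_self (by linarith : 0 < r / 2)))
    rw [h0, zero_add, norm_inv, norm_mul, Complex.norm_real, Real.norm_of_nonneg hε.1.le] at hle
    have hpos : 0 < ε * ‖R z₀‖ := by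
      have := h ε hε.1 hε.2 z₀ hz₀
      rw [h0, zero_add] at this
      exact mul_pos hε.1 (norm_pos_iff.2 (right_ne_zero_of_mul this))
    exact (inv_le_inv₀ hpos (by linarith)).1 hle
  have hlim : Tendsto (fun ε : ℝ => ε * ‖R z₀‖) (𝓝[>] 0) (𝓝 (0 * ‖R z₀‖)) :=
    ((continuous_id.mul continuous_const).tendsto 0).mono_left nhdsWithin_le_nhds
  have := ge_of_tendsto hlim hbd
  rw [zero_mul] at this
  linarith

theorem zero_free (hK : IsCompact K) (hconn : IsConnected Kᶜ) {P : ℂ → ℂ} {κ : ℂ} (hκ : κ ≠ 0)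
    (hP : MemA K P κ) (x : Fin B.n → ℝ → ℝ) (hx : ∀ i, ContDiff ℝ ∞ (x i))
    (hPx : ∀ i t, P (B.curve i t) * B.E i t = x i t) : ∀ z ∈ Kᶜ, P z ≠ 0 := by
  obtain ⟨g1, g2, g3⟩ := (memA_iff hK).1 hP
  have h1 : ∀ i, ∃ c, x i c ≠ 0 := by
    intro i
    obtain ⟨t, ht⟩ := B.not_zero_curve hK hconn hκ hP i
    refine ⟨t, fun h => ?_⟩
    have := hPx i t
    rw [h, Complex.ofReal_zero] at this
    exact ht ((mul_eq_zero.1 this).resolve_right (B.E_ne i t))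
  choose c hc using h1
  let σ : Fin B.n → ℝ := fun i => x i (c i)
  obtain ⟨R, X, hR, hX, hRX⟩ := B.riemann_hilbert hK hconn (fun i t => σ i * Real.sin (Real.pi * (t - c i)))
    (fun i => contDiff_const.mul (Real.contDiff_sin.comp (by fun_prop))) (fun i t => by
      rw [show Real.pi * (t + 1 - c i) = Real.pi * (t - c i) + Real.pi by ring, Real.sin_add_pi]; ring)
  obtain ⟨r1, r2, r3⟩ := (memA_iff hK).1 hR
  have hev : ∀ᶠ ε : ℝ in 𝓝[>] 0, ∀ i, 0 < σ i * (x i (c i) + ε * X i (c i)) := by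
    rw [eventually_all]
    intro i
    have : Tendsto (fun ε : ℝ => σ i * (x i (c i) + ε * X i (c i))) (𝓝[>] 0) (𝓝 (σ i * (x i (c i) + 0 * X i (c i)))) := by
      have c : Continuous fun ε : ℝ => σ i * (x i (c i) + ε * X i (c i)) := by fun_prop
      exact (c.tendsto 0).mono_left nhdsWithin_le_nhds
    refine this.eventually (lt_mem_nhds ?_)
    rw [zero_mul, add_zero]
    exact mul_self_pos.2 (hc i)
  obtain ⟨ε₀, hε₀, hsub⟩ := mem_nhdsGT_iff_exists_Ioo_subset.1 hev
  refine hurwitz hK hconn hκ hP r2 (ε₀ := ε₀) hε₀ ?_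
  intro ε h1 h2
  have hG : MemA K (fun z => P z + ε * R z) κ := by
    rw [memA_iff hK]
    refine ⟨g1.add (continuousOn_const.mul r1), g2.add ((differentiableOn_const _).mul r2), ?_⟩
    simpa using g3.add (r3.const_mul (ε : ℂ))
  refine B.zero_free_pert hK hconn hκ hG
    (fun i t => ((x i t + ε * X i t : ℝ) : ℂ) + ((ε * (σ i * Real.sin (Real.pi * (t - c i))) : ℝ) : ℂ) * Complex.I)
    (fun i => ?_) ?_ c σ ?_ ?_
  · refine (ofReal_smooth ((hx i).add (contDiff_const.mul (hX i)))).add ((ofReal_smooth (contDiff_const.mul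
      (contDiff_const.mul (Real.contDiff_sin.comp (by fun_prop))))).mul contDiff_const)
  · intro i t
    have e1 := hPx i t
    have e2 := hRX i t
    push_cast
    push_cast at e2
    linear_combination e1 + ε * e2
  · intro i
    have := hsub ⟨h1, h2⟩ i
    simpa using this
  · intro i t ht
    have hs : 0 < Real.sin (Real.pi * (t - c i)) := by
      apply Real.sin_pos_of_pos_of_lt_pi
      · exact mul_pos Real.pi_pos (by linarith [ht.1])
      · have : t - c i < 1 := by linarith [ht.2]
        nlinarith [Real.pi_pos]
    have e : (((x i t + ε * X i t : ℝ) : ℂ) + ((ε * (σ i * Real.sin (Real.pi * (t - c i))) : ℝ) : ℂ) * Complex.I).im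
      = ε * (σ i * Real.sin (Real.pi * (t - c i))) := by
      simp only [Complex.add_im, Complex.ofReal_im, Complex.mul_I_im, Complex.ofReal_re, zero_add]
    rw [e]
    have h3 : 0 < σ i * σ i := mul_self_pos.2 (hc i)
    have : σ i * (ε * (σ i * Real.sin (Real.pi * (t - c i)))) = σ i * σ i * (ε * Real.sin (Real.pi * (t - c i))) := by ring
    rw [this]
    positivity

end SmoothBoundary

theorem mul_at_inf {f g : ℂ → ℂ} {lf wf lg wg : ℂ} (hf : Tendsto (fun z => z * (f z - lf)) (cobounded ℂ) (𝓝 wf))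
    (hg : Tendsto (fun z => z * (g z - lg)) (cobounded ℂ) (𝓝 wg)) (hg0 : Tendsto g (cobounded ℂ) (𝓝 lg)) :
    Tendsto (fun z => z * (f z * g z - lf * lg)) (cobounded ℂ) (𝓝 (wf * lg + lf * wg)) := by
  refine ((hf.mul hg0).add (hg.const_mul lf)).congr fun z => ?_
  ring

theorem memA_mul {K : Set ℂ} {f g : ℂ → ℂ} {a b : ℂ} (hf : MemA K f a) (hg : MemA K g b) :
    MemA K (fun z => f z * g z) (a * b) :=
  ⟨hf.1.mul hg.1, hf.2.1.mul hg.2.1, hf.2.2.mul hg.2.2⟩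

theorem memA_add {K : Set ℂ} {f g : ℂ → ℂ} {a b : ℂ} (hf : MemA K f a) (hg : MemA K g b) :
    MemA K (fun z => f z + g z) (a + b) :=
  ⟨hf.1.add hg.1, hf.2.1.add hg.2.1, hf.2.2.add hg.2.2⟩

theorem memA_const {K : Set ℂ} (a : ℂ) : MemA K (fun _ => a) a :=
  ⟨continuousOn_const, differentiableOn_const _, tendsto_const_nhds⟩

theorem memA_smul {K : Set ℂ} {f : ℂ → ℂ} {a : ℂ} (c : ℂ) (hf : MemA K f a) :
    MemA K (fun z => c * f z) (c * a) := memA_mul (memA_const c) hf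

namespace SmoothBoundary
variable {K : Set ℂ} (B : SmoothBoundary K)

/-- Solutions of the real boundary value problem with prescribed value at infinity. -/
theorem exists_real (hK : IsCompact K) (hconn : IsConnected Kᶜ) (κ : ℂ) :
    ∃ (P : ℂ → ℂ) (x : Fin B.n → ℝ → ℝ), MemA K P κ ∧ (∀ i, ContDiff ℝ ∞ (x i)) ∧
      ∀ i t, P (B.curve i t) * B.E i t = x i t := by
  have hs : ∀ i, ContDiff ℝ ∞ fun t => κ * B.E i t := fun i => contDiff_const.mul (B.E_smooth i)
  obtain ⟨R, X, hR, hX, hRX⟩ := B.riemann_hilbert hK hconn (fun i t => - (κ * B.E i t).im)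
    (fun i => (im_smooth (hs i)).neg) (fun i t => by
      simp only [E_add_one, mul_neg, Complex.neg_im])
  refine ⟨fun z => κ + R z, fun i t => X i t + (κ * B.E i t).re, ?_, fun i => (hX i).add (re_smooth (hs i)), ?_⟩
  · simpa using memA_add (memA_const (K := K) κ) hR
  · intro i t
    have h2 := hRX i t
    rw [add_mul, h2]
    nth_rw 1 [← Complex.re_add_im (κ * B.E i t)]
    push_cast
    ring

/-- Contour integrals of real data are real. -/
theorem contour_real {P Q : ℂ → ℂ} {x y : Fin B.n → ℝ → ℝ}
    (hP : ∀ i t, P (B.curve i t) * B.E i t = x i t) (hQ : ∀ i t, Q (B.curve i t) * B.E i t = y i t) :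
    ∃ r : ℝ, contourIntegralOf B.curve (fun z => P z * Q z) = r := by
  refine ⟨∑ i, ∫ t in (0:ℝ)..1, x i t * y i t, ?_⟩
  unfold contourIntegralOf
  push_cast
  refine Finset.sum_congr rfl fun i _ => ?_
  rw [← intervalIntegral.integral_ofReal]
  refine intervalIntegral.integral_congr fun t _ => ?_
  rw [← E_sq]
  push_cast
  rw [← hP, ← hQ]; ring

theorem re_deriv_zero (r : ℝ) : ((2 * Real.pi * Complex.I)⁻¹ * (r : ℂ)).re = 0 := by
  have : ((2 * Real.pi * Complex.I)⁻¹ * (r : ℂ)) = ((-(2 * Real.pi)⁻¹ * r : ℝ) : ℂ) * Complex.I := by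
    rw [mul_inv, Complex.inv_I]; push_cast; ring
  rw [this]; simp

theorem product_re (hK : IsCompact K) (hconn : IsConnected Kᶜ) {P Q : ℂ → ℂ} {p q a b : ℂ}
    (hP : MemA K P p) (hQ : MemA K Q q)
    {x y : Fin B.n → ℝ → ℝ}
    (hPx : ∀ i t, P (B.curve i t) * B.E i t = x i t) (hQy : ∀ i t, Q (B.curve i t) * B.E i t = y i t)
    (ha : Tendsto (fun z => z * (P z - p)) (cobounded ℂ) (𝓝 a))
    (hb : Tendsto (fun z => z * (Q z - q)) (cobounded ℂ) (𝓝 b)) : (a * q + p * b).re = 0 := by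
  have h1 := mul_at_inf ha hb ((memA_iff hK).1 hQ).2.2
  have h2 := B.out_deriv hK hconn (memA_mul hP hQ)
  obtain ⟨r, hr⟩ := B.contour_real hPx hQy
  rw [tendsto_nhds_unique h1 h2, hr]
  exact re_deriv_zero r

/-- The pair `q`, `S`. -/
theorem exists_pair (hK : IsCompact K) (hconn : IsConnected Kᶜ) :
    ∃ q S : ℂ → ℂ, MemA K q 1 ∧ MemA K S 0 ∧
      (∀ i t, S (B.curve i t) * B.E i t = (starRingEnd ℂ) (q (B.curve i t) * B.E i t)) ∧
      Tendsto (fun z => z * (q z - 1)) (cobounded ℂ) (𝓝 0) ∧ ∀ z ∈ Kᶜ, ‖S z‖ < ‖q z‖ := by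
  obtain ⟨P, x, hP, hx, hPx⟩ := B.exists_real hK hconn 1
  obtain ⟨Q, y, hQ, hy, hQy⟩ := B.exists_real hK hconn Complex.I
  have hq : MemA K (fun z => (1/2) * (P z + (-Complex.I) * Q z)) 1 := by
    have := memA_smul (1/2) (memA_add hP (memA_smul (-Complex.I) hQ))
    have e : (1/2 : ℂ) * (1 + (-Complex.I) * Complex.I) = 1 := by
      rw [neg_mul, Complex.I_mul_I]; norm_num
    rwa [e] at this
  have hS : MemA K (fun z => (1/2) * (P z + Complex.I * Q z)) 0 := by
    have := memA_smul (1/2) (memA_add hP (memA_smul Complex.I hQ))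
    have e : (1/2 : ℂ) * (1 + Complex.I * Complex.I) = 0 := by
      rw [Complex.I_mul_I]; norm_num
    rwa [e] at this
  refine ⟨_, _, hq, hS, ?_, ?_, ?_⟩
  · intro i t
    have e1 : (1/2) * (P (B.curve i t) + Complex.I * Q (B.curve i t)) * B.E i t
      = (1/2) * (P (B.curve i t) * B.E i t + Complex.I * (Q (B.curve i t) * B.E i t)) := by ring
    have e2 : (1/2) * (P (B.curve i t) + -Complex.I * Q (B.curve i t)) * B.E i t
      = (1/2) * (P (B.curve i t) * B.E i t - Complex.I * (Q (B.curve i t) * B.E i t)) := by ring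
    rw [e1, e2, hPx, hQy]
    apply Complex.ext <;> simp
  · have ha := B.out_deriv hK hconn hP
    have hb := B.out_deriv hK hconn hQ
    set a := (2 * Real.pi * Complex.I)⁻¹ * contourIntegralOf B.curve P
    set b := (2 * Real.pi * Complex.I)⁻¹ * contourIntegralOf B.curve Q
    have h1 := B.product_re hK hconn hP hP hPx hPx ha ha
    have h2 := B.product_re hK hconn hQ hQ hQy hQy hb hb
    have h3 := B.product_re hK hconn hP hQ hPx hQy ha hb
    simp at h1 h2 h3
    have hab : (1/2) * (a + (-Complex.I) * b) = 0 := by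
      apply Complex.ext <;> simp <;> linarith
    rw [← hab]
    refine ((ha.add (hb.const_mul (-Complex.I))).const_mul (1/2)).congr fun z => ?_
    linear_combination ((1/2) * z) * Complex.I_mul_I
  · have hzf : ∀ α β : ℝ, (α : ℂ) + β * Complex.I ≠ 0 → ∀ z ∈ Kᶜ, (α : ℂ) * P z + β * Q z ≠ 0 := by
      intro α β h
      refine B.zero_free hK hconn (P := fun z => (α : ℂ) * P z + β * Q z) (κ := α + β * Complex.I) h ?_
        (fun i t => α * x i t + β * y i t)
        (fun i => (contDiff_const.mul (hx i)).add (contDiff_const.mul (hy i))) ?_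
      · simpa using memA_add (memA_smul α hP) (memA_smul β hQ)
      · intro i t
        push_cast
        rw [← hPx, ← hQy]; ring
    have hne : ∀ z ∈ Kᶜ, ‖(1/2) * (P z + Complex.I * Q z)‖ ≠ ‖(1/2) * (P z + -Complex.I * Q z)‖ := by
      intro z hz h
      have hP0 : P z ≠ 0 := by
        have := hzf 1 0 (by simp) z hz
        simpa using this
      -- `Q/P` is real
      have h1 : ‖P z + Complex.I * Q z‖ = ‖P z + -Complex.I * Q z‖ := by
        rw [norm_mul, norm_mul] at h
        exact mul_left_cancel₀ (by norm_num) h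
      have h2 : ‖1 + Complex.I * (Q z / P z)‖ = ‖1 + -Complex.I * (Q z / P z)‖ := by
        have e1 : 1 + Complex.I * (Q z / P z) = (P z + Complex.I * Q z) / P z := by field_simp
        have e2 : 1 + -Complex.I * (Q z / P z) = (P z + -Complex.I * Q z) / P z := by field_simp
        rw [e1, e2, norm_div, norm_div, h1]
      have h3 : (Q z / P z).im = 0 := by
        have := congrArg (fun r : ℝ => r ^ 2) h2
        simp only [← Complex.normSq_eq_norm_sq, Complex.normSq_apply] at this
        simp at this
        linarith
      refine hzf (-(Q z / P z).re) 1 (fun h0 => by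
        have := congrArg Complex.im h0
        simp at this) z hz ?_
      have h4 : ((Q z / P z).re : ℂ) = Q z / P z := Complex.ext (by simp) (by simp [h3])
      push_cast
      rw [h4]; field_simp; ring
    intro z hz
    have hcS : ContinuousOn (fun z => ‖(1/2) * (P z + Complex.I * Q z)‖) Kᶜ := hS.2.1.continuousOn.norm
    have hcq : ContinuousOn (fun z => ‖(1/2) * (P z + -Complex.I * Q z)‖) Kᶜ := hq.2.1.continuousOn.norm
    have h1 := ((memA_iff hK).1 hS).2.2.norm
    have h2 := ((memA_iff hK).1 hq).2.2.norm
    have hev := (h1.eventually_lt h2 (by simp)).and (compl_cobounded hK)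
    obtain ⟨w, hw, hwK⟩ := hev.exists
    by_contra hcon
    push Not at hcon
    obtain ⟨v, hv, hvv⟩ := hconn.isPreconnected.intermediate_value₂ hwK hz hcS hcq hw.le hcon
    exact hne v hv hvv

end SmoothBoundary

namespace SmoothBoundary
variable {K : Set ℂ} (B : SmoothBoundary K)

/-- Absolute integral over parallel curves. -/
def Mint (h : ℂ → ℂ) (ε : ℝ) : ℝ := ∑ i, ∫ t in (0:ℝ)..1, ‖h (B.nb i ε t)‖ * ‖B.dnb i ε t‖

theorem Mint_zero (h : ℂ → ℂ) : B.Mint h 0 = arcIntegralOf B.curve (fun ζ => ‖h ζ‖) := by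
  unfold Mint arcIntegralOf
  simp only [nb_zero, dnb_zero]

theorem Mint_cont (σ δ₁ : ℝ) {A : Set ℂ} {G : ℂ → ℂ} (hG : ContinuousOn G A)
    (hA : ∀ ε, 0 ≤ ε → ε < δ₁ → ∀ i t, B.nb i (σ * ε) t ∈ A) (hδ : 0 < δ₁) :
    Tendsto (fun ε : ℝ => B.Mint G (σ * ε)) (𝓝[>] 0) (𝓝 (arcIntegralOf B.curve (fun ζ => ‖G ζ‖))) := by
  have h : ContinuousOn (fun ε : ℝ => B.Mint G (σ * ε)) (Ico 0 δ₁) := by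
    unfold Mint
    refine continuousOn_finsetSum _ fun i _ => ?_
    have := param_cont (fun (ε : ℝ) t => ((‖G (B.nb i (σ * ε) t)‖ * ‖B.dnb i (σ * ε) t‖ : ℝ) : ℂ))
      (Ico 0 δ₁) zero_le_one (by
        refine Complex.continuous_ofReal.comp_continuousOn ?_
        refine ContinuousOn.mul (ContinuousOn.norm (hG.comp ?_ ?_)) (ContinuousOn.norm ?_)
        · exact ((B.nb_cont i).comp (by fun_prop : Continuous fun p : ℝ × ℝ => (σ * p.1, p.2))).continuousOn
        · rintro ⟨ε, t⟩ ⟨hε, -⟩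
          exact hA ε hε.1 hε.2 i t
        · exact ((B.dnb_cont i).comp (by fun_prop : Continuous fun p : ℝ × ℝ => (σ * p.1, p.2))).continuousOn)
    have h2 := Complex.continuous_re.comp_continuousOn this
    refine h2.congr fun ε _ => ?_
    simp only [Function.comp]
    rw [intervalIntegral.integral_ofReal, Complex.ofReal_re]
  have h1 := h 0 ⟨le_refl _, hδ⟩
  have h2 := h1.tendsto
  rw [mul_zero, Mint_zero] at h2
  refine h2.mono_left ?_
  rw [← nhdsWithin_Ioo_eq_nhdsGT hδ]
  exact nhdsWithin_mono _ Ioo_subset_Ico_self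

theorem Nint_le_Mint {f G : ℂ → ℂ} {ε : ℝ} (hf : ∀ i t, ‖f (B.nb i ε t)‖ ≤ 1)
    (hG : ∀ i, Continuous fun t => G (B.nb i ε t)) :
    ‖B.Nint (fun z => f z * G z) ε‖ ≤ B.Mint G ε := by
  unfold Nint Mint
  refine (norm_sum_le _ _).trans (Finset.sum_le_sum fun i _ => ?_)
  refine intervalIntegral.norm_integral_le_of_norm_le zero_le_one ?_ ?_
  · refine Filter.Eventually.of_forall fun t _ => ?_
    rw [norm_mul, norm_mul]
    gcongr
    exact mul_le_of_le_one_left (norm_nonneg _) (hf i t)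
  · exact ((hG i).norm.mul (B.dnb_cont1 i ε).norm).intervalIntegrable _ _

theorem garabedian (hK : IsCompact K) (hconn : IsConnected Kᶜ) :
    ∃ ψ : ℂ → ℂ,
      MemA K ψ (1 / (2 * Real.pi * Complex.I)) ∧
      (∀ (g : ℂ → ℂ) (l : ℂ), MemA K g l →
        Tendsto (fun z => z * (g z - l)) (cobounded ℂ ⊓ 𝓟 Kᶜ)
          (𝓝 (contourIntegralOf B.curve fun ζ => g ζ * ψ ζ))) ∧
      arcIntegralOf B.curve (fun ζ => ‖ψ ζ‖) = analyticCapacity K ∧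
      ∃ q : ℂ → ℂ, MemA K q 1 ∧
        ∀ z ∈ (interior K)ᶜ, q z ^ 2 = 2 * Real.pi * Complex.I * ψ z := by
  obtain ⟨q, S, hq, hS, hSq, hq', hlt⟩ := B.exists_pair hK hconn
  have h2π := two_pi_I_ne
  have hq0 := ((memA_iff hK).1 hq).2.2
  have hS0 := ((memA_iff hK).1 hS).2.2
  have hq2 : MemA K (fun z => q z * q z) 1 := by simpa using memA_mul hq hq
  have hq2' : Tendsto (fun z => z * (q z * q z - 1)) (cobounded ℂ) (𝓝 0) := by
    simpa using mul_at_inf hq' hq' hq0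
  have hψ : MemA K (fun z => (2 * Real.pi * Complex.I)⁻¹ * (q z * q z)) (1 / (2 * Real.pi * Complex.I)) := by
    rw [one_div]
    simpa using memA_smul (2 * Real.pi * Complex.I)⁻¹ hq2
  have hs := B.out_deriv hK hconn hS
  set s := (2 * Real.pi * Complex.I)⁻¹ * contourIntegralOf B.curve S with hsdef
  set A := arcIntegralOf B.curve (fun ζ => ‖q ζ * q ζ‖) with hA
  have hA0 : 0 ≤ A := by
    rw [hA]; unfold arcIntegralOf
    exact Finset.sum_nonneg fun i _ => intervalIntegral.integral_nonneg zero_le_one fun t _ => by positivity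
  have hAc : (A : ℂ) = contourIntegralOf B.curve (fun z => S z * q z) := by
    rw [hA]
    unfold arcIntegralOf contourIntegralOf
    push_cast
    refine Finset.sum_congr rfl fun i _ => ?_
    rw [← intervalIntegral.integral_ofReal]
    refine intervalIntegral.integral_congr fun t _ => ?_
    beta_reduce
    rw [← E_sq]
    have e : S (B.curve i t) * q (B.curve i t) * B.E i t ^ 2 =
      (q (B.curve i t) * B.E i t) * (S (B.curve i t) * B.E i t) := by ring
    rw [e, hSq, Complex.mul_conj, Complex.normSq_eq_norm_sq]
    congr 1
    simp only [norm_mul, norm_pow]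
    ring
  have hsA : s = (2 * Real.pi * Complex.I)⁻¹ * A := by
    have h1 := mul_at_inf hs hq' hq0
    have h2 := B.out_deriv hK hconn (memA_mul hS hq)
    have h3 := tendsto_nhds_unique h1 h2
    rw [hAc, ← h3]; ring
  have hnorm : ‖(2 * Real.pi * Complex.I : ℂ)⁻¹‖ = (2 * Real.pi)⁻¹ := by
    simp [abs_of_pos Real.pi_pos]
    try ring
  have hsn : ‖s‖ = (2 * Real.pi)⁻¹ * A := by
    rw [hsA, norm_mul, hnorm, Complex.norm_real, Real.norm_of_nonneg hA0]
  have harc : arcIntegralOf B.curve (fun ζ => ‖(2 * Real.pi * Complex.I)⁻¹ * (q ζ * q ζ)‖)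
      = (2 * Real.pi)⁻¹ * A := by
    rw [hA]
    unfold arcIntegralOf
    rw [Finset.mul_sum]
    refine Finset.sum_congr rfl fun i _ => ?_
    rw [← intervalIntegral.integral_const_mul]
    refine intervalIntegral.integral_congr fun t _ => ?_
    beta_reduce
    rw [norm_mul, hnorm, mul_assoc]
  obtain ⟨δ₀, hδ0, hN, hgl⟩ := B.out_tendsto_nb hK hconn
  have hub : ∀ r ∈ { r : ℝ | ∃ (f : ℂ → ℂ) (l w : ℂ),
      DifferentiableOn ℂ f Kᶜ ∧ (∀ z ∈ Kᶜ, ‖f z‖ ≤ 1) ∧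
      HasDerivAtInftyOn f Kᶜ l w ∧ r = ‖w‖ }, r ≤ (2 * Real.pi)⁻¹ * A := by
    rintro r ⟨f, l, w, hf, hf1, ⟨hfl, hfw⟩, rfl⟩
    rw [cobounded_inf hK] at hfl hfw
    have ht : Tendsto (fun ε : ℝ => (2 * Real.pi)⁻¹ * B.Mint (fun z => q z * q z) (1 * ε)) (𝓝[>] 0)
        (𝓝 ((2 * Real.pi)⁻¹ * A)) := by
      refine (B.Mint_cont 1 δ₀ hq2.1 (fun ε a b i t => ?_) hδ0).const_mul _
      rcases a.eq_or_lt with h | h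
      · rw [← h, mul_zero, nb_zero]; exact B.curve_notMem_int i t
      · exact fun h' => hN ε h b i t (interior_subset h')
    refine ge_of_tendsto ht ?_
    filter_upwards [Ioo_mem_nhdsGT hδ0] with ε hε
    have h1 := mul_at_inf hfw hq2' ((memA_iff hK).1 hq2).2.2
    have hlim : Tendsto (fun z => f z * (q z * q z)) (cobounded ℂ) (𝓝 (l * 1)) :=
      hfl.mul ((memA_iff hK).1 hq2).2.2
    have h2 := hgl (fun z => f z * (q z * q z)) (l * 1) (hf.mul hq2.2.1) hlim ε hε.1 hε.2
    have h3 := tendsto_nhds_unique h1 h2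
    have h4 : w = (2 * Real.pi * Complex.I)⁻¹ * B.Nint (fun z => f z * (q z * q z)) (1 * ε) := by
      rw [← h3]; ring
    rw [h4, norm_mul, hnorm]
    refine mul_le_mul_of_nonneg_left ?_ (by positivity)
    refine B.Nint_le_Mint (fun i t => hf1 _ (hN ε hε.1 hε.2 i t)) fun i => ?_
    exact hq2.2.1.continuousOn.comp_continuous (B.nb_cont1 i _) (fun t => hN ε hε.1 hε.2 i t)
  have hmem : (2 * Real.pi)⁻¹ * A ∈ { r : ℝ | ∃ (f : ℂ → ℂ) (l w : ℂ),
      DifferentiableOn ℂ f Kᶜ ∧ (∀ z ∈ Kᶜ, ‖f z‖ ≤ 1) ∧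
      HasDerivAtInftyOn f Kᶜ l w ∧ r = ‖w‖ } := by
    have hqne : ∀ z ∈ Kᶜ, q z ≠ 0 := fun z hz h => by
      have := hlt z hz
      rw [h, norm_zero] at this
      exact absurd this (not_lt.2 (norm_nonneg _))
    refine ⟨fun z => S z / q z, 0, s, hS.2.1.div hq.2.1 hqne, fun z hz => ?_, ?_, hsn.symm⟩
    · rw [norm_div]
      exact div_le_one_of_le₀ (hlt z hz).le (norm_nonneg _)
    · unfold HasDerivAtInftyOn
      rw [cobounded_inf hK]
      constructor
      · have h0 := hS0.div hq0 one_ne_zero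
        rw [zero_div] at h0
        exact h0
      · have := hs.div hq0 one_ne_zero
        rw [div_one] at this
        refine this.congr fun z => ?_
        simp only [sub_zero, Pi.div_apply]
        rw [mul_div_assoc]
  refine ⟨fun z => (2 * Real.pi * Complex.I)⁻¹ * (q z * q z), hψ, ?_, ?_, q, hq, ?_⟩
  · intro g l hg
    rw [cobounded_inf hK]
    have hgd := B.out_deriv hK hconn hg
    have h1 := mul_at_inf hgd hq2' ((memA_iff hK).1 hq2).2.2
    have h2 := B.out_deriv hK hconn (memA_mul hg hq2)
    have h3 := tendsto_nhds_unique h1 h2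
    have h4 : contourIntegralOf B.curve (fun ζ => g ζ * ((2 * Real.pi * Complex.I)⁻¹ * (q ζ * q ζ))) =
        (2 * Real.pi * Complex.I)⁻¹ * contourIntegralOf B.curve (fun z => g z * (q z * q z)) := by
      unfold contourIntegralOf
      rw [Finset.mul_sum]
      refine Finset.sum_congr rfl fun i _ => ?_
      rw [← intervalIntegral.integral_const_mul]
      refine intervalIntegral.integral_congr fun t _ => ?_
      beta_reduce
      ring
    rw [h4, ← h3]
    simpa using hgd
  · rw [harc]
    unfold analyticCapacity
    exact le_antisymm (le_csSup ⟨_, hub⟩ hmem) (csSup_le ⟨_, hmem⟩ hub)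
  · intro z _
    rw [mul_inv_cancel_left₀ h2π]; ring

end SmoothBoundary

/-- If `K ⊆ ℂ` is compact with `Ω = ℂ∞ ∖ K` a finitely connected domain with
`C^∞` boundary, then there is a Garabedian function `ψ` for `Ω`: (i) `ψ ∈ A(Ω)`;
(ii) `ψ(∞) = 1/(2πi)`; (iii) `g′(∞) = ∫_{∂Ω} g ψ dζ` for all `g ∈ A(Ω)`;
(iv) `∫_{∂Ω} |ψ| |dζ| = γ(K)`; (v) `ψ` has an analytic square root: there is `q ∈ A(Ω)` with
`q(∞) = 1` and `q² = 2πi ψ` on the closure of `Ω`. -/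
theorem exists_garabedian_smooth (K : Set ℂ) (hK : IsCompact K)
    (hconn : IsConnected Kᶜ) (B : SmoothBoundary K) :
    ∃ ψ : ℂ → ℂ,
      MemA K ψ (1 / (2 * Real.pi * Complex.I)) ∧
      (∀ (g : ℂ → ℂ) (l : ℂ), MemA K g l →
        Tendsto (fun z => z * (g z - l)) (cobounded ℂ ⊓ 𝓟 Kᶜ)
          (𝓝 (contourIntegralOf B.curve fun ζ => g ζ * ψ ζ))) ∧
      arcIntegralOf B.curve (fun ζ => ‖ψ ζ‖) = analyticCapacity K ∧
      ∃ q : ℂ → ℂ, MemA K q 1 ∧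
        ∀ z ∈ (interior K)ᶜ, q z ^ 2 = 2 * Real.pi * Complex.I * ψ z := by
  exact B.garabedian hK hconn
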